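/- The number of combinatorial isomorphism classes of orientable triangulated surfaces with exactly 10 vertices and Euler characteristic 0 (triangulations of the torus) is 2109. -/

import Mathlib

open scoped Classical

/-- A triangulated surface on the vertex set `Fin n`: a finite 2-dimensional simplicial
complex given by its set of triangles, which is connected, in which every vertex lies in
some triangle, every edge lies in exactly two triangles, and the link of every vertex is
a single cycle (encoded as: the link graph of every vertex is connected; together with the
condition that every edge lies in exactly two triangles this makes every vertex link a
single circle). -/
structure TriSurface (n : ℕ) where
  faces : Finset (Finset (Fin n))
  card_eq : ∀ f ∈ faces, f.card = 3
  vertex_mem : ∀ v : Fin n, ∃ f ∈ faces, v ∈ f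
  edge_two : ∀ u v : Fin n, u ≠ v → (∃ f ∈ faces, u ∈ f ∧ v ∈ f) →
      (faces.filter (fun f => u ∈ f ∧ v ∈ f)).card = 2
  conn : ∀ u v : Fin n,
      Relation.ReflTransGen (fun a b : Fin n => ∃ f ∈ faces, a ∈ f ∧ b ∈ f) u v
  link_cycle : ∀ v a b : Fin n,
      (∃ f ∈ faces, v ∈ f ∧ a ∈ f ∧ a ≠ v) →
      (∃ f ∈ faces, v ∈ f ∧ b ∈ f ∧ b ≠ v) →
      Relation.ReflTransGen
        (fun x y : Fin n => x ≠ y ∧ x ≠ v ∧ y ≠ v ∧ ({v, x, y} : Finset (Fin n)) ∈ faces)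
        a b

/-- The edges of a triangulated surface: all 2-element vertex sets contained in a triangle. -/
noncomputable def TriSurface.edges {n : ℕ} (S : TriSurface n) : Finset (Finset (Fin n)) :=
  Finset.univ.filter (fun e => e.card = 2 ∧ ∃ f ∈ S.faces, e ⊆ f)

/-- The Euler characteristic χ = f₀ - f₁ + f₂ of a triangulated surface. -/
noncomputable def TriSurface.eulerChar {n : ℕ} (S : TriSurface n) : ℤ :=
  (n : ℤ) - (S.edges.card : ℤ) + (S.faces.card : ℤ)

/-- Combinatorial isomorphism: a bijection of the vertices mapping triangles to triangles. -/
def TriSurface.Iso {n : ℕ} (S T : TriSurface n) : Prop :=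
  ∃ σ : Equiv.Perm (Fin n), ∀ f : Finset (Fin n), f ∈ S.faces ↔ f.image σ ∈ T.faces

/-- Orientability: each triangle can be given a cyclic orientation (recorded as the set of
its three induced directed edges) such that the two orientations induced on each edge by
the two triangles containing it are opposite (no directed edge is induced twice). -/
def TriSurface.Orientable {n : ℕ} (S : TriSurface n) : Prop :=
  ∃ ω : Finset (Fin n) → Finset (Fin n × Fin n),
    (∀ f ∈ S.faces, ∃ a b c : Fin n, a ≠ b ∧ a ≠ c ∧ b ≠ c ∧
        f = {a, b, c} ∧ ω f = {(a, b), (b, c), (c, a)}) ∧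
    (∀ f ∈ S.faces, ∀ g ∈ S.faces, f ≠ g → ∀ p ∈ ω f, p ∉ ω g)

/-- The edge `uv` is contractible: the only common neighbours of `u` and `v` are the two
vertices `w`, `z` with `uvw`, `uvz` triangles, and the edge `wz` is not contained in both
the link of `u` and the link of `v`. -/
def TriSurface.Contractible {n : ℕ} (S : TriSurface n) (u v : Fin n) : Prop :=
  ({u, v} : Finset (Fin n)) ∈ S.edges ∧
  (∀ w : Fin n, w ≠ u → w ≠ v →
      ({u, w} : Finset (Fin n)) ∈ S.edges → ({v, w} : Finset (Fin n)) ∈ S.edges →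
      ({u, v, w} : Finset (Fin n)) ∈ S.faces) ∧
  ¬ ∃ w z : Fin n, ({u, v, w} : Finset (Fin n)) ∈ S.faces ∧
      ({u, v, z} : Finset (Fin n)) ∈ S.faces ∧ w ≠ z ∧
      ({u, w, z} : Finset (Fin n)) ∈ S.faces ∧ ({v, w, z} : Finset (Fin n)) ∈ S.faces

/-- A triangulated surface is irreducible if it has no contractible edge. -/
def TriSurface.Irreducible {n : ℕ} (S : TriSurface n) : Prop :=
  ¬ ∃ u v : Fin n, S.Contractible u v

/-- The simplices of the complex: the nonempty subsets of triangles. -/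
def TriSurface.IsSimplex {n : ℕ} (S : TriSurface n) (σ : Finset (Fin n)) : Prop :=
  σ.Nonempty ∧ ∃ f ∈ S.faces, σ ⊆ f

/-- A geometric realization in ℝ³: each triangle is mapped to affinely independent points,
and the convex hulls of the point sets of any two simplices of the complex intersect
exactly in the convex hull of the points of their common vertices. -/
def TriSurface.IsRealization {n : ℕ} (S : TriSurface n) (p : Fin n → (Fin 3 → ℝ)) : Prop :=
  (∀ f ∈ S.faces, AffineIndependent ℝ (fun x : {x // x ∈ f} => p x.1)) ∧
  ∀ σ τ : Finset (Fin n), S.IsSimplex σ → S.IsSimplex τ →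
    convexHull ℝ (p '' ↑σ) ∩ convexHull ℝ (p '' ↑τ) = convexHull ℝ (p '' ↑(σ ∩ τ))

/-- Neighborly: every pair of distinct vertices forms an edge. -/
def TriSurface.Neighborly {n : ℕ} (S : TriSurface n) : Prop :=
  ∀ u v : Fin n, u ≠ v → ({u, v} : Finset (Fin n)) ∈ S.edges

namespace Tor

noncomputable section

/-! ### The search program -/

notation "sel(" b ";" t ";" e ")" => @Bool.rec (fun _ => _) e t b

/-- `force e k` is `k e`; the recursion makes the kernel evaluate `e` first. -/
def force {α : Type} (e : ℕ) (k : ℕ → α) : α :=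
  @Nat.rec (fun _ => α) (k 0) (fun m _ => k (Nat.succ m)) e

/-- Entry `(a, b)` of the table `t`. -/
def look (t a b : ℕ) : ℕ :=
  Nat.mod (Nat.shiftRight t (Nat.add (Nat.mul 64 a) (Nat.mul 4 b))) 16

/-- Entry `a` of the array `t`. -/
def nib (t a : ℕ) : ℕ := Nat.mod (Nat.shiftRight t (Nat.mul 4 a)) 16

/-- Xor entry `(a, b)` of the table `t` with `c`. -/
def put (t a b c : ℕ) : ℕ := Nat.xor t (Nat.shiftLeft c (Nat.add (Nat.mul 64 a) (Nat.mul 4 b)))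

/-- Enter the oriented triangle `(a, b, c)`. The unused row `0` receives a checksum, which makes
the tables differ in their low bits. -/
def put3 (t a b c : ℕ) : ℕ :=
  Nat.xor (put (put (put t a b c) b c a) c a b)
    (Nat.mod (Nat.pow 7 (Nat.add c (Nat.add (Nat.mul 16 b) (Nat.mul 256 a)))) 0x1fffffffffffffff)

/-- Xor entry `a` of the array `t` with `c`. -/
def put1 (t a c : ℕ) : ℕ := Nat.xor t (Nat.shiftLeft c (Nat.mul 4 a))

/-- Set entry `v` of the array `u` to `k`. -/
def setn (u v k : ℕ) : ℕ := put1 u v (Nat.xor (nib u v) k)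

/-- A list of oriented triangles. -/
inductive Path
  | nil
  | cons (a b c : ℕ) (p : Path)

/-- Reverse the first path and append the second one. -/
def Path.rev (p : Path) : Path → Path :=
  @Path.rec (fun _ => Path → Path) (fun q => q) (fun a b c _ ih q => ih (Path.cons a b c q)) p

/-- Walk around `v` until an open dart is met or the walk returns to `target`. -/
def walk {α : Type} (t v target : ℕ) (opn cl : ℕ → α) (fuel : ℕ) : ℕ → ℕ → α :=
  @Nat.rec (fun _ => ℕ → ℕ → α) (fun cur _ => opn cur)
    (fun _ ih cur k => force (look t v cur) fun nx =>
      sel(Nat.beq nx 0; opn cur; sel(Nat.beq nx target; cl k; ih nx (Nat.succ k)))) fuel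

/-- Is the path at most as large as the relabelled table? -/
def below (t p q : ℕ) (l : Path) : ℕ → ℕ → ℕ → Bool :=
  @Path.rec (fun _ => ℕ → ℕ → ℕ → Bool) (fun _ _ _ => true)
    (fun a b c _ ih s r n =>
      force (Nat.mod (Nat.shiftRight t
        (Nat.add (Nat.mul p (nib r a)) (Nat.mul q (nib r b)))) 16) fun x =>
      force (nib s x) fun m =>
        sel(Nat.beq m 0;
          sel(Nat.beq (Nat.succ n) c;
            force (put1 s x c) fun s => force (put1 r c x) fun r => ih s r c;
            Nat.ble c n);
          sel(Nat.beq m c; ih s r n; Nat.ble c m))) l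

/-- The number of nonzero entries in row `a`. -/
def rowdeg (t a : ℕ) : ℕ :=
  @Nat.rec (fun _ => ℕ) 0
    (fun x ih => sel(Nat.beq (look t a (Nat.succ x)) 0; ih; Nat.succ ih)) 10

/-- Does `f` hold on `1, …, n`? -/
def all (f : ℕ → Bool) (n : ℕ) : Bool :=
  @Nat.rec (fun _ => Bool) true (fun x ih => sel(f (Nat.succ x); ih; false)) n

/-- No admissible flag gives a smaller code. -/
def minimal (t d0 d1 : ℕ) (l : Path) : Bool :=
  all (fun u => sel(Nat.beq (rowdeg t u) d0;
    all (fun v => sel(Nat.beq (look t u v) 0; true;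
      sel(Nat.beq (rowdeg t v) d1;
        force (put1 (put1 0 u 1) v 2) fun s => force (put1 (put1 0 1 u) 2 v) fun r =>
          sel(below t 64 4 l s r 2; below t 4 64 l s r 2; false);
        Nat.ble (rowdeg t v) d1))) 10;
    Nat.ble d0 (rowdeg t u))) 10

/-- Some `x` with a dart `(x, v)`. -/
def find (t v : ℕ) : ℕ :=
  @Nat.rec (fun _ => ℕ) 0
    (fun x ih => sel(Nat.beq (look t (Nat.succ x) v) 0; ih; Nat.succ x)) 10

/-- The number of nonzero entries. -/
def total (t : ℕ) : ℕ :=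
  @Nat.rec (fun _ => ℕ) 0 (fun x ih => Nat.add (rowdeg t (Nat.succ x)) ih) 10

/-- Is the path a labelling order of the table? -/
def traces (t : ℕ) (l : Path) : ℕ → Bool :=
  @Path.rec (fun _ => ℕ → Bool) (fun n => Nat.beq n 10)
    (fun a b c _ ih n =>
      sel(Nat.ble 1 a; sel(Nat.ble a n; sel(Nat.ble 1 b; sel(Nat.ble b n;
        sel(Nat.beq (look t a b) c; sel(Nat.ble 1 c;
          sel(Nat.ble c n; ih n; sel(Nat.beq c (Nat.succ n); ih c; false));
          false); false); false); false); false); false)) l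

/-- Does the table describe a closed oriented surface? -/
def valid (t : ℕ) : Bool :=
  sel(all (fun a => all (fun b => force (look t a b) fun c =>
      sel(Nat.beq c 0; true; sel(Nat.beq (look t b c) a; sel(Nat.ble c 10; sel(Nat.beq a b; false;
        force (look t b a) fun d => sel(Nat.beq d 0; false; sel(Nat.beq d c; false; true)));
        false); false))) 10) 10;
    all (fun v => force (find t v) fun x => sel(Nat.beq x 0; false;
      walk t v x (fun _ => false) (fun k => Nat.beq k (rowdeg t v)) 10 x 1)) 10;
    false)

/-- The test applied to complete tables. -/
def accept (t d0 d1 : ℕ) (l : Path) : Bool :=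
  sel(Nat.beq (total t) 60; sel(Nat.beq (rowdeg t 1) d0; sel(Nat.beq (rowdeg t 2) d1;
    sel(Nat.beq (look t 1 2) 3; sel(minimal t d0 d1 l; sel(traces t l 2; valid t;
      false); false); false); false); false); false)

/-- Go to the first open dart at vertex `a` or later. -/
def nextv (t d0 d1 n : ℕ) (l : Path) (k : ℕ → ℕ → List ℕ) (fuel : ℕ) : ℕ → List ℕ :=
  @Nat.rec (fun _ => ℕ → List ℕ) (fun _ => [])
    (fun _ ih a => sel(Nat.ble a n;
      force (find t a) fun x =>
        walk t a x (fun y => k a y) (fun _ => ih (Nat.succ a)) 10 x 1;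
      sel(accept t d0 d1 (Path.rev l Path.nil); [t]; []))) fuel

/-- Lower bound for the degree of `v`. -/
def lb (d0 d1 v : ℕ) : ℕ := sel(Nat.beq v 2; d1; d0)

/-- Bound the degrees of the neighbours of `v` by `d1`. -/
def capNbrs (t v d1 n : ℕ) : ℕ → ℕ :=
  @Nat.rec (fun _ => ℕ → ℕ) (fun ub => ub) (fun x ih ub =>
    sel(Nat.beq (look t v (Nat.succ x)) 0; ih ub;
      sel(Nat.ble (nib ub (Nat.succ x)) d1; ih ub;
        force (setn ub (Nat.succ x) d1) fun ub => ih ub))) n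

/-- The vertex `v` has become closed with degree `k`. -/
def closed (t dv ub d0 d1 v k : ℕ) (cont : ℕ → List ℕ) : List ℕ :=
  sel(Nat.ble (nib dv v) k; sel(Nat.ble (lb d0 d1 v) k;
    sel(Nat.beq k d0;
      force (setn (capNbrs t v d1 10 ub) v k) fun ub =>
        sel(all (fun x => Nat.ble (nib dv x) (nib ub x)) 10; cont ub; []);
      force (setn ub v k) fun ub => cont ub); []); [])

/-- Account for the edge `xc`, unless it is present already. -/
def addE (d0 d1 ub x c old dv S : ℕ) (k : ℕ → ℕ → List ℕ) : List ℕ :=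
  sel(Nat.beq old 0;
    force (nib dv x) fun p => force (nib dv c) fun q =>
    sel(Nat.ble (nib ub x) p; []; sel(Nat.ble (nib ub c) q; [];
      force (Nat.add S (Nat.add sel(Nat.ble (lb d0 d1 x) p; 1; 0)
        sel(Nat.ble (lb d0 d1 c) q; 1; 0))) fun S =>
      sel(Nat.ble S 60;
        force (setn (setn dv x (Nat.succ p)) c (Nat.succ q)) fun dv => k dv S; [])));
    k dv S)

/-- Check the vertex `v` for closure. -/
def chk (t dv ub d0 d1 v tgt cur : ℕ) (cont : ℕ → List ℕ) : List ℕ :=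
  walk t v tgt (fun _ => cont ub) (fun k => closed t dv ub d0 d1 v k cont) 10 cur 2

/-- Fill the open dart `(a, y)` with the triangle `(a, y, c)` and continue. -/
def child (d0 d1 t dv ub S n a y c : ℕ) (l : Path)
    (go : ℕ → ℕ → ℕ → ℕ → ℕ → ℕ → ℕ → Path → List ℕ) : List ℕ :=
  sel(Nat.beq (look t y c) 0; sel(Nat.beq (look t c a) 0;
    addE d0 d1 ub y c (look t c y) dv S fun dv S =>
    addE d0 d1 ub c a (look t a c) dv S fun dv S =>
    force (put3 t a y c) fun t =>
    chk t dv ub d0 d1 y c a fun ub => chk t dv ub d0 d1 c a y fun ub =>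
    force sel(Nat.ble c n; n; c) fun n =>
    walk t a y (fun z => go t dv ub S n a z (Path.cons a y c l))
      (fun k => closed t dv ub d0 d1 a k fun ub =>
        nextv t d0 d1 n (Path.cons a y c l)
          (fun v z => go t dv ub S n v z (Path.cons a y c l)) 11 (Nat.succ a)) 10 c 2;
    []); [])

/-- Depth-first search. -/
def search (d0 d1 fuel : ℕ) : ℕ → ℕ → ℕ → ℕ → ℕ → ℕ → ℕ → Path → List ℕ :=
  @Nat.rec (fun _ => ℕ → ℕ → ℕ → ℕ → ℕ → ℕ → ℕ → Path → List ℕ) (fun _ _ _ _ _ _ _ _ => [])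
    (fun _ ih t dv ub S n a y l =>
      @Nat.rec (fun _ => List ℕ) []
        (fun c rest => List.append rest (child d0 d1 t dv ub S n a y (Nat.succ c) l ih))
        sel(Nat.ble 10 n; 10; Nat.succ n)) fuel

/-- The canonical tori whose first two vertices have degrees `d0` and `d1`. -/
def start (d0 d1 : ℕ) : List ℕ :=
  search d0 d1 101 (put3 0 1 2 3) (setn (setn (setn 0 1 2) 2 2) 3 2)
    (setn (setn 0xfffffffffff 1 d0) 2 d1) (Nat.add (Nat.mul 9 d0) d1) 3 1 3
    (Path.cons 1 2 3 Path.nil)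

/-- The length of a list, with an accumulator. -/
def len (l : List ℕ) : ℕ → ℕ :=
  @List.rec ℕ (fun _ => ℕ → ℕ) (fun n => n) (fun _ _ ih n => force (Nat.succ n) ih) l

end

/-! ### Evaluating the search program -/

theorem rec_eq_cond {α : Type*} (b : Bool) (t e : α) :
    @Bool.rec (fun _ => α) e t b = cond b t e := by cases b <;> rfl

theorem force_eq {α : Type} (e : ℕ) (k : ℕ → α) : force e k = k e := by cases e <;> rfl

theorem ble_eq (a b : ℕ) : Nat.ble a b = decide (a ≤ b) := by
  rw [Bool.eq_iff_iff]; simp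

theorem beq_eq (a b : ℕ) : Nat.beq a b = decide (a = b) := by
  rw [Bool.eq_iff_iff]; simp

theorem shiftRight_mod_xor (t c i j : ℕ) (hc : c < 16) :
    ((t ^^^ (c <<< (4 * j))) >>> (4 * i)) % 16 =
      if i = j then (t >>> (4 * i)) % 16 ^^^ c else (t >>> (4 * i)) % 16 := by
  have hc' : c % 16 = c := Nat.mod_eq_of_lt hc
  have key : ((c <<< (4 * j)) >>> (4 * i)) % 16 = if i = j then c else 0 := by
    rcases lt_trichotomy i j with h | h | h
    · rw [if_neg h.ne]
      obtain ⟨d, rfl⟩ := Nat.exists_eq_add_of_lt h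
      rw [Nat.shiftLeft_eq, Nat.shiftRight_eq_div_pow]
      have : 2 ^ (4 * (i + d + 1)) = 2 ^ (4 * i) * (16 * 2 ^ (4 * d)) := by
        rw [show 4 * (i + d + 1) = 4 * i + 4 + 4 * d by ring, pow_add, pow_add]; ring
      rw [this, show c * (2 ^ (4 * i) * (16 * 2 ^ (4 * d))) =
        2 ^ (4 * i) * (16 * (c * 2 ^ (4 * d))) by ring, Nat.mul_div_cancel_left _ (by positivity)]
      simp
    · subst h
      rw [if_pos rfl, Nat.shiftLeft_shiftRight, hc']
    · rw [if_neg h.ne']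
      obtain ⟨d, rfl⟩ := Nat.exists_eq_add_of_lt h
      rw [show 4 * (j + d + 1) = 4 * j + (4 + 4 * d) by ring, Nat.shiftRight_add,
        Nat.shiftLeft_shiftRight, Nat.shiftRight_add, Nat.shiftRight_eq_div_pow c 4,
        Nat.div_eq_of_lt (by simpa using hc)]
      simp
  have h16 : ∀ x : ℕ, x % 16 = x % 2 ^ 4 := fun x => rfl
  rw [Nat.shiftRight_xor_distrib, h16, Nat.xor_mod_two_pow, ← h16, ← h16, key]
  split <;> simp

theorem nib_def (t a : ℕ) : nib t a = (t >>> (4 * a)) % 16 := rfl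

theorem look_def (t a b : ℕ) : look t a b = (t >>> (64 * a + 4 * b)) % 16 := rfl

theorem look_def' (t a b : ℕ) : look t a b = (t >>> (4 * (16 * a + b))) % 16 := by
  rw [look_def]; congr 2; ring

theorem nib_lt (t a : ℕ) : nib t a < 16 := Nat.mod_lt _ (by norm_num)

theorem nib_put1 (t a c i : ℕ) (hc : c < 16) :
    nib (put1 t a c) i = if i = a then nib t i ^^^ c else nib t i :=
  shiftRight_mod_xor t c i a hc

theorem nib_setn (u v k w : ℕ) (hk : k < 16) :
    nib (setn u v k) w = if w = v then k else nib u w := by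
  have h : nib u v ^^^ k < 2 ^ 4 := Nat.xor_lt_two_pow (nib_lt u v) hk
  have : nib (setn u v k) w = if w = v then nib u w ^^^ (nib u v ^^^ k) else nib u w :=
    nib_put1 u v _ w h
  rw [this]
  split
  next h => subst h; rw [← Nat.xor_assoc, Nat.xor_self, Nat.zero_xor]
  · rfl

theorem look_put (t a b c i j : ℕ) (hb : b < 16) (hc : c < 16) (hj : j < 16) :
    look (put t a b c) i j = if i = a ∧ j = b then look t i j ^^^ c else look t i j := by
  have h : put t a b c = t ^^^ (c <<< (4 * (16 * a + b))) := by
    rw [show 4 * (16 * a + b) = 64 * a + 4 * b by ring]; rfl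
  rw [h, look_def', shiftRight_mod_xor _ _ _ _ hc, ← look_def']
  congr 1
  rw [eq_iff_iff]; omega

theorem look_xor_low (t s i j : ℕ) (hs : s < 2 ^ 64) (hi : 1 ≤ i) :
    look (t ^^^ s) i j = look t i j := by
  have h16 : ∀ x : ℕ, x % 16 = x % 2 ^ 4 := fun x => rfl
  have : s >>> (64 * i + 4 * j) = 0 := by
    rw [Nat.shiftRight_eq_div_pow]
    exact Nat.div_eq_of_lt (hs.trans_le (Nat.pow_le_pow_right (by norm_num) (by omega)))
  rw [look_def, Nat.shiftRight_xor_distrib, this, Nat.xor_zero]; rfl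

theorem look_put3 (t a b c i j : ℕ) (ha : a < 16) (hb : b < 16) (hc : c < 16) (hj : j < 16)
    (hi : 1 ≤ i) (hab : a ≠ b) (hbc : b ≠ c) (hca : c ≠ a)
    (h1 : look t a b = 0) (h2 : look t b c = 0) (h3 : look t c a = 0) :
    look (put3 t a b c) i j = if i = a ∧ j = b then c else if i = b ∧ j = c then a else
      if i = c ∧ j = a then b else look t i j := by
  have : look (put3 t a b c) i j = look (put (put (put t a b c) b c a) c a b) i j :=
    look_xor_low _ _ _ _ (lt_of_lt_of_le (Nat.mod_lt _ (by norm_num)) (by norm_num)) hi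
  rw [this, look_put _ _ _ _ _ _ ha hb hj, look_put _ _ _ _ _ _ hc ha hj,
    look_put _ _ _ _ _ _ hb hc hj]
  split_ifs <;> simp_all

/-- The table stored in `t`, restricted to the labels `1, …, 10`. -/
def tab (t a b : ℕ) : ℕ := if (1 ≤ a ∧ a ≤ 10) ∧ 1 ≤ b ∧ b ≤ 10 then look t a b else 0

theorem tab_eq {t a b : ℕ} (ha : 1 ≤ a) (ha' : a ≤ 10) (hb : 1 ≤ b) (hb' : b ≤ 10) :
    tab t a b = look t a b := if_pos ⟨⟨ha, ha'⟩, hb, hb'⟩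

theorem tab_rng {t a b : ℕ} (h : tab t a b ≠ 0) : (1 ≤ a ∧ a ≤ 10) ∧ 1 ≤ b ∧ b ≤ 10 := by
  by_contra h'; exact h (if_neg h')

theorem walk_cases {α : Type} (t v target : ℕ) (opn cl : ℕ → α) (fuel cur k : ℕ) :
    ∃ j ≤ fuel, (∀ i < j, (look t v)^[i + 1] cur ≠ 0 ∧ (look t v)^[i + 1] cur ≠ target) ∧
      ((j = fuel ∧ walk t v target opn cl fuel cur k = opn ((look t v)^[j] cur)) ∨
       (j < fuel ∧ (look t v)^[j + 1] cur = 0 ∧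
          walk t v target opn cl fuel cur k = opn ((look t v)^[j] cur)) ∨
       (j < fuel ∧ (look t v)^[j + 1] cur ≠ 0 ∧ (look t v)^[j + 1] cur = target ∧
          walk t v target opn cl fuel cur k = cl (k + j))) := by
  induction fuel generalizing cur k with
  | zero => exact ⟨0, le_rfl, by simp, Or.inl ⟨rfl, rfl⟩⟩
  | succ fuel ih =>
    have step : walk t v target opn cl (fuel + 1) cur k =
        cond (Nat.beq (look t v cur) 0) (opn cur) (cond (Nat.beq (look t v cur) target) (cl k)
          (walk t v target opn cl fuel (look t v cur) (k + 1))) := by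
      rw [← rec_eq_cond, ← rec_eq_cond, ← force_eq (look t v cur) fun nx =>
        sel(Nat.beq nx 0; opn cur; sel(Nat.beq nx target; cl k;
          walk t v target opn cl fuel nx (k + 1)))]
      rfl
    rw [step, beq_eq, beq_eq]
    by_cases h0 : look t v cur = 0
    · exact ⟨0, by omega, by simp, Or.inr (Or.inl ⟨by omega, h0, by simp [h0]⟩)⟩
    by_cases h1 : look t v cur = target
    · exact ⟨0, by omega, by simp, Or.inr (Or.inr ⟨by omega, h0, h1, by simp [← h1, h0]⟩)⟩
    obtain ⟨j, hj, hlt, h⟩ := ih (look t v cur) (k + 1)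
    refine ⟨j + 1, by omega, ?_, ?_⟩
    · rintro (_ | i) hi
      · exact ⟨h0, h1⟩
      · exact hlt i (by omega)
    · simp only [h0, h1, decide_false, cond_false]
      rcases h with ⟨rfl, h⟩ | ⟨h2, h3, h⟩ | ⟨h2, h3, h4, h⟩
      · exact Or.inl ⟨rfl, h⟩
      · exact Or.inr (Or.inl ⟨by omega, h3, h⟩)
      · exact Or.inr (Or.inr ⟨by omega, h3, h4, by rw [h]; congr 1; omega⟩)

theorem all_iff (f : ℕ → Bool) (n : ℕ) : all f n = true ↔ ∀ x, 1 ≤ x → x ≤ n → f x = true := by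
  induction n with
  | zero => exact ⟨fun _ x h h' => by omega, fun _ => rfl⟩
  | succ n ih =>
    have : all f (n + 1) = cond (f (n + 1)) (all f n) false := by rw [← rec_eq_cond]; rfl
    rw [this]
    constructor
    · intro h x hx hx'
      cases hf : f (n + 1) with
      | false => simp [hf] at h
      | true =>
        rcases hx'.lt_or_eq with h' | rfl
        · exact ih.1 (by simpa [hf] using h) x hx (by omega)
        · exact hf
    · intro h
      simp only [h (n + 1) (by omega) le_rfl, cond_true]
      exact ih.2 fun x hx hx' => h x hx (by omega)

/-- The number of neighbours of `a`. -/
def deg (O : ℕ → ℕ → ℕ) (a : ℕ) : ℕ := ((Finset.Icc 1 10).filter fun b => O a b ≠ 0).card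

theorem rowdeg_eq (t a : ℕ) (ha : 1 ≤ a) (ha' : a ≤ 10) : rowdeg t a = deg (tab t) a := by
  have key : ∀ n, @Nat.rec (fun _ => ℕ) 0
      (fun x ih => sel(Nat.beq (look t a (Nat.succ x)) 0; ih; Nat.succ ih)) n =
      ((Finset.Icc 1 n).filter fun b => look t a b ≠ 0).card := by
    intro n
    induction n with
    | zero => rfl
    | succ n ih =>
      have h : Finset.Icc 1 (n + 1) = insert (n + 1) (Finset.Icc 1 n) := by
        ext; simp only [Finset.mem_Icc, Finset.mem_insert]; omega
      simp only [rec_eq_cond, beq_eq] at ih ⊢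
      rw [h, Finset.filter_insert, ih]
      by_cases h0 : look t a (n + 1) = 0
      · simp [h0]
      · simp [h0]
  refine (key 10).trans ?_
  rw [deg]
  congr 1
  refine Finset.filter_congr fun b hb => ?_
  rw [Finset.mem_Icc] at hb
  rw [tab_eq ha ha' hb.1 hb.2]

theorem total_eq (t : ℕ) : total t = ∑ a ∈ Finset.Icc 1 10, deg (tab t) a := by
  have : total t = ∑ a ∈ Finset.Icc 1 10, rowdeg t a := by
    have : Finset.Icc 1 10 = {10, 9, 8, 7, 6, 5, 4, 3, 2, 1} := by decide
    rw [this]; rfl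
  rw [this]
  refine Finset.sum_congr rfl fun a ha => ?_
  rw [Finset.mem_Icc] at ha
  exact rowdeg_eq t a ha.1 ha.2

theorem find_spec {t v : ℕ} (hv : 1 ≤ v) (hv' : v ≤ 10) (h : ∃ x, tab t x v ≠ 0) :
    find t v ≠ 0 ∧ tab t (find t v) v ≠ 0 := by
  have key : ∀ n ≤ 10, (∃ x, 1 ≤ x ∧ x ≤ n ∧ look t x v ≠ 0) →
      let y := @Nat.rec (fun _ => ℕ) 0
        (fun x ih => sel(Nat.beq (look t (Nat.succ x) v) 0; ih; Nat.succ x)) n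
      y ≠ 0 ∧ tab t y v ≠ 0 := by
    intro n
    induction n with
    | zero => rintro _ ⟨x, h1, h2, _⟩; omega
    | succ n ih =>
      rintro hn ⟨x, h1, h2, h3⟩
      simp only [rec_eq_cond, beq_eq]
      by_cases h0 : look t (n + 1) v = 0
      · simp only [Nat.succ_eq_add_one, h0, decide_true, cond_true]
        have hx : x ≠ n + 1 := fun e => h3 (e ▸ h0)
        simpa only [rec_eq_cond, beq_eq] using ih (by omega) ⟨x, h1, by omega, h3⟩
      · simp only [Nat.succ_eq_add_one, h0, decide_false, cond_false]
        exact ⟨by omega, by rwa [tab_eq (by omega) hn hv hv']⟩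
  obtain ⟨x, hx⟩ := h
  have := tab_rng hx
  exact key 10 le_rfl ⟨x, this.1.1, this.1.2, by rwa [← tab_eq this.1.1 this.1.2 hv hv']⟩

/-! ### Rotation systems of labelled tori -/

/-- A rotation system on the labels `1, …, 10`, not necessarily connected: the entry `O a b` is
the third vertex of the oriented triangle containing the dart `(a, b)`, and `0` if there is none. -/
structure Pre (O : ℕ → ℕ → ℕ) : Prop where
  rng : ∀ {a b}, O a b ≠ 0 → (1 ≤ a ∧ a ≤ 10) ∧ (1 ≤ b ∧ b ≤ 10) ∧ O a b ≤ 10 ∧ a ≠ b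
  rot : ∀ {a b}, O a b ≠ 0 → O b (O a b) = a
  opp : ∀ {a b}, O a b ≠ 0 → O b a ≠ 0 ∧ O b a ≠ O a b

/-- An oriented torus on the labels `1, …, 10`. -/
structure Good (O : ℕ → ℕ → ℕ) : Prop extends Pre O where
  nz : ∀ {v}, 1 ≤ v → v ≤ 10 → ∃ w, O v w ≠ 0
  link : ∀ {v w w'}, O v w ≠ 0 → O v w' ≠ 0 → ∃ k, (O v)^[k] w = w'
  tot : ∑ v ∈ Finset.Icc 1 10, deg O v = 60
  conn : ∀ {a b}, 1 ≤ a → a ≤ 10 → 1 ≤ b → b ≤ 10 →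
    Relation.ReflTransGen (fun x y => O x y ≠ 0) a b

/-- The permutation only moves labels. -/
def Fx (σ : Equiv.Perm ℕ) : Prop := ∀ x, ¬(1 ≤ x ∧ x ≤ 10) → σ x = x

/-- Rename the labels. -/
def relabel (σ : Equiv.Perm ℕ) (O : ℕ → ℕ → ℕ) (a b : ℕ) : ℕ := σ (O (σ.symm a) (σ.symm b))

/-- Equality up to renaming and reversal of the orientation. -/
def Eqv (O O' : ℕ → ℕ → ℕ) : Prop :=
  ∃ σ, Fx σ ∧ (O' = relabel σ O ∨ O' = relabel σ fun a b => O b a)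

theorem Fx.rng {σ : Equiv.Perm ℕ} (h : Fx σ) {x : ℕ} (hx : 1 ≤ x ∧ x ≤ 10) :
    1 ≤ σ x ∧ σ x ≤ 10 := by
  by_contra h'
  have := σ.injective (h _ h')
  rw [this] at h'
  exact h' hx

theorem Fx.zero {σ : Equiv.Perm ℕ} (h : Fx σ) : σ 0 = 0 := h 0 (by omega)

theorem Fx.eq_zero {σ : Equiv.Perm ℕ} (h : Fx σ) {x : ℕ} : σ x = 0 ↔ x = 0 :=
  ⟨fun e => σ.injective (e.trans h.zero.symm), fun e => e ▸ h.zero⟩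

theorem Fx.symm {σ : Equiv.Perm ℕ} (h : Fx σ) : Fx σ.symm := fun x hx => by
  rw [Equiv.symm_apply_eq, h x hx]

theorem Fx.le {σ : Equiv.Perm ℕ} (h : Fx σ) {x : ℕ} (hx : x ≤ 10) : σ x ≤ 10 := by
  rcases Nat.eq_zero_or_pos x with rfl | h'
  · rw [h.zero]; omega
  · exact (h.rng ⟨h', hx⟩).2

theorem Fx.mul {σ τ : Equiv.Perm ℕ} (h : Fx σ) (h' : Fx τ) : Fx (σ * τ) := fun x hx => by
  rw [Equiv.Perm.mul_apply, h' x hx, h x hx]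

theorem Fx.swap {x y : ℕ} (hx : 1 ≤ x ∧ x ≤ 10) (hy : 1 ≤ y ∧ y ≤ 10) :
    Fx (Equiv.swap x y) := fun _ hz =>
  Equiv.swap_apply_of_ne_of_ne (fun e => hz (e ▸ hx)) (fun e => hz (e ▸ hy))

theorem relabel_apply (σ : Equiv.Perm ℕ) (O : ℕ → ℕ → ℕ) (a b : ℕ) :
    relabel σ O (σ a) (σ b) = σ (O a b) := by simp [relabel]

theorem Eqv.relabel {O O' : ℕ → ℕ → ℕ} (h : Eqv O O') {τ : Equiv.Perm ℕ} (hτ : Fx τ) :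
    Eqv O (relabel τ O') := by
  obtain ⟨σ, hσ, rfl | rfl⟩ := h
  · exact ⟨τ * σ, hτ.mul hσ, Or.inl rfl⟩
  · exact ⟨τ * σ, hτ.mul hσ, Or.inr rfl⟩

theorem Eqv.refl (O : ℕ → ℕ → ℕ) : Eqv O O := ⟨1, fun _ _ => rfl, Or.inl rfl⟩

theorem Eqv.symm {O O' : ℕ → ℕ → ℕ} (h : Eqv O O') : Eqv O' O := by
  obtain ⟨σ, hσ, rfl | rfl⟩ := h
  · exact ⟨σ.symm, hσ.symm, Or.inl (by ext; simp [Tor.relabel])⟩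
  · exact ⟨σ.symm, hσ.symm, Or.inr (by ext; simp [Tor.relabel])⟩

theorem Eqv.flip {O O' : ℕ → ℕ → ℕ} (h : Eqv O O') : Eqv O fun a b => O' b a := by
  obtain ⟨σ, hσ, rfl | rfl⟩ := h
  · exact ⟨σ, hσ, Or.inr rfl⟩
  · exact ⟨σ, hσ, Or.inl rfl⟩

theorem Eqv.trans {O O' O'' : ℕ → ℕ → ℕ} (h : Eqv O O') (h' : Eqv O' O'') : Eqv O O'' := by
  obtain ⟨σ, hσ, rfl | rfl⟩ := h'
  · exact h.relabel hσ
  · exact h.flip.relabel hσ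

theorem Pre.inj {O : ℕ → ℕ → ℕ} (h : Pre O) {v w w' : ℕ} (h1 : O v w ≠ 0)
    (h2 : O v w = O v w') : w = w' := by
  have key : ∀ {w}, O v w ≠ 0 → O (O v w) v = w := fun {w} hw => by
    have := h.rot hw
    have h3 : O w (O v w) ≠ 0 := by rw [this]; have := (h.rng hw).1; omega
    have h4 := h.rot h3
    rwa [this] at h4
  have h1' : O v w' ≠ 0 := h2 ▸ h1
  rw [← key h1, h2, key h1']

theorem Pre.rot2 {O : ℕ → ℕ → ℕ} (h : Pre O) {a b : ℕ} (hw : O a b ≠ 0) :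
    O (O a b) a = b := by
  have := h.rot hw
  have h3 : O b (O a b) ≠ 0 := by rw [this]; have := (h.rng hw).1; omega
  have h4 := h.rot h3
  rwa [this] at h4

theorem Pre.ne_iff {O : ℕ → ℕ → ℕ} (h : Pre O) {a b : ℕ} : O a b ≠ 0 ↔ O b a ≠ 0 :=
  ⟨fun h' => (h.opp h').1, fun h' => (h.opp h').1⟩

theorem Pre.next {O : ℕ → ℕ → ℕ} (h : Pre O) {a b : ℕ} (hw : O a b ≠ 0) :
    O a (O a b) ≠ 0 := by
  rw [h.ne_iff, h.rot2 hw]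
  have := (h.rng hw).2.1; omega

theorem Pre.iter {O : ℕ → ℕ → ℕ} (h : Pre O) {a b : ℕ} (hw : O a b ≠ 0) (i : ℕ) :
    O a ((O a)^[i] b) ≠ 0 := by
  induction i with
  | zero => exact hw
  | succ i ih => rw [Function.iterate_succ_apply']; exact h.next ih

theorem Pre.iter_inj {O : ℕ → ℕ → ℕ} (h : Pre O) {a b : ℕ} (hw : O a b ≠ 0) {i d : ℕ}
    (e : (O a)^[i + d] b = (O a)^[i] b) : (O a)^[d] b = b := by
  induction i with
  | zero => simpa using e
  | succ i ih =>
    refine ih ?_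
    rw [show i + 1 + d = i + d + 1 by ring, Function.iterate_succ_apply',
      Function.iterate_succ_apply'] at e
    exact h.inj (h.iter hw _) e

theorem Pre.exists_period {O : ℕ → ℕ → ℕ} (h : Pre O) {a b : ℕ} (hw : O a b ≠ 0) :
    ∃ m, 1 ≤ m ∧ m ≤ 10 ∧ (O a)^[m] b = b := by
  obtain ⟨i, hi, j, hj, hij, e⟩ := Finset.exists_ne_map_eq_of_card_lt_of_maps_to
    (s := Finset.range 11) (t := Finset.Icc 1 10) (by simp) (f := fun i => (O a)^[i] b)
    (fun i _ => by
      have := (h.rng (h.iter hw i)).2.1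
      simpa using this)
  rw [Finset.mem_range] at hi hj
  rcases Nat.lt_or_gt_of_ne hij with h' | h'
  · obtain ⟨d, rfl⟩ := Nat.exists_eq_add_of_lt h'
    exact ⟨d + 1, by omega, by omega, h.iter_inj hw (i := i) e.symm⟩
  · obtain ⟨d, rfl⟩ := Nat.exists_eq_add_of_lt h'
    exact ⟨d + 1, by omega, by omega, h.iter_inj hw (i := j) e⟩

theorem Good.mem_iter {O : ℕ → ℕ → ℕ} (h : Good O) {a b c m : ℕ} (hb : O a b ≠ 0)
    (hc : O a c ≠ 0) (hm : 1 ≤ m) (e : (O a)^[m] b = b) : ∃ i < m, (O a)^[i] b = c := by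
  obtain ⟨k, rfl⟩ := h.link hb hc
  exact ⟨k % m, Nat.mod_lt _ hm, Function.IsPeriodicPt.iterate_mod_apply e k⟩

theorem Good.deg_le {O : ℕ → ℕ → ℕ} (h : Good O) {a b m : ℕ} (hb : O a b ≠ 0)
    (hm : 1 ≤ m) (e : (O a)^[m] b = b) : deg O a ≤ m := by
  calc deg O a ≤ ((Finset.range m).image fun i => (O a)^[i] b).card := by
        refine Finset.card_le_card fun c hc => ?_
        obtain ⟨i, hi, rfl⟩ := h.mem_iter hb (Finset.mem_filter.1 hc).2 hm e
        exact Finset.mem_image_of_mem _ (Finset.mem_range.2 hi)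
    _ ≤ m := Finset.card_image_le.trans (by simp)

theorem iter_image_card {f : ℕ → ℕ} {b m : ℕ} (e : f^[m] b = b)
    (h : ∀ i, 1 ≤ i → i < m → f^[i] b ≠ b) :
    ((Finset.range m).image fun i => f^[i] b).card = m := by
  rw [Finset.card_image_of_injOn, Finset.card_range]
  have key : ∀ i j, i < j → j < m → f^[i] b ≠ f^[j] b := fun i j hij hj e' => by
    refine h (m - j + i) (by omega) (by omega) ?_
    rw [Function.iterate_add_apply, e', ← Function.iterate_add_apply,
      Nat.sub_add_cancel hj.le, e]
  intro i hi j hj e'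
  simp only [Finset.coe_range, Set.mem_Iio] at hi hj
  rcases lt_trichotomy i j with h' | h' | h'
  · exact absurd e' (key i j h' hj)
  · exact h'
  · exact absurd e'.symm (key j i h' hi)

theorem Pre.le_deg {O : ℕ → ℕ → ℕ} (h : Pre O) {a b m : ℕ} (hb : O a b ≠ 0)
    (e : (O a)^[m] b = b) (hmin : ∀ i, 1 ≤ i → i < m → (O a)^[i] b ≠ b) : m ≤ deg O a := by
  rw [← iter_image_card e hmin]
  refine Finset.card_le_card fun c hc => ?_
  obtain ⟨i, _, rfl⟩ := Finset.mem_image.1 hc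
  have := h.iter hb i
  exact Finset.mem_filter.2 ⟨Finset.mem_Icc.2 (h.rng this).2.1, this⟩

theorem deg_relabel {σ : Equiv.Perm ℕ} (hσ : Fx σ) (O : ℕ → ℕ → ℕ) (a : ℕ) :
    deg (relabel σ O) (σ a) = deg O a := by
  refine (Finset.card_bij (fun b _ => σ b) ?_ ?_ ?_).symm
  · intro b hb
    rw [Finset.mem_filter, Finset.mem_Icc] at hb ⊢
    exact ⟨hσ.rng hb.1, by rw [relabel_apply]; exact fun e => hb.2 (hσ.eq_zero.1 e)⟩
  · intro b _ c _ e; exact σ.injective e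
  · intro b hb
    rw [Finset.mem_filter, Finset.mem_Icc] at hb
    refine ⟨σ.symm b, Finset.mem_filter.2 ⟨Finset.mem_Icc.2 (hσ.symm.rng hb.1), fun e => hb.2 ?_⟩,
      by simp⟩
    rw [relabel, Equiv.symm_apply_apply, e, hσ.zero]

theorem Pre.deg_flip {O : ℕ → ℕ → ℕ} (h : Pre O) (a : ℕ) : deg (fun a b => O b a) a = deg O a := by
  unfold deg
  congr 1
  exact Finset.filter_congr fun b _ => h.ne_iff

theorem Good.flip {O : ℕ → ℕ → ℕ} (h : Good O) : Good fun a b => O b a where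
  rng h' := by
    have := h.rng h'
    exact ⟨this.2.1, this.1, this.2.2.1, this.2.2.2.symm⟩
  rot h' := h.rot2 h'
  opp h' := h.opp h'
  nz h1 h2 := by
    obtain ⟨w, hw⟩ := h.nz h1 h2
    exact ⟨w, h.ne_iff.1 hw⟩
  link {v w w'} h1 h2 := by
    obtain ⟨k, rfl⟩ := h.link (h.ne_iff.1 h2) (h.ne_iff.1 h1)
    rw [← h.ne_iff] at h2
    refine ⟨k, ?_⟩
    clear h1
    induction k with
    | zero => rfl
    | succ k ih =>
      rw [Function.iterate_succ_apply, Function.iterate_succ_apply', h.rot2 (h.iter h2 k)]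
      exact ih
  tot := by rw [← h.tot]; exact Finset.sum_congr rfl fun v _ => h.deg_flip v
  conn h1 h2 h3 h4 :=
    Relation.ReflTransGen.mono (r := fun x y => O x y ≠ 0) (fun _ _ hxy => h.ne_iff.1 hxy) _ _
      (h.conn h1 h2 h3 h4)

theorem Good.relabel {O : ℕ → ℕ → ℕ} (h : Good O) {σ : Equiv.Perm ℕ} (hσ : Fx σ) :
    Good (relabel σ O) := by
  have ne : ∀ {a b}, Tor.relabel σ O a b ≠ 0 ↔ O (σ.symm a) (σ.symm b) ≠ 0 := fun {a b} =>
    not_congr hσ.eq_zero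
  have it : ∀ v w k, (Tor.relabel σ O v)^[k] w = σ ((O (σ.symm v))^[k] (σ.symm w)) := by
    intro v w k
    induction k with
    | zero => simp
    | succ k ih => rw [Function.iterate_succ_apply', ih, Function.iterate_succ_apply']; simp [Tor.relabel]
  refine ⟨⟨fun {a b} h' => ?_, fun {a b} h' => ?_, fun {a b} h' => ?_⟩, fun {v} h1 h2 => ?_,
    fun {v w w'} h1 h2 => ?_, ?_, fun {a b} h1 h2 h3 h4 => ?_⟩
  · rw [ne] at h'
    have := h.rng h'
    have ha := hσ.rng this.1
    have hb := hσ.rng this.2.1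
    rw [Equiv.apply_symm_apply] at ha hb
    exact ⟨ha, hb, hσ.le this.2.2.1, fun e => this.2.2.2 (by rw [e])⟩
  · rw [ne] at h'
    simp [Tor.relabel, h.rot h']
  · rw [ne] at h'
    exact ⟨ne.2 (h.opp h').1, fun e => (h.opp h').2 (σ.injective e)⟩
  · have := hσ.symm.rng ⟨h1, h2⟩
    obtain ⟨w, hw⟩ := h.nz this.1 this.2
    exact ⟨σ w, by rw [ne, Equiv.symm_apply_apply]; exact hw⟩
  · rw [ne] at h1 h2
    obtain ⟨k, hk⟩ := h.link h1 h2
    exact ⟨k, by rw [it, hk]; simp⟩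
  · rw [← h.tot]
    refine Finset.sum_bij (fun v _ => σ.symm v) ?_ ?_ ?_ ?_
    · intro v hv; rw [Finset.mem_Icc] at hv ⊢; exact hσ.symm.rng hv
    · intro v _ w _ e; exact σ.symm.injective e
    · intro v hv; rw [Finset.mem_Icc] at hv
      exact ⟨σ v, Finset.mem_Icc.2 (hσ.rng hv), by simp⟩
    · intro v _
      conv_lhs => rw [← σ.apply_symm_apply v]
      exact deg_relabel hσ O _
  · have ha := hσ.symm.rng ⟨h1, h2⟩
    have hb := hσ.symm.rng ⟨h3, h4⟩
    have := (h.conn ha.1 ha.2 hb.1 hb.2).lift (p := fun x y => Tor.relabel σ O x y ≠ 0) σ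
      fun x y hxy => by
        change Tor.relabel σ O (σ x) (σ y) ≠ 0
        rw [ne]; simpa using hxy
    change Relation.ReflTransGen _ (σ (σ.symm a)) (σ (σ.symm b)) at this
    rwa [Equiv.apply_symm_apply, Equiv.apply_symm_apply] at this

theorem Eqv.good {O O' : ℕ → ℕ → ℕ} (h : Eqv O O') (hO : Good O) : Good O' := by
  obtain ⟨σ, hσ, rfl | rfl⟩ := h
  · exact hO.relabel hσ
  · exact hO.flip.relabel hσ

theorem Good.deg_ge {O : ℕ → ℕ → ℕ} (h : Good O) {v : ℕ} (h1 : 1 ≤ v) (h2 : v ≤ 10) :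
    3 ≤ deg O v := by
  obtain ⟨w, hw⟩ := h.nz h1 h2
  have h3 := h.next hw
  have hr := h.rng hw
  have hr' := h.rng h3
  have hl := h.ne_iff.1 hw
  have hn : O v (O w v) ≠ 0 := by rw [h.rot hl]; omega
  have hr'' := h.rng hn
  have ho := h.opp hw
  have h5 := h.rng hl
  have h6 := h.rng h3
  have hs : ({w, O v w, O w v} : Finset ℕ) ⊆ (Finset.Icc 1 10).filter fun b => O v b ≠ 0 := by
    intro x hx
    simp only [Finset.mem_insert, Finset.mem_singleton] at hx
    rw [Finset.mem_filter, Finset.mem_Icc]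
    rcases hx with rfl | rfl | rfl
    · exact ⟨hr.2.1, hw⟩
    · exact ⟨hr'.2.1, h3⟩
    · exact ⟨hr''.2.1, hn⟩
  have e1 : w ≠ O v w := (h.rng (a := w) (b := O v w) (by rw [h.rot hw]; omega)).2.2.2
  have e2 : w ≠ O w v := fun e => by
    have := (h.rng (a := O w v) (b := w) (by rw [h.rot2 hl]; omega)).2.2.2
    exact this e.symm
  calc 3 = ({w, O v w, O w v} : Finset ℕ).card := by
        rw [Finset.card_insert_of_notMem, Finset.card_pair ho.2.symm]
        simp [e1, e2]
    _ ≤ _ := Finset.card_le_card hs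

theorem Good.deg_le_nine {O : ℕ → ℕ → ℕ} (h : Good O) (v : ℕ) : deg O v ≤ 9 := by
  by_cases hv : 1 ≤ v ∧ v ≤ 10
  · calc deg O v ≤ ((Finset.Icc 1 10).erase v).card := by
          refine Finset.card_le_card fun c hc => ?_
          rw [Finset.mem_filter] at hc
          exact Finset.mem_erase.2 ⟨(h.rng hc.2).2.2.2.symm, hc.1⟩
      _ = 9 := by rw [Finset.card_erase_of_mem (Finset.mem_Icc.2 hv)]; simp
  · have : deg O v = 0 := by
      rw [deg, Finset.card_eq_zero, Finset.filter_eq_empty_iff]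
      intro b _ hb
      exact hv (h.rng hb).1
    omega

/-- Walks in the restricted table. -/
theorem walk_tab {α : Type} {t v cur : ℕ} (target : ℕ) (opn cl : ℕ → α) (fuel k : ℕ)
    (hv : 1 ≤ v ∧ v ≤ 10) (hb : ∀ w, tab t v w ≤ 10) (hc : 1 ≤ cur ∧ cur ≤ 10) :
    ∃ j ≤ fuel, (∀ i < j, (tab t v)^[i + 1] cur ≠ 0 ∧ (tab t v)^[i + 1] cur ≠ target) ∧
      ((j = fuel ∧ walk t v target opn cl fuel cur k = opn ((tab t v)^[j] cur)) ∨
       (j < fuel ∧ (tab t v)^[j + 1] cur = 0 ∧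
          walk t v target opn cl fuel cur k = opn ((tab t v)^[j] cur)) ∨
       (j < fuel ∧ (tab t v)^[j + 1] cur ≠ 0 ∧ (tab t v)^[j + 1] cur = target ∧
          walk t v target opn cl fuel cur k = cl (k + j))) := by
  obtain ⟨j, hj, hlt, h⟩ := walk_cases t v target opn cl fuel cur k
  have key : ∀ i ≤ j, (look t v)^[i] cur = (tab t v)^[i] cur ∧
      1 ≤ (tab t v)^[i] cur ∧ (tab t v)^[i] cur ≤ 10 := by
    intro i
    induction i with
    | zero => exact fun _ => ⟨rfl, hc⟩
    | succ i ih =>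
      intro hi
      obtain ⟨e, h1, h2⟩ := ih (by omega)
      have h3 := (hlt i (by omega)).1
      rw [Function.iterate_succ_apply', Function.iterate_succ_apply'] at *
      have e' : look t v ((look t v)^[i] cur) = tab t v ((tab t v)^[i] cur) := by
        rw [e, tab_eq hv.1 hv.2 h1 h2]
      exact ⟨e', by rw [← e']; omega, hb _⟩
  have key' : ∀ i ≤ j, (look t v)^[i + 1] cur = (tab t v)^[i + 1] cur := by
    intro i hi
    obtain ⟨e, h1, h2⟩ := key i hi
    rw [Function.iterate_succ_apply', Function.iterate_succ_apply', e, tab_eq hv.1 hv.2 h1 h2]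
  refine ⟨j, hj, fun i hi => by rw [← key' i hi.le]; exact hlt i hi, ?_⟩
  rw [← key' j le_rfl, ← (key j le_rfl).1]
  exact h

/-! ### Paths and codes -/

/-- The triangles of a path as a list. -/
def Path.toList : Path → List (ℕ × ℕ × ℕ)
  | .nil => []
  | .cons a b c p => (a, b, c) :: p.toList

theorem Path.toList_rev (p q : Path) : (p.rev q).toList = p.toList.reverse ++ q.toList := by
  induction p generalizing q with
  | nil => rfl
  | cons a b c p ih =>
    have : (Path.cons a b c p).rev q = p.rev (.cons a b c q) := rfl
    rw [this, ih]
    simp [Path.toList]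

/-- The list introduces the labels `n + 1, …, m` in order. -/
def Wf : ℕ → List (ℕ × ℕ × ℕ) → ℕ → Prop
  | n, [], m => n = m
  | n, (a, b, c) :: l, m => (1 ≤ a ∧ a ≤ n) ∧ (1 ≤ b ∧ b ≤ n) ∧ (1 ≤ c ∧ c ≤ n + 1) ∧ Wf (max n c) l m

theorem Wf.le {n m : ℕ} {l : List (ℕ × ℕ × ℕ)} (h : Wf n l m) : n ≤ m := by
  induction l generalizing n with
  | nil => exact le_of_eq h
  | cons e l ih => exact (le_max_left _ _).trans (ih h.2.2.2)

theorem wf_append {n m : ℕ} {l l' : List (ℕ × ℕ × ℕ)} :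
    Wf n (l ++ l') m ↔ ∃ k, Wf n l k ∧ Wf k l' m := by
  induction l generalizing n with
  | nil => simp [Wf]
  | cons e l ih => simp [Wf, ih, and_assoc]

/-- The list is strictly below the code of `O`, or a prefix of it. -/
def LEs : List (ℕ × ℕ × ℕ) → (ℕ → ℕ → ℕ) → Prop
  | [], _ => True
  | (a, b, c) :: l, O => c < O a b ∨ (O a b = c ∧ LEs l O)

/-- As `LEs`, but nothing is claimed after a missing triangle. -/
def LEw : List (ℕ × ℕ × ℕ) → (ℕ → ℕ → ℕ) → Prop
  | [], _ => True
  | (a, b, c) :: l, O => O a b = 0 ∨ c < O a b ∨ (O a b = c ∧ LEw l O)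

theorem les_append {l l' : List (ℕ × ℕ × ℕ)} {O : ℕ → ℕ → ℕ} (h : LEs l O)
    (h' : (∀ e ∈ l, O e.1 e.2.1 = e.2.2) → LEs l' O) : LEs (l ++ l') O := by
  induction l with
  | nil => exact h' (by simp)
  | cons e l ih =>
    obtain ⟨a, b, c⟩ := e
    rcases h with h | ⟨h1, h2⟩
    · exact Or.inl h
    · refine Or.inr ⟨h1, ih h2 fun h3 => h' fun e he => ?_⟩
      rcases List.mem_cons.1 he with rfl | he
      · exact h1
      · exact h3 e he

/-- The permutation `σ` sends the labelled vertices to their labels. -/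
structure Cons (σ : Equiv.Perm ℕ) (s r n : ℕ) : Prop where
  fx : Fx σ
  inv : ∀ i, 1 ≤ i → i ≤ n → nib r i = σ.symm i
  zero : ∀ i, n < i → nib r i = 0
  lab : ∀ x, 1 ≤ x → x ≤ 10 → nib s x = if σ x ≤ n then σ x else 0

theorem below_cons (t p q a b c : ℕ) (l : Path) (s r n : ℕ) :
    below t p q (.cons a b c l) s r n =
      cond (decide (nib s ((t >>> (p * nib r a + q * nib r b)) % 16) = 0))
        (cond (decide (n + 1 = c))
          (below t p q l (put1 s ((t >>> (p * nib r a + q * nib r b)) % 16) c)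
            (put1 r c ((t >>> (p * nib r a + q * nib r b)) % 16)) c)
          (decide (c ≤ n)))
        (cond (decide (nib s ((t >>> (p * nib r a + q * nib r b)) % 16) = c))
          (below t p q l s r n)
          (decide (c ≤ nib s ((t >>> (p * nib r a + q * nib r b)) % 16)))) := by
  have : below t p q (.cons a b c l) s r n =
      force ((t >>> (p * nib r a + q * nib r b)) % 16) fun x =>
      force (nib s x) fun m =>
        sel(Nat.beq m 0;
          sel(Nat.beq (n + 1) c;
            force (put1 s x c) fun s => force (put1 r c x) fun r => below t p q l s r c;
            Nat.ble c n);
          sel(Nat.beq m c; below t p q l s r n; Nat.ble c m)) := rfl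
  rw [this]
  simp only [force_eq, rec_eq_cond, ble_eq, beq_eq]

theorem Cons.extend {σ : Equiv.Perm ℕ} {s r n x : ℕ} (h : Cons σ s r n) (hn : n + 1 ≤ 10)
    (hx : 1 ≤ x ∧ x ≤ 10) (e : σ x = n + 1) :
    Cons σ (put1 s x (n + 1)) (put1 r (n + 1) x) (n + 1) := by
  refine ⟨h.fx, fun i h1 h2 => ?_, fun i hi => ?_, fun y h1 h2 => ?_⟩
  · rw [nib_put1 _ _ _ _ (by omega)]
    split_ifs with h3
    · rw [h.zero i (by omega), Nat.zero_xor, h3, ← e, Equiv.symm_apply_apply]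
    · exact h.inv i h1 (by omega)
  · rw [nib_put1 _ _ _ _ (by omega), if_neg (by omega), h.zero i (by omega)]
  · rw [nib_put1 _ _ _ _ (by omega), h.lab y h1 h2]
    by_cases hy : y = x
    · subst hy; rw [if_pos rfl, e, if_neg (by omega), if_pos le_rfl, Nat.zero_xor]
    · have : σ y ≠ n + 1 := fun e' => hy (σ.injective (e'.trans e.symm))
      rw [if_neg hy]
      congr 1
      rw [eq_iff_iff]; omega

theorem Cons.restrict {σ : Equiv.Perm ℕ} {s r n x : ℕ} (hn : n + 1 ≤ 10)
    (hx : 1 ≤ x ∧ x ≤ 10) (h0 : nib s x = 0) (hz : ∀ i, n < i → nib r i = 0)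
    (h : Cons σ (put1 s x (n + 1)) (put1 r (n + 1) x) (n + 1)) : Cons σ s r n ∧ σ x = n + 1 := by
  have e : σ x = n + 1 := by
    have := h.inv (n + 1) (by omega) le_rfl
    rw [nib_put1 _ _ _ _ (by omega), if_pos rfl, hz _ (by omega), Nat.zero_xor] at this
    rw [this, Equiv.apply_symm_apply]
  refine ⟨⟨h.fx, fun i h1 h2 => ?_, hz, fun y h1 h2 => ?_⟩, e⟩
  · have := h.inv i h1 (by omega)
    rwa [nib_put1 _ _ _ _ (by omega), if_neg (by omega)] at this
  · by_cases hy : y = x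
    · subst hy; rw [h0, e, if_neg (by omega)]
    · have := h.lab y h1 h2
      have hne : σ y ≠ n + 1 := fun e' => hy (σ.injective (e'.trans e.symm))
      rw [nib_put1 _ _ _ _ (by omega), if_neg hy] at this
      rw [this]
      congr 1
      rw [eq_iff_iff]; omega

theorem below_sound {t p q : ℕ} {W : ℕ → ℕ → ℕ} (hW : ∀ a b, (1 ≤ a ∧ a ≤ 10) →
    (1 ≤ b ∧ b ≤ 10) → (t >>> (p * a + q * b)) % 16 = W a b) (hW' : ∀ a b, W a b ≤ 10)
    {l : Path} {s r n m : ℕ} (hm : m ≤ 10) (hwf : Wf n l.toList m)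
    (h : below t p q l s r n = true) {σ : Equiv.Perm ℕ} (hσ : Cons σ s r n) :
    LEw l.toList (relabel σ W) := by
  induction l generalizing s r n with
  | nil => trivial
  | cons a b c l ih =>
    have hn := hwf.le
    obtain ⟨ha, hb, hc, hwf⟩ := hwf
    have ha' := hσ.fx.symm.rng ⟨ha.1, by omega⟩
    have hb' := hσ.fx.symm.rng ⟨hb.1, by omega⟩
    rw [below_cons, hσ.inv a ha.1 ha.2, hσ.inv b hb.1 hb.2, hW _ _ ha' hb'] at h
    have hx' := hW' (σ.symm a) (σ.symm b)
    have hO : relabel σ W a b = σ (W (σ.symm a) (σ.symm b)) := rfl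
    generalize W (σ.symm a) (σ.symm b) = x at *
    change relabel σ W a b = 0 ∨ c < relabel σ W a b ∨ (relabel σ W a b = c ∧ LEw l.toList _)
    rw [hO]
    rcases Nat.eq_zero_or_pos x with rfl | hx
    · exact Or.inl hσ.fx.zero
    right
    have hs := hσ.lab x hx hx'
    have hσx := hσ.fx.rng ⟨hx, hx'⟩
    by_cases h0 : σ x ≤ n
    · rw [if_pos h0] at hs
      have h1 : σ x ≠ 0 := by omega
      rw [hs] at h
      simp only [h1, decide_false, cond_false] at h
      by_cases h2 : σ x = c
      · simp only [h2, decide_true, cond_true] at h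
        rw [max_eq_left (by omega)] at hwf
        exact Or.inr ⟨h2, ih hwf h hσ⟩
      · simp only [h2, decide_false, cond_false, decide_eq_true_eq] at h
        left; omega
    · rw [if_neg h0] at hs
      rw [hs] at h
      simp only [decide_true, cond_true] at h
      by_cases h2 : n + 1 = c
      · subst h2
        simp only [decide_true, cond_true] at h
        rw [max_eq_right (by omega)] at hwf
        by_cases h3 : σ x = n + 1
        · exact Or.inr ⟨h3, ih hwf h (hσ.extend (hwf.le.trans hm) ⟨hx, hx'⟩ h3)⟩
        · left; omega
      · simp only [h2, decide_false, cond_false, decide_eq_true_eq] at h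
        left; omega

theorem below_complete {t p q : ℕ} {W : ℕ → ℕ → ℕ} (hW : ∀ a b, (1 ≤ a ∧ a ≤ 10) →
    (1 ≤ b ∧ b ≤ 10) → (t >>> (p * a + q * b)) % 16 = W a b) (hW' : ∀ a b, W a b ≤ 10)
    {l : Path} {s r n m : ℕ} (hm : m ≤ 10) (hwf : Wf n l.toList m)
    (hσ : ∃ σ, Cons σ s r n) (h : ∀ σ, Cons σ s r n → LEs l.toList (relabel σ W)) :
    below t p q l s r n = true := by
  induction l generalizing s r n with
  | nil => rfl
  | cons a b c l ih =>
    obtain ⟨σ, hσ⟩ := hσ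
    have hn := hwf.le
    obtain ⟨ha, hb, hc, hwf⟩ := hwf
    have ha' := hσ.fx.symm.rng ⟨ha.1, by omega⟩
    have hb' := hσ.fx.symm.rng ⟨hb.1, by omega⟩
    have h' : ∀ τ, Cons τ s r n → c < τ (W (σ.symm a) (σ.symm b)) ∨
        (τ (W (σ.symm a) (σ.symm b)) = c ∧ LEs l.toList (relabel τ W)) := by
      intro τ hτ
      have := h τ hτ
      change c < τ (W (τ.symm a) (τ.symm b)) ∨ (τ (W (τ.symm a) (τ.symm b)) = c ∧ _) at this
      rwa [← hτ.inv a ha.1 ha.2, ← hτ.inv b hb.1 hb.2, hσ.inv a ha.1 ha.2,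
        hσ.inv b hb.1 hb.2] at this
    rw [below_cons, hσ.inv a ha.1 ha.2, hσ.inv b hb.1 hb.2, hW _ _ ha' hb']
    have hx' := hW' (σ.symm a) (σ.symm b)
    generalize W (σ.symm a) (σ.symm b) = x at *
    have hx : 1 ≤ x := by
      rcases Nat.eq_zero_or_pos x with rfl | hx
      · have := h' σ hσ
        rw [hσ.fx.zero] at this
        omega
      · exact hx
    have hs := hσ.lab x hx hx'
    have hσx := hσ.fx.rng ⟨hx, hx'⟩
    have hσ' := h' σ hσ
    by_cases h0 : σ x ≤ n
    · rw [if_pos h0] at hs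
      have h1 : σ x ≠ 0 := by omega
      rw [hs]
      simp only [h1, decide_false, cond_false]
      by_cases h2 : σ x = c
      · simp only [h2, decide_true, cond_true]
        rw [max_eq_left (by omega)] at hwf
        refine ih hwf ⟨σ, hσ⟩ fun τ hτ => ?_
        have h3 := hτ.lab x hx hx'
        have h4 := h' τ hτ
        have h5 : τ x = c := by split_ifs at h3 <;> omega
        exact (h4.resolve_left (by omega)).2
      · simp only [h2, decide_false, cond_false, decide_eq_true_eq]
        omega
    · rw [if_neg h0] at hs
      rw [hs]
      simp only [decide_true, cond_true]
      by_cases h2 : n + 1 = c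
      · subst h2
        simp only [decide_true, cond_true]
        rw [max_eq_right (by omega)] at hwf
        have hn1 := hwf.le.trans hm
        refine ih hwf ⟨Equiv.swap (σ x) (n + 1) * σ, ?_⟩ fun τ hτ => ?_
        · have hfx : Fx (Equiv.swap (σ x) (n + 1) * σ) :=
            (Fx.swap hσx ⟨by omega, hn1⟩).mul hσ.fx
          refine Cons.extend ⟨hfx, fun i h1 h2 => ?_, hσ.zero, fun y h1 h2 => ?_⟩ hn1 ⟨hx, hx'⟩ ?_
          · rw [hσ.inv i h1 h2, Equiv.eq_symm_apply, Equiv.Perm.mul_apply, Equiv.apply_symm_apply,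
              Equiv.swap_apply_of_ne_of_ne (by omega) (by omega)]
          · rw [hσ.lab y h1 h2, Equiv.Perm.mul_apply]
            rcases eq_or_ne (σ y) (σ x) with e | e
            · rw [e, Equiv.swap_apply_left, if_neg h0, if_neg (by omega)]
            rcases eq_or_ne (σ y) (n + 1) with e' | e'
            · rw [e', Equiv.swap_apply_right, if_neg h0, if_neg (by omega)]
            · rw [Equiv.swap_apply_of_ne_of_ne e e']
          · rw [Equiv.Perm.mul_apply, Equiv.swap_apply_left]
        · obtain ⟨h3, h4⟩ := hτ.restrict hn1 ⟨hx, hx'⟩ hs hσ.zero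
          exact ((h' τ h3).resolve_left (by omega)).2
      · simp only [h2, decide_false, cond_false, decide_eq_true_eq]
        omega

/-! ### The test for complete tables -/

theorem rec_and (b e : Bool) :
    @Bool.rec (fun _ => Bool) false e b = true ↔ b = true ∧ e = true := by cases b <;> simp

theorem rec_or (b e : Bool) :
    @Bool.rec (fun _ => Bool) e true b = true ↔ b = true ∨ e = true := by cases b <;> simp

theorem rec_not (b e : Bool) :
    @Bool.rec (fun _ => Bool) e false b = true ↔ b = false ∧ e = true := by cases b <;> simp

theorem traces_iff (t : ℕ) (l : Path) (n : ℕ) : traces t l n = true ↔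
    Wf n l.toList 10 ∧ ∀ e ∈ l.toList, look t e.1 e.2.1 = e.2.2 := by
  induction l generalizing n with
  | nil =>
    have : traces t .nil n = Nat.beq n 10 := rfl
    rw [this]; simp [Path.toList, Wf]
  | cons a b c l ih =>
    have : traces t (.cons a b c l) n =
      sel(Nat.ble 1 a; sel(Nat.ble a n; sel(Nat.ble 1 b; sel(Nat.ble b n;
        sel(Nat.beq (look t a b) c; sel(Nat.ble 1 c;
          sel(Nat.ble c n; traces t l n; sel(Nat.beq c (n + 1); traces t l c; false));
          false); false); false); false); false); false) := rfl
    rw [this]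
    by_cases h : c ≤ n
    · have hb : Nat.ble c n = true := Nat.ble_eq.mpr h
      simp only [hb, rec_and, ih, Path.toList, Wf, List.forall_mem_cons, Nat.ble_eq, Nat.beq_eq,
        max_eq_left h]
      constructor
      · rintro ⟨h1, h2, h3, h4, h5, h6, h7, h8⟩
        exact ⟨⟨⟨h1, h2⟩, ⟨h3, h4⟩, ⟨h6, by omega⟩, h7⟩, h5, h8⟩
      · rintro ⟨⟨⟨h1, h2⟩, ⟨h3, h4⟩, ⟨h6, _⟩, h7⟩, h5, h8⟩
        exact ⟨h1, h2, h3, h4, h5, h6, h7, h8⟩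
    · have hb : Nat.ble c n = false := by rw [← Bool.not_eq_true, Nat.ble_eq]; exact h
      simp only [hb, rec_and, ih, Path.toList, Wf, List.forall_mem_cons, Nat.ble_eq, Nat.beq_eq,
        max_eq_right (le_of_not_ge h)]
      constructor
      · rintro ⟨h1, h2, h3, h4, h5, h6, rfl, h7, h8⟩
        exact ⟨⟨⟨h1, h2⟩, ⟨h3, h4⟩, ⟨h6, by omega⟩, h7⟩, h5, h8⟩
      · rintro ⟨⟨⟨h1, h2⟩, ⟨h3, h4⟩, ⟨h6, _⟩, h7⟩, h5, h8⟩
        exact ⟨h1, h2, h3, h4, h5, h6, by omega, h7, h8⟩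

theorem valid_iff (t : ℕ) : valid t = true ↔
    (∀ a, 1 ≤ a → a ≤ 10 → ∀ b, 1 ≤ b → b ≤ 10 → look t a b = 0 ∨
      (look t b (look t a b) = a ∧ look t a b ≤ 10 ∧ a ≠ b ∧ look t b a ≠ 0 ∧
        look t b a ≠ look t a b)) ∧
    ∀ v, 1 ≤ v → v ≤ 10 → find t v ≠ 0 ∧ walk t v (find t v) (fun _ => false)
      (fun k => Nat.beq k (rowdeg t v)) 10 (find t v) 1 = true := by
  have : valid t = sel(all (fun a => all (fun b => force (look t a b) fun c =>
      sel(Nat.beq c 0; true; sel(Nat.beq (look t b c) a; sel(Nat.ble c 10; sel(Nat.beq a b; false;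
        force (look t b a) fun d => sel(Nat.beq d 0; false; sel(Nat.beq d c; false; true)));
        false); false))) 10) 10;
    all (fun v => force (find t v) fun x => sel(Nat.beq x 0; false;
      walk t v x (fun _ => false) (fun k => Nat.beq k (rowdeg t v)) 10 x 1)) 10;
    false) := rfl
  rw [this]
  simp only [force_eq, rec_and, rec_or, rec_not, all_iff, Nat.ble_eq, Nat.beq_eq,
    ← Bool.not_eq_true, and_true, ne_eq]

theorem valid_complete {t : ℕ} (h : Good (tab t)) : valid t = true := by
  rw [valid_iff]
  refine ⟨fun a h1 h2 b h3 h4 => ?_, fun v h1 h2 => ?_⟩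
  · by_cases h0 : look t a b = 0
    · exact Or.inl h0
    right
    have e := tab_eq (t := t) h1 h2 h3 h4
    rw [← e] at h0 ⊢
    have hr := h.rng h0
    have ho := h.opp h0
    rw [← tab_eq h3 h4 (by omega) hr.2.2.1, h.rot h0, ← tab_eq h3 h4 h1 h2]
    exact ⟨rfl, hr.2.2.1, hr.2.2.2, ho.1, ho.2⟩
  · have hx : ∃ x, tab t x v ≠ 0 := by
      obtain ⟨w, hw⟩ := h.nz h1 h2
      exact ⟨w, h.ne_iff.1 hw⟩
    obtain ⟨hf, hx⟩ := find_spec h1 h2 hx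
    refine ⟨hf, ?_⟩
    generalize find t v = x at *
    have hrng := h.rng hx
    have hx' := h.ne_iff.1 hx
    obtain ⟨j, hj, hlt, hw⟩ := walk_tab (t := t) (v := v) (cur := x) x (fun _ => false)
      (fun k => Nat.beq k (rowdeg t v)) 10 1 ⟨h1, h2⟩ (fun w => by
        by_cases hw : tab t v w = 0
        · omega
        · exact (h.rng hw).2.2.1) hrng.1
    obtain ⟨m, hm1, hm2, hm⟩ := h.exists_period hx'
    rcases hw with ⟨rfl, _⟩ | ⟨_, h0, _⟩ | ⟨h3, h4, h5, hw⟩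
    · have := (hlt (m - 1) (by omega)).2
      rw [Nat.sub_add_cancel hm1] at this
      exact absurd hm this
    · rw [Function.iterate_succ_apply'] at h0
      exact absurd h0 (h.iter hx' j)
    · rw [hw, rowdeg_eq t v h1 h2, Nat.beq_eq]
      refine le_antisymm ?_ ((h.deg_le hx' (by omega) h5).trans (by omega))
      rw [add_comm]
      refine h.le_deg hx' h5 fun i hi hi' => ?_
      have := (hlt (i - 1) (by omega)).2
      rwa [Nat.sub_add_cancel hi] at this

theorem conn_of_wf {O : ℕ → ℕ → ℕ} (h : Pre O) {l : List (ℕ × ℕ × ℕ)} {n m : ℕ} (hwf : Wf n l m)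
    (he : ∀ e ∈ l, O e.1 e.2.1 = e.2.2)
    (hn : ∀ v, 1 ≤ v → v ≤ n → Relation.ReflTransGen (fun x y => O x y ≠ 0) v 1) :
    ∀ v, 1 ≤ v → v ≤ m → Relation.ReflTransGen (fun x y => O x y ≠ 0) v 1 := by
  induction l generalizing n with
  | nil => cases hwf; exact hn
  | cons e l ih =>
    obtain ⟨a, b, c⟩ := e
    obtain ⟨ha, hb, hc, hwf⟩ := hwf
    rw [List.forall_mem_cons] at he
    refine ih hwf he.2 fun v h1 h2 => ?_
    by_cases hv : v ≤ n
    · exact hn v h1 hv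
    · obtain rfl : v = c := by omega
      have h0 : O a b = v := he.1
      have h3 : O v a = b := by rw [← h0]; exact h.rot2 (by omega)
      exact Relation.ReflTransGen.head (by rw [h3]; omega) (hn a ha.1 ha.2)

theorem good_of_valid {t : ℕ} (hv : valid t = true) (ht : total t = 60) (h12 : look t 1 2 = 3)
    {l : Path} (hl : traces t l 2 = true) : Good (tab t) := by
  rw [valid_iff] at hv
  obtain ⟨h1, h2⟩ := hv
  have key : ∀ {a b}, tab t a b ≠ 0 → ((1 ≤ a ∧ a ≤ 10) ∧ (1 ≤ b ∧ b ≤ 10) ∧ tab t a b ≤ 10 ∧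
      a ≠ b) ∧ tab t b (tab t a b) = a ∧ (tab t b a ≠ 0 ∧ tab t b a ≠ tab t a b) := by
    intro a b h0
    obtain ⟨ha, hb⟩ := tab_rng h0
    have e := tab_eq (t := t) ha.1 ha.2 hb.1 hb.2
    have := h1 a ha.1 ha.2 b hb.1 hb.2
    rw [← e] at this
    obtain ⟨h3, h4, h5, h6, h7⟩ := this.resolve_left h0
    rw [← tab_eq hb.1 hb.2 (by omega) h4] at h3
    rw [← tab_eq hb.1 hb.2 ha.1 ha.2] at h6 h7
    exact ⟨⟨ha, hb, h4, h5⟩, h3, h6, h7⟩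
  have hP : Pre (tab t) := ⟨fun h => (key h).1, fun h => (key h).2.1, fun h => (key h).2.2⟩
  have hcyc : ∀ v, 1 ≤ v → v ≤ 10 → ∃ x, tab t v x ≠ 0 ∧ ∀ w, tab t v w ≠ 0 → ∃ i,
      i ≤ deg (tab t) v ∧ (tab t v)^[i] x = w ∧ (tab t v)^[deg (tab t) v] x = x := by
    intro v hv1 hv2
    obtain ⟨hf, hw⟩ := h2 v hv1 hv2
    have hf10 : find t v ≤ 10 := by
      have : ∀ n, @Nat.rec (fun _ => ℕ) 0
          (fun x ih => sel(Nat.beq (look t (Nat.succ x) v) 0; ih; Nat.succ x)) n ≤ n := by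
        intro n
        induction n with
        | zero => exact le_rfl
        | succ n ih =>
          simp only [rec_eq_cond] at ih ⊢
          cases Nat.beq (look t n.succ v) 0
          · exact le_rfl
          · exact ih.trans (by omega)
      exact this 10
    generalize find t v = x at *
    obtain ⟨j, hj, hlt, h⟩ := walk_tab (t := t) (v := v) (cur := x) x (fun _ => false)
      (fun k => Nat.beq k (rowdeg t v)) 10 1 ⟨hv1, hv2⟩ (fun w => by
        by_cases hw : tab t v w = 0
        · omega
        · exact (hP.rng hw).2.2.1) ⟨by omega, hf10⟩
    rcases h with ⟨_, h⟩ | ⟨_, _, h⟩ | ⟨h3, h4, h5, h⟩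
    · rw [h] at hw; cases hw
    · rw [h] at hw; cases hw
    rw [h, rowdeg_eq t v hv1 hv2, Nat.beq_eq] at hw
    have hx0 : tab t v x ≠ 0 := by
      rcases Nat.eq_zero_or_pos j with rfl | hj0
      · exact h4
      · exact (hlt 0 hj0).1
    refine ⟨x, hx0, ?_⟩
    have hj1 : j + 1 = deg (tab t) v := by omega
    rw [hj1] at h5
    have hcard := iter_image_card h5 fun i hi hi' => by
      have := (hlt (i - 1) (by omega)).2
      rwa [Nat.sub_add_cancel hi] at this
    have heq := Finset.eq_of_subset_of_card_le
      (t := (Finset.Icc 1 10).filter fun b => tab t v b ≠ 0) (fun c hc => by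
        obtain ⟨i, _, rfl⟩ := Finset.mem_image.1 hc
        have := hP.iter hx0 i
        exact Finset.mem_filter.2 ⟨Finset.mem_Icc.2 (hP.rng this).2.1, this⟩) hcard.ge
    intro w hw0
    have : w ∈ (Finset.Icc 1 10).filter fun b => tab t v b ≠ 0 :=
      Finset.mem_filter.2 ⟨Finset.mem_Icc.2 (hP.rng hw0).2.1, hw0⟩
    rw [← heq] at this
    obtain ⟨i, hi, rfl⟩ := Finset.mem_image.1 this
    exact ⟨i, (Finset.mem_range.1 hi).le, rfl, h5⟩
  refine ⟨hP, fun {v} hv1 hv2 => ?_, fun {v w w'} hw hw' => ?_, ?_, fun {a b} ha ha' hb hb' => ?_⟩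
  · obtain ⟨x, hx, _⟩ := hcyc v hv1 hv2
    exact ⟨x, hx⟩
  · have hv := (hP.rng hw).1
    obtain ⟨x, hx, hall⟩ := hcyc v hv.1 hv.2
    obtain ⟨i, hi, rfl, e⟩ := hall w hw
    obtain ⟨i', hi', rfl, _⟩ := hall w' hw'
    refine ⟨i' + (deg (tab t) v - i), ?_⟩
    rw [← Function.iterate_add_apply, add_assoc, Nat.sub_add_cancel hi,
      Function.iterate_add_apply, e]
  · rw [← total_eq, ht]
  · rw [traces_iff] at hl
    have hadj : ∀ {x y}, Relation.ReflTransGen (fun x y => tab t x y ≠ 0) x y →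
        Relation.ReflTransGen (fun x y => tab t x y ≠ 0) y x := fun h => by
      induction h with
      | refl => exact .refl
      | tail _ hbc ih => exact .head (hP.ne_iff.1 hbc) ih
    have h21 : tab t 1 2 ≠ 0 := by
      rw [tab_eq (by omega) (by omega) (by omega) (by omega), h12]; omega
    have hto := conn_of_wf hP hl.1 (fun e he => ?_) (fun v hv1 hv2 => ?_)
    · exact (hto a ha ha').trans (hadj (hto b hb hb'))
    · have hmem : ∀ (l : List (ℕ × ℕ × ℕ)) (n m : ℕ), Wf n l m → m ≤ 10 → ∀ e ∈ l,
          (1 ≤ e.1 ∧ e.1 ≤ 10) ∧ 1 ≤ e.2.1 ∧ e.2.1 ≤ 10 := by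
        intro l
        induction l with
        | nil => simp
        | cons e l ih =>
          obtain ⟨a, b, c⟩ := e
          intro n m h hm e he
          have := h.le
          obtain ⟨h1, h2, h3, h4⟩ := h
          rcases List.mem_cons.1 he with rfl | he
          · exact ⟨⟨h1.1, h1.2.trans (this.trans hm)⟩, h2.1, h2.2.trans (this.trans hm)⟩
          · exact ih _ _ h4 hm e he
      have := hmem _ _ _ hl.1 le_rfl e he
      rw [tab_eq this.1.1 this.1.2 this.2.1 this.2.2]
      exact hl.2 e he
    · obtain rfl | rfl : v = 1 ∨ v = 2 := by omega
      · exact Relation.ReflTransGen.refl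
      · exact Relation.ReflTransGen.single (hP.ne_iff.1 h21)

theorem rec_imp (b t e : Bool) : @Bool.rec (fun _ => Bool) e t b = true ↔
    (b = true → t = true) ∧ (¬b = true → e = true) := by cases b <;> simp

theorem minimal_iff (t d0 d1 : ℕ) (l : Path) : minimal t d0 d1 l = true ↔
    ∀ u, 1 ≤ u → u ≤ 10 → (rowdeg t u = d0 → ∀ v, 1 ≤ v → v ≤ 10 → look t u v ≠ 0 →
      (rowdeg t v = d1 →
        below t 64 4 l (put1 (put1 0 u 1) v 2) (put1 (put1 0 1 u) 2 v) 2 = true ∧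
        below t 4 64 l (put1 (put1 0 u 1) v 2) (put1 (put1 0 1 u) 2 v) 2 = true) ∧
      (rowdeg t v ≠ d1 → rowdeg t v ≤ d1)) ∧ (rowdeg t u ≠ d0 → d0 ≤ rowdeg t u) := by
  have : minimal t d0 d1 l = all (fun u => sel(Nat.beq (rowdeg t u) d0;
    all (fun v => sel(Nat.beq (look t u v) 0; true;
      sel(Nat.beq (rowdeg t v) d1;
        force (put1 (put1 0 u 1) v 2) fun s => force (put1 (put1 0 1 u) 2 v) fun r =>
          sel(below t 64 4 l s r 2; below t 4 64 l s r 2; false);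
        Nat.ble (rowdeg t v) d1))) 10;
    Nat.ble d0 (rowdeg t u))) 10 := rfl
  have h : ∀ p q : Prop, ((p → q) ∧ (¬p → false = true)) ↔ p ∧ q := fun p q => by
    by_cases hp : p <;> simp [hp]
  rw [this]
  simp only [rec_imp, all_iff, force_eq, h, Nat.beq_eq, Nat.ble_eq, implies_true, true_and, ne_eq]

theorem cons_init {σ : Equiv.Perm ℕ} {u v : ℕ} (hu : 1 ≤ u ∧ u ≤ 10) (hv : 1 ≤ v ∧ v ≤ 10)
    (huv : u ≠ v) : Cons σ (put1 (put1 0 u 1) v 2) (put1 (put1 0 1 u) 2 v) 2 ↔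
      Fx σ ∧ σ u = 1 ∧ σ v = 2 := by
  have h0 : ∀ i, nib 0 i = 0 := fun i => by simp [nib_def]
  have hs : ∀ i, nib (put1 (put1 0 u 1) v 2) i = if i = v then 2 else if i = u then 1 else 0 := by
    intro i
    rw [nib_put1 _ _ _ _ (by omega), nib_put1 _ _ _ _ (by omega), h0]
    split_ifs with h1 h2 <;> first | rfl | (exfalso; omega)
  have hr : ∀ i, nib (put1 (put1 0 1 u) 2 v) i = if i = 2 then v else if i = 1 then u else 0 := by
    intro i
    rw [nib_put1 _ _ _ _ (by omega), nib_put1 _ _ _ _ (by omega), h0]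
    split_ifs with h1 h2 <;> first | (exfalso; omega) | simp
  constructor
  · intro h
    have h1 := h.inv 1 (by omega) (by omega)
    have h2 := h.inv 2 (by omega) (by omega)
    rw [hr, if_neg (by omega), if_pos rfl] at h1
    rw [hr, if_pos rfl] at h2
    exact ⟨h.fx, by rw [h1, Equiv.apply_symm_apply], by rw [h2, Equiv.apply_symm_apply]⟩
  · rintro ⟨hfx, h1, h2⟩
    refine ⟨hfx, fun i hi hi' => ?_, fun i hi => ?_, fun x hx hx' => ?_⟩
    · rw [hr, Equiv.eq_symm_apply]
      obtain rfl | rfl : i = 1 ∨ i = 2 := by omega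
      · simpa using h1
      · simpa using h2
    · rw [hr, if_neg (by omega), if_neg (by omega)]
    · rw [hs]
      have hσx := hfx.rng ⟨hx, hx'⟩
      have e1 : x = u ↔ σ x = 1 := by rw [← h1]; exact σ.injective.eq_iff.symm
      have e2 : x = v ↔ σ x = 2 := by rw [← h2]; exact σ.injective.eq_iff.symm
      simp only [e1, e2]
      split_ifs <;> omega

/-- The table `tab t` is the canonical torus with code `l`. -/
structure Canon (O : ℕ → ℕ → ℕ) (d0 d1 : ℕ) (l : List (ℕ × ℕ × ℕ))
    (R : List (ℕ × ℕ × ℕ) → (ℕ → ℕ → ℕ) → Prop) : Prop where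
  good : Good O
  deg1 : deg O 1 = d0
  deg2 : deg O 2 = d1
  o12 : O 1 2 = 3
  wf : Wf 2 l 10
  ent : ∀ e ∈ l, O e.1 e.2.1 = e.2.2
  min : ∀ v, 1 ≤ v → v ≤ 10 → d0 ≤ deg O v
  max : ∀ u v, deg O u = d0 → O u v ≠ 0 → deg O v ≤ d1
  below : ∀ O', Eqv O O' → deg O' 1 = d0 → deg O' 2 = d1 → O' 1 2 ≠ 0 → R l O'

theorem Wf.mem {l : List (ℕ × ℕ × ℕ)} {n m : ℕ} (h : Wf n l m) {e : ℕ × ℕ × ℕ} (he : e ∈ l) :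
    (1 ≤ e.1 ∧ e.1 ≤ m) ∧ (1 ≤ e.2.1 ∧ e.2.1 ≤ m) ∧ 1 ≤ e.2.2 ∧ e.2.2 ≤ m := by
  induction l generalizing n with
  | nil => simp at he
  | cons e l ih =>
    obtain ⟨a, b, c⟩ := e
    obtain ⟨h1, h2, h3, h4⟩ := h
    have := h4.le
    rcases List.mem_cons.1 he with rfl | he
    · exact ⟨⟨h1.1, h1.2.trans ((le_max_left _ _).trans this)⟩,
        ⟨h2.1, h2.2.trans ((le_max_left _ _).trans this)⟩, h3.1, (le_max_right _ _).trans this⟩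
    · exact ih h4 he

theorem tab_le {t a b : ℕ} (h : Pre (tab t)) : tab t a b ≤ 10 := by
  by_cases hw : tab t a b = 0
  · omega
  · exact (h.rng hw).2.2.1

theorem accept_iff (t d0 d1 : ℕ) (l : Path) : accept t d0 d1 l = true ↔
    total t = 60 ∧ rowdeg t 1 = d0 ∧ rowdeg t 2 = d1 ∧ look t 1 2 = 3 ∧
      minimal t d0 d1 l = true ∧ traces t l 2 = true ∧ valid t = true := by
  have : accept t d0 d1 l =
    sel(Nat.beq (total t) 60; sel(Nat.beq (rowdeg t 1) d0; sel(Nat.beq (rowdeg t 2) d1;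
      sel(Nat.beq (look t 1 2) 3; sel(minimal t d0 d1 l; sel(traces t l 2; valid t;
      false); false); false); false); false); false) := rfl
  rw [this]
  simp only [rec_and, Nat.beq_eq]

theorem accept_sound {t d0 d1 : ℕ} {l : Path} (h : accept t d0 d1 l = true) :
    Canon (tab t) d0 d1 l.toList LEw := by
  rw [accept_iff] at h
  obtain ⟨h1, h2, h3, h4, h5, h6, h7⟩ := h
  have hg := good_of_valid h7 h1 h4 h6
  rw [traces_iff] at h6
  rw [minimal_iff] at h5
  have hrd : ∀ v, 1 ≤ v → v ≤ 10 → rowdeg t v = deg (tab t) v := fun v => rowdeg_eq t v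
  refine ⟨hg, by rw [← hrd 1 (by omega) (by omega), h2], by rw [← hrd 2 (by omega) (by omega), h3],
    by rw [tab_eq (by omega) (by omega) (by omega) (by omega), h4], h6.1, fun e he => ?_,
    fun v hv hv' => ?_, fun u v hu huv => ?_, fun O' hO' e1 e2 e3 => ?_⟩
  · have := h6.1.mem he
    rw [tab_eq this.1.1 this.1.2 this.2.1.1 this.2.1.2, h6.2 e he]
  · rw [← hrd v hv hv']
    by_cases h8 : rowdeg t v = d0
    · exact h8.ge
    · exact (h5 v hv hv').2 h8
  · obtain ⟨hu', hv', _, _⟩ := hg.rng huv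
    rw [← hrd u hu'.1 hu'.2] at hu
    rw [tab_eq hu'.1 hu'.2 hv'.1 hv'.2] at huv
    rw [← hrd v hv'.1 hv'.2]
    by_cases h8 : rowdeg t v = d1
    · exact h8.le
    · exact ((h5 u hu'.1 hu'.2).1 hu v hv'.1 hv'.2 huv).2 h8
  · obtain ⟨σ, hσ, hO'⟩ := hO'
    have hu := hσ.symm.rng (x := 1) (by omega)
    have hv := hσ.symm.rng (x := 2) (by omega)
    have huv : σ.symm 1 ≠ σ.symm 2 := fun e => by simpa using σ.symm.injective e
    have hinit := (cons_init (σ := σ) hu hv huv).2 ⟨hσ, by simp, by simp⟩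
    have key : deg (tab t) (σ.symm 1) = d0 ∧ deg (tab t) (σ.symm 2) = d1 ∧
        tab t (σ.symm 1) (σ.symm 2) ≠ 0 := by
      rcases hO' with rfl | rfl
      · rw [← deg_relabel hσ, ← deg_relabel hσ (tab t) (σ.symm 2), Equiv.apply_symm_apply,
          Equiv.apply_symm_apply]
        exact ⟨e1, e2, fun e => e3 (hσ.eq_zero.2 e)⟩
      · rw [← hg.deg_flip, ← hg.deg_flip (σ.symm 2), ← deg_relabel hσ,
          ← deg_relabel hσ _ (σ.symm 2), Equiv.apply_symm_apply, Equiv.apply_symm_apply]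
        exact ⟨e1, e2, hg.ne_iff.2 fun e => e3 (hσ.eq_zero.2 e)⟩
    obtain ⟨k1, k2, k3⟩ := key
    rw [← hrd _ hu.1 hu.2] at k1
    rw [← hrd _ hv.1 hv.2] at k2
    rw [tab_eq hu.1 hu.2 hv.1 hv.2] at k3
    obtain ⟨b1, b2⟩ := ((h5 _ hu.1 hu.2).1 k1 _ hv.1 hv.2 k3).1 k2
    rcases hO' with rfl | rfl
    · exact below_sound (fun a b ha hb => (tab_eq ha.1 ha.2 hb.1 hb.2).symm) (fun a b => tab_le hg.1)
        le_rfl h6.1 b1 hinit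
    · exact below_sound (W := fun a b => tab t b a)
        (fun a b ha hb => by rw [tab_eq hb.1 hb.2 ha.1 ha.2, add_comm]; rfl)
        (fun a b => tab_le hg.1) le_rfl h6.1 b2 hinit

theorem exists_fx {u v : ℕ} (hu : 1 ≤ u ∧ u ≤ 10) (hv : 1 ≤ v ∧ v ≤ 10) (huv : u ≠ v) :
    ∃ σ, Fx σ ∧ σ u = 1 ∧ σ v = 2 := by
  refine ⟨Equiv.swap (Equiv.swap u 1 v) 2 * Equiv.swap u 1, ?_, ?_, ?_⟩
  · have h1 := Fx.swap hu (y := 1) (by omega)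
    exact (Fx.swap (h1.rng hv) (by omega)).mul h1
  · rw [Equiv.Perm.mul_apply, Equiv.swap_apply_left]
    refine Equiv.swap_apply_of_ne_of_ne (fun e => huv ?_) (by omega)
    have : Equiv.swap u 1 u = Equiv.swap u 1 v := by rw [← e, Equiv.swap_apply_left]
    exact (Equiv.swap u 1).injective this
  · rw [Equiv.Perm.mul_apply, Equiv.swap_apply_left]

theorem accept_complete {t d0 d1 : ℕ} {l : Path} (h : Canon (tab t) d0 d1 l.toList LEs) :
    accept t d0 d1 l = true := by
  have hg := h.good
  have hrd : ∀ v, 1 ≤ v → v ≤ 10 → rowdeg t v = deg (tab t) v := fun v => rowdeg_eq t v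
  rw [accept_iff, traces_iff, minimal_iff, total_eq, hg.tot, hrd 1 (by omega) (by omega),
    hrd 2 (by omega) (by omega), h.deg1, h.deg2, ← tab_eq (by omega) (by omega) (by omega) (by omega), h.o12]
  refine ⟨rfl, rfl, rfl, rfl, fun u hu1 hu2 => ⟨fun hu v hv1 hv2 huv => ⟨fun hv => ?_, fun _ => ?_⟩,
    fun _ => ?_⟩, ⟨h.wf, fun e he => ?_⟩, valid_complete hg⟩
  · rw [hrd u hu1 hu2] at hu
    rw [hrd v hv1 hv2] at hv
    rw [← tab_eq hu1 hu2 hv1 hv2] at huv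
    have hne := (hg.rng huv).2.2.2
    obtain ⟨σ, hσ⟩ := exists_fx ⟨hu1, hu2⟩ ⟨hv1, hv2⟩ hne
    constructor
    · refine below_complete (fun a b ha hb => (tab_eq ha.1 ha.2 hb.1 hb.2).symm)
        (fun a b => tab_le hg.1) le_rfl h.wf
        ⟨σ, (cons_init ⟨hu1, hu2⟩ ⟨hv1, hv2⟩ hne).2 hσ⟩ fun τ hτ => ?_
      obtain ⟨hτ, t1, t2⟩ := (cons_init ⟨hu1, hu2⟩ ⟨hv1, hv2⟩ hne).1 hτ
      refine h.below _ ⟨τ, hτ, Or.inl rfl⟩ ?_ ?_ ?_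
      · rw [← t1, deg_relabel hτ, hu]
      · rw [← t2, deg_relabel hτ, hv]
      · rw [← t1, ← t2, relabel_apply]; exact fun e => huv (hτ.eq_zero.1 e)
    · refine below_complete (W := fun a b => tab t b a)
        (fun a b ha hb => by rw [tab_eq hb.1 hb.2 ha.1 ha.2, add_comm]; rfl)
        (fun a b => tab_le hg.1) le_rfl h.wf
        ⟨σ, (cons_init ⟨hu1, hu2⟩ ⟨hv1, hv2⟩ hne).2 hσ⟩ fun τ hτ => ?_
      obtain ⟨hτ, t1, t2⟩ := (cons_init ⟨hu1, hu2⟩ ⟨hv1, hv2⟩ hne).1 hτ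
      refine h.below _ ⟨τ, hτ, Or.inr rfl⟩ ?_ ?_ ?_
      · rw [← t1, deg_relabel hτ, hg.deg_flip, hu]
      · rw [← t2, deg_relabel hτ, hg.deg_flip, hv]
      · rw [← t1, ← t2, relabel_apply]
        exact fun e => hg.ne_iff.1 huv (hτ.eq_zero.1 e)
  · rw [hrd u hu1 hu2] at hu
    rw [← tab_eq hu1 hu2 hv1 hv2] at huv
    rw [hrd v hv1 hv2]
    exact h.max u v hu huv
  · rw [hrd u hu1 hu2]
    exact h.min u hu1 hu2
  · have := h.wf.mem he
    rw [← tab_eq this.1.1 this.1.2 this.2.1.1 this.2.1.2, h.ent e he]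

/-! ### The tori found by the search are pairwise different -/

/-- The list consists of pairwise different canonical tori whose codes extend `l`. -/
def Sep (d0 d1 : ℕ) (l : List (ℕ × ℕ × ℕ)) (L : List ℕ) : Prop :=
  (∀ x ∈ L, ∃ p : Path, accept x d0 d1 p = true ∧ l <+: p.toList) ∧
    L.Pairwise fun x x' => ¬Eqv (tab x) (tab x')

theorem sep_nil (d0 d1 : ℕ) (l : List (ℕ × ℕ × ℕ)) : Sep d0 d1 l [] := ⟨by simp, .nil⟩

theorem walk_ind {R : List ℕ → Prop} (t v target : ℕ) {opn cl : ℕ → List ℕ}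
    (fuel cur k : ℕ) (h1 : ∀ y, R (opn y)) (h2 : ∀ k, R (cl k)) :
    R (walk t v target opn cl fuel cur k) := by
  obtain ⟨j, _, _, ⟨_, h⟩ | ⟨_, _, h⟩ | ⟨_, _, _, h⟩⟩ := walk_cases t v target opn cl fuel cur k
  · rw [h]; exact h1 _
  · rw [h]; exact h1 _
  · rw [h]; exact h2 _

theorem cond_ind {α : Type} {R : α → Prop} (b : Bool) {x y : α} (hx : R x) (hy : R y) :
    R (cond b x y) := by cases b <;> assumption

theorem nextv_succ (t d0 d1 n : ℕ) (l : Path) (k : ℕ → ℕ → List ℕ) (fuel a : ℕ) :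
    nextv t d0 d1 n l k (fuel + 1) a =
      cond (Nat.ble a n)
        (walk t a (find t a) (fun y => k a y)
          (fun _ => nextv t d0 d1 n l k fuel (a + 1)) 10 (find t a) 1)
        (cond (accept t d0 d1 (Path.rev l .nil)) [t] []) := by
  have : nextv t d0 d1 n l k (fuel + 1) a = sel(Nat.ble a n;
      force (find t a) fun x =>
        walk t a x (fun y => k a y) (fun _ => nextv t d0 d1 n l k fuel (a + 1)) 10 x 1;
      sel(accept t d0 d1 (Path.rev l Path.nil); [t]; [])) := rfl
  rw [this]
  simp only [rec_eq_cond, force_eq]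

theorem closed_eq (t dv ub d0 d1 v k : ℕ) (cont : ℕ → List ℕ) :
    closed t dv ub d0 d1 v k cont =
      cond (Nat.ble (nib dv v) k) (cond (Nat.ble (lb d0 d1 v) k)
        (cond (Nat.beq k d0)
          (cond (all (fun x => Nat.ble (nib dv x) (nib (setn (capNbrs t v d1 10 ub) v k) x)) 10)
            (cont (setn (capNbrs t v d1 10 ub) v k)) [])
          (cont (setn ub v k))) []) [] := by
  have : closed t dv ub d0 d1 v k cont =
      sel(Nat.ble (nib dv v) k; sel(Nat.ble (lb d0 d1 v) k;
        sel(Nat.beq k d0;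
          force (setn (capNbrs t v d1 10 ub) v k) fun ub =>
            sel(all (fun x => Nat.ble (nib dv x) (nib ub x)) 10; cont ub; []);
          force (setn ub v k) fun ub => cont ub); []); []) := rfl
  rw [this]
  simp only [rec_eq_cond, force_eq]

theorem addE_eq (d0 d1 ub x c old dv S : ℕ) (k : ℕ → ℕ → List ℕ) :
    addE d0 d1 ub x c old dv S k =
      cond (Nat.beq old 0)
        (cond (Nat.ble (nib ub x) (nib dv x)) [] (cond (Nat.ble (nib ub c) (nib dv c)) []
          (cond (Nat.ble (S + (cond (Nat.ble (lb d0 d1 x) (nib dv x)) 1 0 +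
              cond (Nat.ble (lb d0 d1 c) (nib dv c)) 1 0)) 60)
            (k (setn (setn dv x (nib dv x + 1)) c (nib dv c + 1))
              (S + (cond (Nat.ble (lb d0 d1 x) (nib dv x)) 1 0 +
                cond (Nat.ble (lb d0 d1 c) (nib dv c)) 1 0))) [])))
        (k dv S) := by
  have : addE d0 d1 ub x c old dv S k =
    sel(Nat.beq old 0;
    force (nib dv x) fun p => force (nib dv c) fun q =>
    sel(Nat.ble (nib ub x) p; []; sel(Nat.ble (nib ub c) q; [];
      force (Nat.add S (Nat.add sel(Nat.ble (lb d0 d1 x) p; 1; 0)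
        sel(Nat.ble (lb d0 d1 c) q; 1; 0))) fun S =>
      sel(Nat.ble S 60;
        force (setn (setn dv x (Nat.succ p)) c (Nat.succ q)) fun dv => k dv S; [])));
    k dv S) := rfl
  rw [this]
  simp only [rec_eq_cond, force_eq]
  rfl

theorem child_eq (d0 d1 t dv ub S n a y c : ℕ) (l : Path)
    (go : ℕ → ℕ → ℕ → ℕ → ℕ → ℕ → ℕ → Path → List ℕ) :
    child d0 d1 t dv ub S n a y c l go =
      cond (Nat.beq (look t y c) 0) (cond (Nat.beq (look t c a) 0)
        (addE d0 d1 ub y c (look t c y) dv S fun dv S =>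
          addE d0 d1 ub c a (look t a c) dv S fun dv S =>
          chk (put3 t a y c) dv ub d0 d1 y c a fun ub =>
          chk (put3 t a y c) dv ub d0 d1 c a y fun ub =>
          walk (put3 t a y c) a y
            (fun z => go (put3 t a y c) dv ub S (cond (Nat.ble c n) n c) a z (.cons a y c l))
            (fun k => closed (put3 t a y c) dv ub d0 d1 a k fun ub =>
              nextv (put3 t a y c) d0 d1 (cond (Nat.ble c n) n c) (.cons a y c l)
                (fun v z => go (put3 t a y c) dv ub S (cond (Nat.ble c n) n c) v z
                  (.cons a y c l)) 11 (a + 1)) 10 c 2) []) [] := by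
  have : child d0 d1 t dv ub S n a y c l go =
    sel(Nat.beq (look t y c) 0; sel(Nat.beq (look t c a) 0;
    addE d0 d1 ub y c (look t c y) dv S fun dv S =>
    addE d0 d1 ub c a (look t a c) dv S fun dv S =>
    force (put3 t a y c) fun t =>
    chk t dv ub d0 d1 y c a fun ub => chk t dv ub d0 d1 c a y fun ub =>
    force sel(Nat.ble c n; n; c) fun n =>
    walk t a y (fun z => go t dv ub S n a z (Path.cons a y c l))
      (fun k => closed t dv ub d0 d1 a k fun ub =>
        nextv t d0 d1 n (Path.cons a y c l)
          (fun v z => go t dv ub S n v z (Path.cons a y c l)) 11 (Nat.succ a)) 10 c 2;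
    []); []) := rfl
  rw [this]
  simp only [rec_eq_cond, force_eq, Nat.succ_eq_add_one]

/-- The children for the third vertices `1, …, m`. -/
noncomputable def children (d0 d1 fuel t dv ub S n a y : ℕ) (l : Path) : ℕ → List ℕ
  | 0 => []
  | m + 1 => children d0 d1 fuel t dv ub S n a y l m ++
      child d0 d1 t dv ub S n a y (m + 1) l (search d0 d1 fuel)

theorem search_succ (d0 d1 fuel t dv ub S n a y : ℕ) (l : Path) :
    search d0 d1 (fuel + 1) t dv ub S n a y l =
      children d0 d1 fuel t dv ub S n a y l (cond (Nat.ble 10 n) 10 (n + 1)) := by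
  have : search d0 d1 (fuel + 1) t dv ub S n a y l =
      @Nat.rec (fun _ => List ℕ) []
        (fun c rest => List.append rest
          (child d0 d1 t dv ub S n a y (Nat.succ c) l (search d0 d1 fuel)))
        sel(Nat.ble 10 n; 10; Nat.succ n) := rfl
  rw [this, rec_eq_cond]
  generalize (cond (Nat.ble 10 n) 10 (n + 1)) = m
  induction m with
  | zero => rfl
  | succ m ih => rw [children, ← ih]; rfl

theorem closed_ind {R : List ℕ → Prop} (h0 : R []) (t dv ub d0 d1 v k : ℕ) {cont : ℕ → List ℕ}
    (h : ∀ ub, R (cont ub)) : R (closed t dv ub d0 d1 v k cont) := by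
  rw [closed_eq]
  exact cond_ind _ (cond_ind _ (cond_ind _ (cond_ind _ (h _) h0) (h _)) h0) h0

theorem addE_ind {R : List ℕ → Prop} (h0 : R []) (d0 d1 ub x c old dv S : ℕ)
    {k : ℕ → ℕ → List ℕ} (h : ∀ dv S, R (k dv S)) : R (addE d0 d1 ub x c old dv S k) := by
  rw [addE_eq]
  exact cond_ind _ (cond_ind _ h0 (cond_ind _ h0 (cond_ind _ (h _ _) h0))) (h _ _)

theorem chk_ind {R : List ℕ → Prop} (h0 : R []) (t dv ub d0 d1 v tgt cur : ℕ)
    {cont : ℕ → List ℕ} (h : ∀ ub, R (cont ub)) : R (chk t dv ub d0 d1 v tgt cur cont) :=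
  walk_ind _ _ _ _ _ _ (fun _ => h _) fun _ => closed_ind h0 _ _ _ _ _ _ _ h

theorem nextv_sep {d0 d1 : ℕ} (t n : ℕ) {l : Path} {k : ℕ → ℕ → List ℕ} (fuel a : ℕ)
    (h : ∀ v z, Sep d0 d1 l.toList.reverse (k v z)) :
    Sep d0 d1 l.toList.reverse (nextv t d0 d1 n l k fuel a) := by
  induction fuel generalizing a with
  | zero => exact sep_nil _ _ _
  | succ fuel ih =>
    rw [nextv_succ]
    refine cond_ind _ (walk_ind _ _ _ _ _ _ (fun _ => h _ _) fun _ => ih _) ?_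
    cases hacc : accept t d0 d1 (l.rev .nil)
    · exact sep_nil _ _ _
    · refine ⟨fun x hx => ?_, List.pairwise_singleton _ _⟩
      rw [cond_true, List.mem_singleton] at hx
      subst hx
      exact ⟨_, hacc, by rw [Path.toList_rev]; exact List.prefix_append _ _⟩

theorem lew_append {l r : List (ℕ × ℕ × ℕ)} {a b c : ℕ} {O : ℕ → ℕ → ℕ}
    (h : LEw (l ++ (a, b, c) :: r) O) (he : ∀ e ∈ l, O e.1 e.2.1 = e.2.2)
    (h0 : ∀ e ∈ l, 1 ≤ e.2.2) (hab : O a b ≠ 0) : c ≤ O a b := by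
  induction l with
  | nil =>
    rcases h with h | h | ⟨h, _⟩ <;> omega
  | cons e l ih =>
    obtain ⟨a', b', c'⟩ := e
    rw [List.forall_mem_cons] at he h0
    obtain ⟨he1, he2⟩ := he
    obtain ⟨h01, h02⟩ := h0
    simp only at he1 h01
    rcases h with h | h | ⟨_, h⟩
    · omega
    · omega
    · exact ih h he2 h02

theorem not_eqv_of_lt {d0 d1 x x' a y c c' : ℕ} {l : List (ℕ × ℕ × ℕ)} {p p' : Path}
    (h : accept x d0 d1 p = true) (h' : accept x' d0 d1 p' = true)
    (hp : l ++ [(a, y, c)] <+: p.toList) (hp' : l ++ [(a, y, c')] <+: p'.toList) (hc : c < c') :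
    ¬Eqv (tab x) (tab x') := by
  intro he
  have h1 := accept_sound h
  have h2 := accept_sound h'
  have h3 := h2.below _ he.symm h1.deg1 h1.deg2 (by rw [h1.o12]; omega)
  obtain ⟨r, hr⟩ := hp
  obtain ⟨r', hr'⟩ := hp'
  rw [List.append_assoc, List.singleton_append] at hr hr'
  rw [← hr'] at h3
  have hent := h1.ent
  have hwf := h1.wf
  rw [← hr] at hent hwf
  have hac : tab x a y = c := hent (a, y, c) (by simp)
  have hc1 := (hwf.mem (e := (a, y, c)) (by simp)).2.2.1
  have := lew_append h3 (fun e he => hent e (by simp [he]))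
    (fun e he => (hwf.mem (by simp [he])).2.2.1) (by rw [hac]; simp only at hc1; omega)
  omega

theorem search_sep {d0 d1 : ℕ} (fuel t dv ub S n a y : ℕ) (l : Path) :
    Sep d0 d1 l.toList.reverse (search d0 d1 fuel t dv ub S n a y l) := by
  induction fuel generalizing t dv ub S n a y l with
  | zero => exact sep_nil _ _ _
  | succ fuel ih =>
    have hchild : ∀ c, Sep d0 d1 (l.toList.reverse ++ [(a, y, c)])
        (child d0 d1 t dv ub S n a y c l (search d0 d1 fuel)) := by
      intro c
      have h0 := sep_nil d0 d1 (l.toList.reverse ++ [(a, y, c)])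
      have ih' : ∀ t dv ub S n v z, Sep d0 d1 (l.toList.reverse ++ [(a, y, c)])
          (search d0 d1 fuel t dv ub S n v z (.cons a y c l)) := fun t dv ub S n v z => by
        have := ih t dv ub S n v z (.cons a y c l)
        rwa [Path.toList, List.reverse_cons] at this
      rw [child_eq]
      refine cond_ind _ (cond_ind _ (addE_ind h0 _ _ _ _ _ _ _ _ fun _ _ =>
        addE_ind h0 _ _ _ _ _ _ _ _ fun _ _ => chk_ind h0 _ _ _ _ _ _ _ _ fun _ =>
        chk_ind h0 _ _ _ _ _ _ _ _ fun _ => walk_ind _ _ _ _ _ _ (fun _ => ih' _ _ _ _ _ _ _)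
        fun _ => closed_ind h0 _ _ _ _ _ _ _ fun _ => ?_) h0) h0
      rw [show l.toList.reverse ++ [(a, y, c)] = (Path.cons a y c l).toList.reverse by
        rw [Path.toList, List.reverse_cons]]
      exact nextv_sep _ _ _ _ fun v z => ih _ _ _ _ _ _ _ _
    rw [search_succ]
    generalize (cond (Nat.ble 10 n) 10 (n + 1)) = m
    have key : (∀ x ∈ children d0 d1 fuel t dv ub S n a y l m, ∃ p : Path, ∃ c ≤ m,
        accept x d0 d1 p = true ∧ l.toList.reverse ++ [(a, y, c)] <+: p.toList) ∧
        (children d0 d1 fuel t dv ub S n a y l m).Pairwise fun x x' => ¬Eqv (tab x) (tab x') := by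
      induction m with
      | zero => exact ⟨by simp [children], .nil⟩
      | succ m ihm =>
        rw [children]
        refine ⟨fun x hx => ?_, List.pairwise_append.2 ⟨ihm.2, (hchild _).2, ?_⟩⟩
        · rcases List.mem_append.1 hx with hx | hx
          · obtain ⟨p, c, hc, h⟩ := ihm.1 x hx
            exact ⟨p, c, by omega, h⟩
          · obtain ⟨p, h⟩ := (hchild _).1 x hx
            exact ⟨p, m + 1, le_rfl, h⟩
        · intro x hx x' hx'
          obtain ⟨p, c, hc, h1, h2⟩ := ihm.1 x hx
          obtain ⟨p', h3, h4⟩ := (hchild _).1 x' hx'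
          exact not_eqv_of_lt h1 h3 h2 h4 (by omega)
    refine ⟨fun x hx => ?_, key.2⟩
    obtain ⟨p, c, _, h1, h2⟩ := key.1 x hx
    exact ⟨p, h1, (List.prefix_append _ _).trans h2⟩

theorem Eqv.exists_dart {O O' : ℕ → ℕ → ℕ} (h : Eqv O O') (hO : Good O) {a b : ℕ}
    (hab : O' a b ≠ 0) : ∃ u v, O u v ≠ 0 ∧ deg O u = deg O' a ∧ deg O v = deg O' b := by
  obtain ⟨σ, hσ, rfl | rfl⟩ := h
  · refine ⟨σ.symm a, σ.symm b, fun e => hab (hσ.eq_zero.2 e), ?_, ?_⟩ <;>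
    · rw [← deg_relabel hσ, Equiv.apply_symm_apply]
  · refine ⟨σ.symm a, σ.symm b, hO.ne_iff.2 fun e => hab (hσ.eq_zero.2 e), ?_, ?_⟩ <;>
    · rw [← hO.deg_flip, ← deg_relabel hσ, Equiv.apply_symm_apply]

theorem Canon.degrees_le {O O' : ℕ → ℕ → ℕ} {d0 d1 d0' d1' : ℕ} {l l' : List (ℕ × ℕ × ℕ)}
    {R R' : List (ℕ × ℕ × ℕ) → (ℕ → ℕ → ℕ) → Prop} (h : Canon O d0 d1 l R)
    (h' : Canon O' d0' d1' l' R') (e : Eqv O O') : d0 ≤ d0' ∧ (d0 = d0' → d1' ≤ d1) := by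
  obtain ⟨u, v, huv, hu, hv⟩ := e.exists_dart h.good (a := 1) (b := 2) (by rw [h'.o12]; omega)
  rw [h'.deg1] at hu
  rw [h'.deg2] at hv
  have hr := (h.good.rng huv).1
  refine ⟨hu ▸ h.min u hr.1 hr.2, fun hd => ?_⟩
  subst hd
  exact hv ▸ h.max u v hu huv

theorem Canon.degrees_eq {O O' : ℕ → ℕ → ℕ} {d0 d1 d0' d1' : ℕ} {l l' : List (ℕ × ℕ × ℕ)}
    {R R' : List (ℕ × ℕ × ℕ) → (ℕ → ℕ → ℕ) → Prop} (h : Canon O d0 d1 l R)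
    (h' : Canon O' d0' d1' l' R') (e : Eqv O O') : d0 = d0' ∧ d1 = d1' := by
  have h1 := h.degrees_le h' e
  have h2 := h'.degrees_le h e.symm
  have h3 := le_antisymm h1.1 h2.1
  exact ⟨h3, le_antisymm (h2.2 h3.symm) (h1.2 h3)⟩

/-! ### Partial tables and their extensions -/

/-- The table `O` extends the partial table `T`. -/
def Ext (T O : ℕ → ℕ → ℕ) : Prop := ∀ {a b}, T a b ≠ 0 → O a b = T a b

/-- Rotation invariant partial tables with labels at most `n`. -/
structure Part (T : ℕ → ℕ → ℕ) (n : ℕ) : Prop where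
  rng : ∀ {a b}, T a b ≠ 0 → (1 ≤ a ∧ a ≤ n) ∧ (1 ≤ b ∧ b ≤ n) ∧ T a b ≤ n
  rot : ∀ {a b}, T a b ≠ 0 → T b (T a b) = a

theorem Part.rot2 {T : ℕ → ℕ → ℕ} {n : ℕ} (h : Part T n) {a b : ℕ} (hab : T a b ≠ 0) :
    T (T a b) a = b := by
  have h1 := h.rot hab
  have h2 := h.rot (a := b) (b := T a b) (by rw [h1]; have := (h.rng hab).1; omega)
  rwa [h1] at h2

theorem Part.back {T : ℕ → ℕ → ℕ} {n : ℕ} (h : Part T n) {a b : ℕ} (hab : T a b ≠ 0) :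
    T (T a b) a ≠ 0 := by
  rw [h.rot2 hab]; have := (h.rng hab).2.1; omega

theorem Ext.iter {T O : ℕ → ℕ → ℕ} (h : Ext T O) {v x j : ℕ}
    (hj : ∀ i < j, (T v)^[i + 1] x ≠ 0) : ∀ i ≤ j, (O v)^[i] x = (T v)^[i] x := by
  intro i hi
  induction i with
  | zero => rfl
  | succ i ih =>
    have := hj i hi
    rw [Function.iterate_succ_apply'] at this
    rw [Function.iterate_succ_apply', Function.iterate_succ_apply', ih (by omega), h this]

theorem Pre.next_ne {O : ℕ → ℕ → ℕ} (h : Pre O) {a b : ℕ} (hab : O a b ≠ 0) : O a b ≠ b := by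
  intro e
  have h1 := h.rot hab
  rw [e] at h1
  have h2 := (h.rng hab).1
  exact (h.rng (a := b) (b := b) (by omega)).2.2.2 rfl

/-- The open and the closed outcome of a walk. -/
theorem walk_open_or_closed {α : Type} {t n v cur tgt e : ℕ} (hP : Part (tab t) n) (hn : n ≤ 10)
    (he : e = 0 ∧ tgt = cur ∨ e = 1 ∧ tab t v tgt = cur) (hcur : tab t cur v ≠ 0)
    {O : ℕ → ℕ → ℕ} (hO : Good O) (hTO : Ext (tab t) O) (opn cl : ℕ → α) :
    (∃ z, walk t v tgt opn cl 10 cur (e + 1) = opn z ∧ tab t v z = 0 ∧ tab t z v ≠ 0) ∨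
    ∃ m, walk t v tgt opn cl 10 cur (e + 1) = cl m ∧
      (∀ O, Good O → Ext (tab t) O → deg O v = m) ∧ ∀ w, tab t w v ≠ 0 → tab t v w ≠ 0 := by
  have hr := hP.rng hcur
  have htgt : ∀ {O}, Good O → Ext (tab t) O → O v tgt ≠ 0 ∧ (O v)^[e] tgt = cur := by
    intro O hO hTO
    have h1 : O cur v ≠ 0 := by rw [hTO hcur]; exact hcur
    rcases he with ⟨rfl, rfl⟩ | ⟨rfl, he⟩
    · exact ⟨hO.ne_iff.1 h1, rfl⟩
    · have h2 : O v tgt = cur := by rw [hTO (by omega), he]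
      exact ⟨by omega, h2⟩
  have hb : ∀ w, tab t v w ≤ 10 := fun w => by
    by_cases h : tab t v w = 0
    · omega
    · exact (hP.rng h).2.2.trans hn
  obtain ⟨j, hj, hlt, h⟩ := walk_tab tgt opn cl 10 (e + 1) (t := t) (v := v) (cur := cur)
    (by omega) hb (by omega)
  have hback : ∀ i, (∀ i' < i, (tab t v)^[i' + 1] cur ≠ 0) → tab t ((tab t v)^[i] cur) v ≠ 0 := by
    intro i hi
    cases i with
    | zero => exact hcur
    | succ i =>
      have := hi i (by omega)
      rw [Function.iterate_succ_apply'] at this ⊢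
      exact hP.back this
  rcases h with ⟨rfl, h⟩ | ⟨hj', h0, h⟩ | ⟨hj', h0, h1, h⟩
  · exfalso
    obtain ⟨h3, h4⟩ := htgt hO hTO
    obtain ⟨m, hm, hm', hmm⟩ := hO.exists_period h3
    have hit := hTO.iter (fun i hi => (hlt i hi).1)
    have hne : m ≠ e := by
      rintro rfl
      have := (hO.rng h3).2.1
      rcases he with ⟨he, _⟩ | ⟨he, _⟩
      · omega
      · subst he
        exact hO.next_ne h3 hmm
    obtain ⟨i, rfl⟩ : ∃ i, m = i + 1 + e := ⟨m - 1 - e, by omega⟩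
    rw [Function.iterate_add_apply, h4, hit _ (by omega)] at hmm
    exact (hlt i (by omega)).2 hmm
  · left
    refine ⟨_, h, ?_, hback j fun i hi => (hlt i hi).1⟩
    rwa [Function.iterate_succ_apply'] at h0
  · right
    have hnz : ∀ i < j + 1, (tab t v)^[i + 1] cur ≠ 0 := fun i hi => by
      rcases Nat.lt_succ_iff_lt_or_eq.1 hi with hi | rfl
      · exact (hlt i hi).1
      · exact h0
    have hper : ∀ {O}, Good O → Ext (tab t) O → (O v)^[e + 1 + j] tgt = tgt := by
      intro O hO hTO
      rw [show e + 1 + j = j + 1 + e by omega, Function.iterate_add_apply, (htgt hO hTO).2,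
        hTO.iter hnz _ le_rfl, h1]
    refine ⟨_, h, fun O hO hTO => ?_, fun w hw => ?_⟩
    · obtain ⟨h3, h4⟩ := htgt hO hTO
      refine le_antisymm (hO.deg_le h3 (by omega) (hper hO hTO)) (hO.le_deg h3 (hper hO hTO) ?_)
      intro i hi hi' hc
      by_cases hie : i = e
      · rcases he with ⟨he, _⟩ | ⟨he, _⟩
        · omega
        · subst he
          subst hie
          exact hO.next_ne h3 hc
      · obtain ⟨i, rfl⟩ : ∃ i', i = i' + 1 + e := ⟨i - 1 - e, by omega⟩
        rw [Function.iterate_add_apply, h4, hTO.iter hnz _ (by omega)] at hc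
        exact (hlt i (by omega)).2 hc
    · obtain ⟨h3, h4⟩ := htgt hO hTO
      have hw' : O v w ≠ 0 := hO.ne_iff.1 (by rw [hTO hw]; exact hw)
      obtain ⟨i, hi, hiw⟩ := hO.mem_iter h3 hw' (by omega) (hper hO hTO)
      by_cases hie : i < e
      · rcases he with ⟨he, _⟩ | ⟨he, he'⟩
        · omega
        · obtain rfl : i = 0 := by omega
          rw [← hiw, Function.iterate_zero_apply, he']
          omega
      · obtain ⟨i, rfl⟩ : ∃ i', i = i' + e := ⟨i - e, by omega⟩
        rw [Function.iterate_add_apply, h4, hTO.iter hnz _ (by omega)] at hiw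
        have := hnz i (by omega)
        rwa [Function.iterate_succ_apply', hiw] at this

/-- `T'` arises from `T` by filling in the triangle `(a, y, c)`. -/
structure Fill (T T' : ℕ → ℕ → ℕ) (a y c : ℕ) : Prop where
  ay : T a y = 0
  yc : T y c = 0
  ca : T c a = 0
  new : ∀ i j, T' i j = if i = a ∧ j = y then c else if i = y ∧ j = c then a else
    if i = c ∧ j = a then y else T i j

theorem fill_tab {t a y c : ℕ} (ha : 1 ≤ a ∧ a ≤ 10) (hy : 1 ≤ y ∧ y ≤ 10) (hc : 1 ≤ c ∧ c ≤ 10)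
    (hay : a ≠ y) (hyc : y ≠ c) (hca : c ≠ a) (h1 : tab t a y = 0) (h2 : tab t y c = 0)
    (h3 : tab t c a = 0) : Fill (tab t) (tab (put3 t a y c)) a y c := by
  refine ⟨h1, h2, h3, fun i j => ?_⟩
  rw [tab_eq ha.1 ha.2 hy.1 hy.2] at h1
  rw [tab_eq hy.1 hy.2 hc.1 hc.2] at h2
  rw [tab_eq hc.1 hc.2 ha.1 ha.2] at h3
  unfold tab
  by_cases hij : (1 ≤ i ∧ i ≤ 10) ∧ 1 ≤ j ∧ j ≤ 10
  · rw [if_pos hij, if_pos hij, look_put3 _ _ _ _ _ _ (by omega) (by omega) (by omega) (by omega)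
      (by omega) hay hyc hca h1 h2 h3]
  · rw [if_neg hij, if_neg hij, if_neg (by omega), if_neg (by omega), if_neg (by omega)]

theorem Fill.ext_iff {T T' O : ℕ → ℕ → ℕ} {a y c : ℕ} (h : Fill T T' a y c) (hO : Good O)
    (hc : c ≠ 0) : Ext T' O ↔ Ext T O ∧ O a y = c := by
  have h4 := h.new
  constructor
  · intro hE
    refine ⟨fun {i j} hij => ?_, ?_⟩
    · have h5 : T' i j = T i j := by
        rw [h4]
        have h1 := h.ay
        have h2 := h.yc
        have h3 := h.ca
        split_ifs with e1 e2 e3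
        · rw [e1.1, e1.2] at hij; contradiction
        · rw [e2.1, e2.2] at hij; contradiction
        · rw [e3.1, e3.2] at hij; contradiction
        · rfl
      rw [← h5]
      exact hE (by rwa [h5])
    · have : T' a y = c := by rw [h4]; simp
      rw [← this]
      exact hE (by rwa [this])
  · rintro ⟨hE, rfl⟩ i j hij
    rw [h4] at hij ⊢
    split_ifs at hij ⊢ with e1 e2 e3
    · rw [e1.1, e1.2]
    · rw [e2.1, e2.2]; exact hO.rot hc
    · rw [e3.1, e3.2]; exact hO.rot2 hc
    · exact hE hij

theorem Fill.part {T T' : ℕ → ℕ → ℕ} {a y c n : ℕ} (h : Fill T T' a y c) (hT : Part T n)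
    (ha : 1 ≤ a ∧ a ≤ n) (hy : 1 ≤ y ∧ y ≤ n) (hc : 1 ≤ c) (hay : a ≠ y) (hyc : y ≠ c)
    (hca : c ≠ a) : Part T' (max n c) := by
  have h4 := h.new
  refine ⟨fun {i j} hij => ?_, fun {i j} hij => ?_⟩
  · rw [h4] at hij ⊢
    split_ifs at hij ⊢ with e1 e2 e3
    · omega
    · omega
    · omega
    · have := hT.rng hij
      omega
  · by_cases h1 : T i j = 0
    · rw [h4] at hij
      rw [h4 i j]
      split_ifs at hij ⊢ with e1 e2 e3
      · rw [h4, e1.2, e1.1]; simp [hay.symm]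
      · rw [h4, e2.2, e2.1]; simp [hca, hyc.symm, hca.symm]
      · rw [h4, e3.2, e3.1]; simp
      · exact absurd h1 hij
    · have h5 : ∀ i j, T i j ≠ 0 → T' i j = T i j := by
        intro i j hij
        have h1 := h.ay
        have h2 := h.yc
        have h3 := h.ca
        rw [h4]
        split_ifs with e1 e2 e3
        · rw [e1.1, e1.2] at hij; contradiction
        · rw [e2.1, e2.2] at hij; contradiction
        · rw [e3.1, e3.2] at hij; contradiction
        · rfl
      rw [h5 i j h1]
      have h6 := hT.rot h1
      have h7 := hT.rng h1
      rw [h5 _ _ (by omega), h6]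

/-- The number of missing entries. -/
def zeros (T : ℕ → ℕ → ℕ) : ℕ :=
  ((Finset.Icc 1 10 ×ˢ Finset.Icc 1 10).filter fun p : ℕ × ℕ => T p.1 p.2 = 0).card

theorem Fill.zeros_lt {T T' : ℕ → ℕ → ℕ} {a y c : ℕ} (h : Fill T T' a y c)
    (ha : 1 ≤ a ∧ a ≤ 10) (hy : 1 ≤ y ∧ y ≤ 10) (hc : 1 ≤ c) : zeros T' < zeros T := by
  have h4 := h.new
  refine Finset.card_lt_card (Finset.ssubset_iff_of_subset ?_ |>.2 ⟨(a, y), ?_, ?_⟩)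
  · rintro ⟨i, j⟩ hij
    rw [Finset.mem_filter] at hij ⊢
    refine ⟨hij.1, ?_⟩
    have h1 := h.ay
    have h2 := h.yc
    have h3 := h.ca
    have h0 := hij.2
    simp only at h0 ⊢
    rw [h4] at h0
    split_ifs at h0 with e1 e2 e3
    · rwa [e1.1, e1.2]
    · rwa [e2.1, e2.2]
    · rwa [e3.1, e3.2]
    · exact h0
  · simp [h.ay, ha, hy]
  · simp [h4]; omega

/-! ### Bookkeeping of degrees -/

/-- A class of tori with distinguished first two vertices of degrees `d0` and `d1`. -/
structure Cls (C : (ℕ → ℕ → ℕ) → Prop) (d0 d1 : ℕ) : Prop where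
  good : ∀ {O}, C O → Good O
  deg1 : ∀ {O}, C O → deg O 1 = d0
  deg2 : ∀ {O}, C O → deg O 2 = d1
  o12 : ∀ {O}, C O → O 1 2 ≠ 0
  min : ∀ {O}, C O → ∀ v, 1 ≤ v → v ≤ 10 → d0 ≤ deg O v
  max : ∀ {O}, C O → ∀ u v, deg O u = d0 → O u v ≠ 0 → deg O v ≤ d1
  eqv : ∀ {O O'}, C O → Eqv O O' → deg O' 1 = d0 → deg O' 2 = d1 → O' 1 2 ≠ 0 → C O'

theorem Cls.le_nine {C : (ℕ → ℕ → ℕ) → Prop} {d0 d1 : ℕ} (hC : Cls C d0 d1) {O : ℕ → ℕ → ℕ}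
    (h : C O) : d0 ≤ 9 ∧ d1 ≤ 9 :=
  ⟨hC.deg1 h ▸ (hC.good h).deg_le_nine 1, hC.deg2 h ▸ (hC.good h).deg_le_nine 2⟩

theorem lb_eq (d0 d1 v : ℕ) : lb d0 d1 v = if v = 2 then d1 else d0 := by
  unfold lb
  rw [rec_eq_cond, beq_eq]
  by_cases h : v = 2 <;> simp [h]

theorem Cls.lb_le {C : (ℕ → ℕ → ℕ) → Prop} {d0 d1 : ℕ} (hC : Cls C d0 d1) {O : ℕ → ℕ → ℕ}
    (h : C O) {v : ℕ} (hv : 1 ≤ v ∧ v ≤ 10) : lb d0 d1 v ≤ deg O v := by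
  rw [lb_eq]
  split_ifs with h2
  · rw [h2, hC.deg2 h]
  · exact hC.min h v hv.1 hv.2

/-- The number of labels related to `v`. -/
noncomputable def rdeg (D : ℕ → ℕ → Prop) (v : ℕ) : ℕ := ((Finset.Icc 1 10).filter (D v)).card

theorem rdeg_le {D : ℕ → ℕ → Prop} {O : ℕ → ℕ → ℕ} (h : ∀ v w, D v w → O v w ≠ 0) (v : ℕ) :
    rdeg D v ≤ deg O v :=
  Finset.card_le_card fun w hw => by
    rw [Finset.mem_filter] at hw ⊢
    exact ⟨hw.1, h v w hw.2⟩

/-- The array `dv` and the sum `S` are correct for the adjacency relation `D`. -/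
structure Book (d0 d1 : ℕ) (D : ℕ → ℕ → Prop) (dv S : ℕ) : Prop where
  dv : ∀ v, 1 ≤ v → v ≤ 10 → nib dv v = rdeg D v
  S : S = ∑ v ∈ Finset.Icc 1 10, max (rdeg D v) (lb d0 d1 v)

theorem rdeg_insert {D : ℕ → ℕ → Prop} {x c : ℕ} (hc : 1 ≤ c ∧ c ≤ 10)
    (hxc : x ≠ c) (h : ¬D x c) :
    rdeg (fun v w => D v w ∨ v = x ∧ w = c ∨ v = c ∧ w = x) x = rdeg D x + 1 := by
  unfold rdeg
  rw [← Finset.card_insert_of_notMem (a := c) (by simp [h])]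
  congr 1
  ext w
  simp only [Finset.mem_filter, Finset.mem_insert, Finset.mem_Icc]
  constructor
  · rintro ⟨hw, hw' | hw' | hw'⟩
    · exact Or.inr ⟨hw, hw'⟩
    · exact Or.inl hw'.2
    · exact absurd hw'.1 hxc
  · rintro (rfl | ⟨hw, hw'⟩)
    · exact ⟨hc, Or.inr (Or.inl ⟨trivial, rfl⟩)⟩
    · exact ⟨hw, Or.inl hw'⟩

theorem rdeg_insert_ne {D : ℕ → ℕ → Prop} {x c v : ℕ} (hx : v ≠ x) (hc : v ≠ c) :
    rdeg (fun v w => D v w ∨ v = x ∧ w = c ∨ v = c ∧ w = x) v = rdeg D v := by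
  unfold rdeg
  congr 1
  ext w
  simp [hx, hc]

theorem addE_book {C : (ℕ → ℕ → ℕ) → Prop} {d0 d1 : ℕ} (hC : Cls C d0 d1) {O : ℕ → ℕ → ℕ}
    (hO : C O) {ub x c old dv S : ℕ} {D D' : ℕ → ℕ → Prop} (k : ℕ → ℕ → List ℕ)
    (hB : Book d0 d1 D dv S) (hx : 1 ≤ x ∧ x ≤ 10) (hc : 1 ≤ c ∧ c ≤ 10) (hxc : x ≠ c)
    (hsymm : ∀ v w, D v w → D w v) (hold : old = 0 ↔ ¬D x c)
    (hD' : ∀ v w, D' v w ↔ D v w ∨ v = x ∧ w = c ∨ v = c ∧ w = x)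
    (hDO : ∀ v w, D' v w → O v w ≠ 0)
    (hub : ∀ v, 1 ≤ v → v ≤ 10 → deg O v ≤ nib ub v) :
    ∃ dv' S', addE d0 d1 ub x c old dv S k = k dv' S' ∧ Book d0 d1 D' dv' S' := by
  obtain rfl : D' = fun v w => D v w ∨ v = x ∧ w = c ∨ v = c ∧ w = x := by
    ext v w; exact hD' v w
  rw [addE_eq]
  by_cases h : D x c
  · rw [beq_eq, decide_eq_false (by rwa [hold, not_not]), cond_false]
    refine ⟨dv, S, rfl, ?_⟩
    have : (fun v w => D v w ∨ v = x ∧ w = c ∨ v = c ∧ w = x) = D := by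
      ext v w
      constructor
      · rintro (h' | ⟨rfl, rfl⟩ | ⟨rfl, rfl⟩)
        exacts [h', h, hsymm _ _ h]
      · exact Or.inl
    rwa [this]
  · have hdx := rdeg_insert hc hxc h
    have hdc : rdeg (fun v w => D v w ∨ v = x ∧ w = c ∨ v = c ∧ w = x) c = rdeg D c + 1 := by
      have := rdeg_insert hx hxc.symm (D := D) (x := c) (c := x) fun h' => h (hsymm _ _ h')
      rw [← this]
      congr 1
      ext v w
      tauto
    have hle := rdeg_le hDO
    have hx1 := hle x
    have hc1 := hle c
    rw [hdx] at hx1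
    rw [hdc] at hc1
    have hux := hub x hx.1 hx.2
    have huc := hub c hc.1 hc.2
    have h9x := (hC.good hO).deg_le_nine x
    have h9c := (hC.good hO).deg_le_nine c
    have hnx := hB.dv x hx.1 hx.2
    have hnc := hB.dv c hc.1 hc.2
    have hS : S + (cond (Nat.ble (lb d0 d1 x) (nib dv x)) 1 0 +
        cond (Nat.ble (lb d0 d1 c) (nib dv c)) 1 0) = ∑ v ∈ Finset.Icc 1 10,
        max (rdeg (fun v w => D v w ∨ v = x ∧ w = c ∨ v = c ∧ w = x) v) (lb d0 d1 v) := by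
      have hx2 : x ∈ Finset.Icc 1 10 := Finset.mem_Icc.2 hx
      have hc2 : c ∈ (Finset.Icc 1 10).erase x :=
        Finset.mem_erase.2 ⟨hxc.symm, Finset.mem_Icc.2 hc⟩
      rw [hB.S, ← Finset.add_sum_erase _ _ hx2, ← Finset.add_sum_erase _ _ hc2,
        ← Finset.add_sum_erase _ _ hx2, ← Finset.add_sum_erase _ _ hc2, hdx, hdc]
      have hrest : ∑ v ∈ ((Finset.Icc 1 10).erase x).erase c,
          max (rdeg (fun v w => D v w ∨ v = x ∧ w = c ∨ v = c ∧ w = x) v) (lb d0 d1 v) =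
          ∑ v ∈ ((Finset.Icc 1 10).erase x).erase c, max (rdeg D v) (lb d0 d1 v) := by
        refine Finset.sum_congr rfl fun v hv => ?_
        rw [Finset.mem_erase, Finset.mem_erase] at hv
        rw [rdeg_insert_ne hv.2.1 hv.1]
      rw [hrest, ble_eq, ble_eq, hnx, hnc]
      by_cases h1 : lb d0 d1 x ≤ rdeg D x <;> by_cases h2 : lb d0 d1 c ≤ rdeg D c <;>
      simp only [h1, h2, decide_true, decide_false, cond_true, cond_false] <;> omega
    rw [beq_eq, decide_eq_true (hold.2 h), cond_true, ble_eq, decide_eq_false (by omega),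
      cond_false, ble_eq, decide_eq_false (by omega), cond_false, ble_eq, decide_eq_true, cond_true]
    · refine ⟨_, _, rfl, fun v hv hv' => ?_, hS⟩
      rw [nib_setn _ _ _ _ (by omega)]
      split_ifs with h1
      · rw [h1, hdc, hnc]
      · rw [nib_setn _ _ _ _ (by omega)]
        split_ifs with h2
        · rw [h2, hdx, hnx]
        · rw [rdeg_insert_ne h2 h1, hB.dv v hv hv']
    · rw [hS, ← (hC.good hO).tot]
      exact Finset.sum_le_sum fun v hv =>
        max_le (hle v) (hC.lb_le hO (Finset.mem_Icc.1 hv))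

theorem nib_capNbrs {t v d1 : ℕ} (hd : d1 < 16) (n ub w : ℕ) :
    nib (capNbrs t v d1 n ub) w =
      if (1 ≤ w ∧ w ≤ n) ∧ look t v w ≠ 0 then min (nib ub w) d1 else nib ub w := by
  induction n generalizing ub with
  | zero => rw [if_neg (by omega)]; rfl
  | succ n ih =>
    have : capNbrs t v d1 (n + 1) ub =
      sel(Nat.beq (look t v (Nat.succ n)) 0; capNbrs t v d1 n ub;
        sel(Nat.ble (nib ub (Nat.succ n)) d1; capNbrs t v d1 n ub;
          force (setn ub (Nat.succ n) d1) fun ub => capNbrs t v d1 n ub)) := rfl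
    rw [this]
    simp only [rec_eq_cond, force_eq, Nat.succ_eq_add_one, beq_eq, ble_eq, Bool.cond_decide]
    by_cases hw : w = n + 1
    · subst hw
      have hn : ¬((1 ≤ n + 1 ∧ n + 1 ≤ n) ∧ look t v (n + 1) ≠ 0) := by omega
      by_cases h1 : look t v (n + 1) = 0
      · rw [if_pos h1, ih, if_neg hn, if_neg (by simp [h1])]
      · rw [if_neg h1, if_pos (c := _ ∧ _) ⟨by omega, h1⟩]
        by_cases h2 : nib ub (n + 1) ≤ d1
        · rw [if_pos h2, ih, if_neg hn, min_eq_left h2]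
        · rw [if_neg h2, ih, if_neg hn, nib_setn _ _ _ _ hd, if_pos rfl]
          omega
    · have hn : ((1 ≤ w ∧ w ≤ n + 1) ∧ look t v w ≠ 0) ↔ ((1 ≤ w ∧ w ≤ n) ∧ look t v w ≠ 0) := by
        constructor <;> rintro ⟨h, h'⟩ <;> exact ⟨by omega, h'⟩
      simp only [hn]
      split_ifs <;> simp_all [nib_setn _ _ _ _ hd]

/-- The array `ub` bounds the degrees in all extensions of `T`. -/
def Ubd (C : (ℕ → ℕ → ℕ) → Prop) (T : ℕ → ℕ → ℕ) (ub : ℕ) : Prop :=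
  ∀ O, C O → Ext T O → ∀ v, 1 ≤ v → v ≤ 10 → deg O v ≤ nib ub v

theorem closed_ubd {C : (ℕ → ℕ → ℕ) → Prop} {d0 d1 : ℕ} (hC : Cls C d0 d1)
    {t dv ub v m : ℕ} (hv : 1 ≤ v ∧ v ≤ 10)
    (hex : ∃ O, C O ∧ Ext (tab t) O)
    (hm : ∀ O, Good O → Ext (tab t) O → deg O v = m)
    (hub : Ubd C (tab t) ub)
    (hdv : ∀ O, C O → Ext (tab t) O → ∀ x, 1 ≤ x → x ≤ 10 → nib dv x ≤ deg O x)
    (cont : ℕ → List ℕ) :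
    ∃ ub', closed t dv ub d0 d1 v m cont = cont ub' ∧ Ubd C (tab t) ub' := by
  obtain ⟨O, hO, hTO⟩ := hex
  have hdeg := hm O (hC.good hO) hTO
  have h9 := (hC.good hO).deg_le_nine v
  have h1 : nib dv v ≤ m := by rw [← hdeg]; exact hdv O hO hTO v hv.1 hv.2
  have h2 : lb d0 d1 v ≤ m := by rw [← hdeg]; exact hC.lb_le hO hv
  have h3 := hC.le_nine hO
  rw [closed_eq, ble_eq, decide_eq_true h1, cond_true, ble_eq, decide_eq_true h2, cond_true,
    beq_eq]
  by_cases h4 : m = d0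
  · have hu : Ubd C (tab t) (setn (capNbrs t v d1 10 ub) v m) := by
      intro O hO hTO w hw hw'
      rw [nib_setn _ _ _ _ (by omega)]
      split_ifs with h
      · rw [h, hm O (hC.good hO) hTO]
      · rw [nib_capNbrs (by omega)]
        split_ifs with hl
        · refine le_min (hub O hO hTO w hw hw') ?_
          have hl' : tab t v w ≠ 0 := by rw [tab_eq hv.1 hv.2 hw hw']; exact hl.2
          exact hC.max hO v w ((hm O (hC.good hO) hTO).trans h4) (by rw [hTO hl']; exact hl')
        · exact hub O hO hTO w hw hw'
    rw [decide_eq_true h4, cond_true, (all_iff _ 10).2, cond_true]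
    · exact ⟨_, rfl, hu⟩
    · intro x hx hx'
      rw [ble_eq]
      exact decide_eq_true ((hdv O hO hTO x hx hx').trans (hu O hO hTO x hx hx'))
  · rw [decide_eq_false h4, cond_false]
    refine ⟨_, rfl, fun O hO hTO w hw hw' => ?_⟩
    rw [nib_setn _ _ _ _ (by omega)]
    split_ifs with h
    · rw [h, hm O (hC.good hO) hTO]
    · exact hub O hO hTO w hw hw'

theorem chk_ubd {C : (ℕ → ℕ → ℕ) → Prop} {d0 d1 : ℕ} (hC : Cls C d0 d1)
    {t dv ub n v tgt cur : ℕ} (hP : Part (tab t) n) (hn : n ≤ 10)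
    (h : tab t v tgt = cur) (hcur : cur ≠ 0)
    (hex : ∃ O, C O ∧ Ext (tab t) O) (hub : Ubd C (tab t) ub)
    (hdv : ∀ O, C O → Ext (tab t) O → ∀ x, 1 ≤ x → x ≤ 10 → nib dv x ≤ deg O x)
    (cont : ℕ → List ℕ) :
    ∃ ub', chk t dv ub d0 d1 v tgt cur cont = cont ub' ∧ Ubd C (tab t) ub' := by
  obtain ⟨O, hO, hTO⟩ := hex
  have h1 : tab t v tgt ≠ 0 := by omega
  have h2 := hP.back h1
  rw [h] at h2
  have h3 := hP.rng h1
  rcases walk_open_or_closed hP hn (Or.inr ⟨rfl, h⟩) h2 (hC.good hO) hTO (fun _ => cont ub)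
    (fun k => closed t dv ub d0 d1 v k cont) with ⟨z, hz, _⟩ | ⟨m, hm, hm', _⟩
  · exact ⟨ub, hz, hub⟩
  · obtain ⟨ub', h4, h5⟩ := closed_ubd hC (v := v) (by omega) ⟨O, hO, hTO⟩ hm' hub hdv cont
    exact ⟨ub', hm.trans h4, h5⟩

/-! ### The search finds a canonical torus in every class -/

/-- The invariant of the search. -/
structure Inv (C : (ℕ → ℕ → ℕ) → Prop) (d0 d1 t dv ub S n : ℕ) (l : Path) : Prop where
  part : Part (tab t) n
  three_le : 3 ≤ n
  le_ten : n ≤ 10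
  ex : ∃ O, C O ∧ Ext (tab t) O
  opt : ∀ O, C O → LEs l.toList.reverse O
  agr : ∀ O, C O → (∀ e ∈ l.toList.reverse, O e.1 e.2.1 = e.2.2) → Ext (tab t) O
  ent : ∀ e ∈ l.toList.reverse, tab t e.1 e.2.1 = e.2.2
  wf : Wf 2 l.toList.reverse n
  t12 : tab t 1 2 = 3
  nbr : ∀ v, 1 ≤ v → v ≤ n → ∃ w, tab t v w ≠ 0
  book : Book d0 d1 (fun v w => tab t v w ≠ 0 ∨ tab t w v ≠ 0) dv S
  ubd : Ubd C (tab t) ub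

/-- There is no open dart at `v`. -/
def Done (T : ℕ → ℕ → ℕ) (v : ℕ) : Prop := ∀ w, T w v ≠ 0 → T v w ≠ 0

theorem Ext.eq_of_done {T O : ℕ → ℕ → ℕ} {n v : ℕ} (h : Ext T O) (hO : Good O) (hT : Part T n)
    (hv : Done T v) (hnb : ∃ x, T v x ≠ 0) (w : ℕ) : O v w = T v w := by
  by_cases hw : T v w = 0
  · by_contra hne
    obtain ⟨x, hx⟩ := hnb
    have hit : ∀ i, (O v)^[i] x = (T v)^[i] x ∧ T v ((T v)^[i] x) ≠ 0 := by
      intro i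
      induction i with
      | zero => exact ⟨rfl, hx⟩
      | succ i ih =>
        rw [Function.iterate_succ_apply', Function.iterate_succ_apply', ih.1, h ih.2]
        exact ⟨rfl, hv _ (hT.back ih.2)⟩
    obtain ⟨k, hk⟩ := hO.link (v := v) (w := x) (w' := w) (by rw [h hx]; exact hx)
      (by rwa [← hw])
    rw [(hit k).1] at hk
    exact (hit k).2 (hk ▸ hw)
  · exact h hw

theorem Inv.leaf {C : (ℕ → ℕ → ℕ) → Prop} {d0 d1 t dv ub S n : ℕ} {l : Path}
    (h : Inv C d0 d1 t dv ub S n l) (hC : Cls C d0 d1)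
    (hd : ∀ v, 1 ≤ v → v ≤ n → Done (tab t) v) :
    accept t d0 d1 (l.rev .nil) = true ∧ C (tab t) := by
  obtain ⟨O, hO, hTO⟩ := h.ex
  have hgood := hC.good hO
  have heq : ∀ v, 1 ≤ v → v ≤ n → ∀ w, O v w = tab t v w := fun v hv hv' w =>
    hTO.eq_of_done hgood h.part (hd v hv hv') (h.nbr v hv hv') w
  have h3 := h.three_le
  have hn : n = 10 := by
    have hle := h.le_ten
    have key : ∀ y, Relation.ReflTransGen (fun x y => O x y ≠ 0) 1 y → 1 ≤ y ∧ y ≤ n := by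
      intro y hy
      induction hy with
      | refl => omega
      | tail _ hyz ih =>
        rw [heq _ ih.1 ih.2] at hyz
        exact (h.part.rng hyz).2.1
    have := (key 10 (hgood.conn (by omega) (by omega) (by omega) (by omega))).2
    omega
  subst hn
  have hOt : O = tab t := by
    ext v w
    by_cases hv : 1 ≤ v ∧ v ≤ 10
    · exact heq v hv.1 hv.2 w
    · have h1 : O v w = 0 := by
        by_contra h0; exact hv (hgood.rng h0).1
      have h2 : tab t v w = 0 := by
        by_contra h0; exact hv (tab_rng h0).1
      rw [h1, h2]
  subst hOt
  refine ⟨accept_complete ?_, hO⟩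
  rw [Path.toList_rev, Path.toList, List.append_nil]
  exact ⟨hgood, hC.deg1 hO, hC.deg2 hO, h.t12, h.wf, h.ent, hC.min hO, hC.max hO,
    fun O' h1 h2 h3 h4 => h.opt O' (hC.eqv hO h1 h2 h3 h4)⟩

theorem nextv_mem {C : (ℕ → ℕ → ℕ) → Prop} {d0 d1 t dv ub S n : ℕ} {l : Path}
    (h : Inv C d0 d1 t dv ub S n l) (hC : Cls C d0 d1) (k : ℕ → ℕ → List ℕ)
    (hk : ∀ v z, 1 ≤ v → v ≤ n → tab t v z = 0 → tab t z v ≠ 0 →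
      (∀ w, 1 ≤ w → w < v → Done (tab t) w) → ∃ x ∈ k v z, C (tab x)) :
    ∀ fuel a, 1 ≤ a → a ≤ n + 1 → 12 ≤ fuel + a →
      (∀ w, 1 ≤ w → w < a → Done (tab t) w) →
      ∃ x ∈ nextv t d0 d1 n l k fuel a, C (tab x) := by
  have hn := h.le_ten
  intro fuel
  induction fuel with
  | zero => intro a _ ha hf; omega
  | succ fuel ih =>
    intro a ha han hf hd
    rw [nextv_succ, ble_eq]
    by_cases hle : a ≤ n
    · rw [decide_eq_true hle, cond_true]
      obtain ⟨w, hw⟩ := h.nbr a ha hle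
      obtain ⟨_, hx⟩ := find_spec ha (hle.trans hn) ⟨_, h.part.back hw⟩
      obtain ⟨O, hO, hTO⟩ := h.ex
      rcases walk_open_or_closed h.part hn (Or.inl ⟨rfl, rfl⟩) hx (hC.good hO) hTO
        (fun y => k a y) (fun _ => nextv t d0 d1 n l k fuel (a + 1))
        with ⟨z, hz, hz1, hz2⟩ | ⟨m, hm, _, hm'⟩
      · rw [Nat.zero_add] at hz
        rw [hz]
        exact hk a z ha hle hz1 hz2 hd
      · rw [Nat.zero_add] at hm
        rw [hm]
        refine ih (a + 1) (by omega) (by omega) (by omega) fun w hw hw' => ?_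
        rcases Nat.lt_succ_iff_lt_or_eq.1 hw' with hw' | rfl
        · exact hd w hw hw'
        · exact hm'
    · rw [decide_eq_false hle, cond_false]
      obtain ⟨h1, h2⟩ := h.leaf hC fun v hv hv' => hd v hv (by omega)
      rw [h1, cond_true]
      exact ⟨t, List.mem_singleton_self t, h2⟩

theorem mem_children {d0 d1 fuel t dv ub S n a y c x : ℕ} {l : Path} {m : ℕ} (hc : 1 ≤ c)
    (hcm : c ≤ m) (hx : x ∈ child d0 d1 t dv ub S n a y c l (search d0 d1 fuel)) :
    x ∈ children d0 d1 fuel t dv ub S n a y l m := by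
  induction m with
  | zero => omega
  | succ m ih =>
    rw [children, List.mem_append]
    rcases Nat.lt_succ_iff_lt_or_eq.1 (Nat.lt_succ_of_le hcm) with h | rfl
    · exact Or.inl (ih (by omega))
    · exact Or.inr hx

/-- The third vertex for which the code can be minimal. -/
theorem Inv.exists_third {C : (ℕ → ℕ → ℕ) → Prop} {d0 d1 t dv ub S n a y : ℕ} {l : Path}
    (h : Inv C d0 d1 t dv ub S n l) (hC : Cls C d0 d1) (hya : tab t y a ≠ 0) :
    ∃ c, c ≤ n + 1 ∧ (∃ O, C O ∧ Ext (tab t) O ∧ O a y = c) ∧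
      ∀ O, C O → Ext (tab t) O → c ≤ O a y := by
  have hex : ∃ c, ∃ O, C O ∧ Ext (tab t) O ∧ O a y = c := by
    obtain ⟨O, h1, h2⟩ := h.ex
    exact ⟨_, O, h1, h2, rfl⟩
  refine ⟨Nat.find hex, ?_, Nat.find_spec hex, fun O h1 h2 => Nat.find_min' hex ⟨O, h1, h2, rfl⟩⟩
  obtain ⟨O, h1, h2, h3⟩ := Nat.find_spec hex
  by_contra hlt
  have hgood := hC.good h1
  have h4 := hgood.next (a := y) (b := a) (by rw [h2 hya]; exact hya)
  have h5 : O a y ≠ 0 := by omega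
  have h6 := (hgood.rng h5).2.2.1
  have h7 := h.three_le
  have hfx : Fx (Equiv.swap (O a y) (n + 1)) := Fx.swap (by omega) (by omega)
  have hfix : ∀ z, z ≤ n → Equiv.swap (O a y) (n + 1) z = z := fun z hz =>
    Equiv.swap_apply_of_ne_of_ne (by omega) (by omega)
  have hsame : ∀ i j, i ≤ n → j ≤ n → relabel (Equiv.swap (O a y) (n + 1)) O i j =
      Equiv.swap (O a y) (n + 1) (O i j) := by
    intro i j hi hj
    conv_lhs => rw [← hfix i hi, ← hfix j hj]
    exact relabel_apply _ _ _ _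
  have hd : ∀ i, i ≤ n → deg (relabel (Equiv.swap (O a y) (n + 1)) O) i = deg O i := by
    intro i hi
    conv_lhs => rw [← hfix i hi]
    exact deg_relabel hfx O i
  have hmem : C (relabel (Equiv.swap (O a y) (n + 1)) O) := by
    refine hC.eqv h1 ((Eqv.refl O).relabel hfx) ?_ ?_ ?_
    · rw [hd 1 (by omega), hC.deg1 h1]
    · rw [hd 2 (by omega), hC.deg2 h1]
    · rw [hsame 1 2 (by omega) (by omega)]
      exact fun e => hC.o12 h1 (hfx.eq_zero.1 e)
  have hr := h.part.rng hya
  have hmin := Nat.find_min' hex ⟨_, hmem, fun {i j} hij => by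
    have := h.part.rng hij
    rw [hsame i j (by omega) (by omega), h2 hij, hfix _ (by omega)], rfl⟩
  rw [hsame a y (by omega) (by omega), Equiv.swap_apply_left] at hmin
  omega

theorem Fill.adj_iff {T T' : ℕ → ℕ → ℕ} {a y c : ℕ} (h : Fill T T' a y c) (hya : T y a ≠ 0)
    (ha : a ≠ 0) (hy : y ≠ 0) (hc : c ≠ 0) (hay : a ≠ y) (hyc : y ≠ c) (hca : c ≠ a) (v w : ℕ) :
    (T' v w ≠ 0 ∨ T' w v ≠ 0) ↔ ((T v w ≠ 0 ∨ T w v ≠ 0) ∨ v = y ∧ w = c ∨ v = c ∧ w = y) ∨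
      v = c ∧ w = a ∨ v = a ∧ w = c := by
  have key : ∀ v w, T' v w ≠ 0 ↔ v = a ∧ w = y ∨ v = y ∧ w = c ∨ v = c ∧ w = a ∨ T v w ≠ 0 := by
    intro v w
    rw [h.new]
    split_ifs <;> tauto
  rw [key, key]
  constructor
  · rintro ((⟨rfl, rfl⟩ | h | h | h) | ⟨rfl, rfl⟩ | h | h | h) <;> tauto
  · tauto

set_option maxHeartbeats 1000000 in
theorem Inv.child_mem {C : (ℕ → ℕ → ℕ) → Prop} {d0 d1 fuel t dv ub S n a y : ℕ} {l : Path}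
    (h : Inv C d0 d1 t dv ub S n l) (hC : Cls C d0 d1) (ha : 1 ≤ a ∧ a ≤ n)
    (hay : tab t a y = 0) (hya : tab t y a ≠ 0)
    (hd : ∀ w, 1 ≤ w → w < a → Done (tab t) w) (hf : zeros (tab t) < fuel + 1)
    (ih : ∀ t dv ub S n a y l, Inv C d0 d1 t dv ub S n l → 1 ≤ a ∧ a ≤ n → tab t a y = 0 →
      tab t y a ≠ 0 → (∀ w, 1 ≤ w → w < a → Done (tab t) w) → zeros (tab t) < fuel →
      ∃ x ∈ search d0 d1 fuel t dv ub S n a y l, C (tab x)) :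
    ∃ c, 1 ≤ c ∧ c ≤ 10 ∧ c ≤ n + 1 ∧
      ∃ x ∈ child d0 d1 t dv ub S n a y c l (search d0 d1 fuel), C (tab x) := by
  obtain ⟨c, hcn, ⟨O, hO, hTO, hOc⟩, hmin⟩ := h.exists_third hC hya
  have hgood := hC.good hO
  have hn := h.le_ten
  have hr := h.part.rng hya
  have hc0 : O a y ≠ 0 := hgood.ne_iff.1 (by rw [hTO hya]; exact hya)
  have hOr := hgood.rng hc0
  have hyc : O y c = a := by rw [← hOc]; exact hgood.rot hc0
  have hca : O c a = y := by rw [← hOc]; exact hgood.rot2 hc0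
  have nyc : y ≠ c := (hgood.rng (a := y) (b := c) (by omega)).2.2.2
  have nca : c ≠ a := (hgood.rng (a := c) (b := a) (by omega)).2.2.2
  have nay : a ≠ y := hOr.2.2.2
  have tca : tab t c a = 0 := by
    by_contra h0
    have h1 := h.part.rot2 h0
    have h2 := h.part.rot h0
    rw [← hTO h0, hca, hay] at h2
    omega
  have tyc : tab t y c = 0 := by
    by_contra h0
    have h1 := h.part.rot2 h0
    rw [← hTO h0, hyc, hay] at h1
    omega
  have hc1 : 1 ≤ c := by omega
  have hc10 : c ≤ 10 := by omega
  refine ⟨c, hc1, hc10, hcn, ?_⟩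
  have hfill := fill_tab (t := t) (by omega) (by omega) ⟨hc1, hc10⟩ nay nyc nca hay tyc tca
  have hpart := hfill.part h.part ha hr.1 hc1 nay nyc nca
  have hext : ∀ {O}, C O → (Ext (tab (put3 t a y c)) O ↔ Ext (tab t) O ∧ O a y = c) :=
    fun hO => hfill.ext_iff (hC.good hO) (by omega)
  have hTO' : Ext (tab (put3 t a y c)) O := (hext hO).2 ⟨hTO, hOc⟩
  have hnew := hfill.new
  have hubO := h.ubd O hO hTO
  have hadj : ∀ v w, tab t v w ≠ 0 ∨ tab t w v ≠ 0 → O v w ≠ 0 := by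
    rintro v w (h1 | h1)
    · rw [hTO h1]; exact h1
    · exact hgood.ne_iff.1 (by rw [hTO h1]; exact h1)
  rw [child_eq, beq_eq, decide_eq_true (by rwa [← tab_eq (by omega) (by omega) hc1 hc10]),
    cond_true, beq_eq, decide_eq_true (by rwa [← tab_eq hc1 hc10 (by omega) (by omega)]), cond_true]
  obtain ⟨dv1, S1, e1, hB1⟩ := addE_book hC hO (ub := ub) (x := y) (c := c) (old := look t c y)
    (D' := fun v w => (tab t v w ≠ 0 ∨ tab t w v ≠ 0) ∨ v = y ∧ w = c ∨ v = c ∧ w = y)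
    (fun dv S => addE d0 d1 ub c a (look t a c) dv S fun dv S =>
          chk (put3 t a y c) dv ub d0 d1 y c a fun ub =>
          chk (put3 t a y c) dv ub d0 d1 c a y fun ub =>
          walk (put3 t a y c) a y
            (fun z => search d0 d1 fuel (put3 t a y c) dv ub S (cond (Nat.ble c n) n c) a z
              (.cons a y c l))
            (fun k => closed (put3 t a y c) dv ub d0 d1 a k fun ub =>
              nextv (put3 t a y c) d0 d1 (cond (Nat.ble c n) n c) (.cons a y c l)
                (fun v z => search d0 d1 fuel (put3 t a y c) dv ub S (cond (Nat.ble c n) n c) v z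
                  (.cons a y c l)) 11 (a + 1)) 10 c 2)
    h.book (by omega) ⟨hc1, hc10⟩ nyc (fun _ _ => Or.symm)
    (by rw [← tab_eq hc1 hc10 (by omega) (by omega)]; simp [tyc]) (fun _ _ => Iff.rfl)
    (by
      rintro v w (h1 | ⟨rfl, rfl⟩ | ⟨rfl, rfl⟩)
      · exact hadj v w h1
      · omega
      · exact hgood.ne_iff.1 (by omega))
    hubO
  rw [e1]
  obtain ⟨dv2, S2, e2, hB2⟩ := addE_book hC hO (ub := ub) (x := c) (c := a) (old := look t a c)
    (D' := fun v w => tab (put3 t a y c) v w ≠ 0 ∨ tab (put3 t a y c) w v ≠ 0)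
    (fun dv S =>
          chk (put3 t a y c) dv ub d0 d1 y c a fun ub =>
          chk (put3 t a y c) dv ub d0 d1 c a y fun ub =>
          walk (put3 t a y c) a y
            (fun z => search d0 d1 fuel (put3 t a y c) dv ub S (cond (Nat.ble c n) n c) a z
              (.cons a y c l))
            (fun k => closed (put3 t a y c) dv ub d0 d1 a k fun ub =>
              nextv (put3 t a y c) d0 d1 (cond (Nat.ble c n) n c) (.cons a y c l)
                (fun v z => search d0 d1 fuel (put3 t a y c) dv ub S (cond (Nat.ble c n) n c) v z
                  (.cons a y c l)) 11 (a + 1)) 10 c 2)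
    hB1 ⟨hc1, hc10⟩ (by omega) nca
    (by
      rintro v w (h1 | ⟨rfl, rfl⟩ | ⟨rfl, rfl⟩)
      · exact Or.inl h1.symm
      · exact Or.inr (Or.inr ⟨rfl, rfl⟩)
      · exact Or.inr (Or.inl ⟨rfl, rfl⟩))
    (by rw [← tab_eq (by omega) (by omega) hc1 hc10]; simp [tca]; omega)
    (hfill.adj_iff hya (by omega) (by omega) (by omega) nay nyc nca)
    (by
      rintro v w (h1 | h1)
      · rw [hTO' h1]; exact h1
      · exact hgood.ne_iff.1 (by rw [hTO' h1]; exact h1))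
    hubO
  rw [e2]
  have hub0 : Ubd C (tab (put3 t a y c)) ub := fun O hO hE => h.ubd O hO ((hext hO).1 hE).1
  have hdv : ∀ O, C O → Ext (tab (put3 t a y c)) O → ∀ x, 1 ≤ x → x ≤ 10 →
      nib dv2 x ≤ deg O x := by
    intro O hO hE x hx hx'
    rw [hB2.dv x hx hx']
    refine rdeg_le ?_ x
    rintro v w (h1 | h1)
    · rw [hE h1]; exact h1
    · exact (hC.good hO).ne_iff.1 (by rw [hE h1]; exact h1)
  have hle' : max n c ≤ 10 := by omega
  have nay' : tab (put3 t a y c) a y = c := by rw [hnew]; simp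
  have nyc' : tab (put3 t a y c) y c = a := by rw [hnew]; simp [nay.symm]
  have nca' : tab (put3 t a y c) c a = y := by rw [hnew]; simp [nca, nyc.symm]
  obtain ⟨ub1, e3, hub1⟩ := chk_ubd (dv := dv2) hC hpart hle' nyc' (by omega) ⟨O, hO, hTO'⟩ hub0
    hdv fun ub =>
          chk (put3 t a y c) dv2 ub d0 d1 c a y fun ub =>
          walk (put3 t a y c) a y
            (fun z => search d0 d1 fuel (put3 t a y c) dv2 ub S2 (cond (Nat.ble c n) n c) a z
              (.cons a y c l))
            (fun k => closed (put3 t a y c) dv2 ub d0 d1 a k fun ub =>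
              nextv (put3 t a y c) d0 d1 (cond (Nat.ble c n) n c) (.cons a y c l)
                (fun v z => search d0 d1 fuel (put3 t a y c) dv2 ub S2 (cond (Nat.ble c n) n c) v z
                  (.cons a y c l)) 11 (a + 1)) 10 c 2
  rw [e3]
  obtain ⟨ub2, e4, hub2⟩ := chk_ubd (dv := dv2) hC hpart hle' nca' (by omega) ⟨O, hO, hTO'⟩ hub1
    hdv fun ub =>
          walk (put3 t a y c) a y
            (fun z => search d0 d1 fuel (put3 t a y c) dv2 ub S2 (cond (Nat.ble c n) n c) a z
              (.cons a y c l))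
            (fun k => closed (put3 t a y c) dv2 ub d0 d1 a k fun ub =>
              nextv (put3 t a y c) d0 d1 (cond (Nat.ble c n) n c) (.cons a y c l)
                (fun v z => search d0 d1 fuel (put3 t a y c) dv2 ub S2 (cond (Nat.ble c n) n c) v z
                  (.cons a y c l)) 11 (a + 1)) 10 c 2
  rw [e4]
  have hmaxn : cond (Nat.ble c n) n c = max n c := by
    rw [ble_eq, Bool.cond_decide]
    split_ifs <;> omega
  rw [hmaxn]
  have hold : ∀ {i j}, tab t i j ≠ 0 → tab (put3 t a y c) i j = tab t i j := by
    intro i j hij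
    rw [← hTO hij, hTO' ?_]
    rw [hnew]
    split_ifs <;> omega
  have hinv : ∀ ub, Ubd C (tab (put3 t a y c)) ub →
      Inv C d0 d1 (put3 t a y c) dv2 ub S2 (max n c) (.cons a y c l) := by
    intro ub hub
    have h3 := h.three_le
    have hlist : (Path.cons a y c l).toList.reverse = l.toList.reverse ++ [(a, y, c)] := by
      rw [Path.toList, List.reverse_cons]
    refine ⟨hpart, by omega, hle', ⟨O, hO, hTO'⟩, ?_, ?_, ?_, ?_, ?_, ?_, hB2, hub⟩
    · intro O hO
      rw [hlist]
      refine les_append (h.opt O hO) fun hag => ?_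
      have := hmin O hO (h.agr O hO hag)
      rcases this.lt_or_eq with h1 | h1
      · exact Or.inl h1
      · exact Or.inr ⟨h1.symm, trivial⟩
    · intro O hO hag
      rw [hlist] at hag
      exact (hext hO).2 ⟨h.agr O hO fun e he => hag e (List.mem_append_left _ he),
        hag (a, y, c) (by simp)⟩
    · intro e he
      rw [hlist, List.mem_append, List.mem_singleton] at he
      rcases he with he | rfl
      · have h4 := h.ent e he
        have h5 := (h.wf.mem he).2.2.1
        rw [hold (by omega), h4]
      · exact nay'
    · rw [hlist, wf_append]
      exact ⟨n, h.wf, ha, hr.1, ⟨hc1, hcn⟩, rfl⟩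
    · rw [hold (by rw [h.t12]; omega), h.t12]
    · intro v hv hv'
      by_cases hvn : v ≤ n
      · obtain ⟨w, hw⟩ := h.nbr v hv hvn
        exact ⟨w, by rwa [hold hw]⟩
      · obtain rfl : v = c := by omega
        exact ⟨a, by omega⟩
  have hz := hfill.zeros_lt (by omega) (by omega) hc1
  have hdone : ∀ w, 1 ≤ w → w < a → Done (tab (put3 t a y c)) w := by
    intro w hw hwa z hz
    by_cases h0 : tab t w z = 0
    · have h1 : O w z = tab t w z := hTO.eq_of_done hgood h.part (hd w hw hwa)
        (h.nbr w hw (by omega)) z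
      have h2 := hgood.ne_iff.1 (show O z w ≠ 0 by rw [hTO' hz]; exact hz)
      omega
    · rw [hold h0]; exact h0
  rcases walk_open_or_closed hpart hle' (Or.inr ⟨rfl, nay'⟩) (by omega) hgood hTO'
    (fun z => search d0 d1 fuel (put3 t a y c) dv2 ub2 S2 (max n c) a z (.cons a y c l))
    (fun k => closed (put3 t a y c) dv2 ub2 d0 d1 a k fun ub =>
      nextv (put3 t a y c) d0 d1 (max n c) (.cons a y c l)
        (fun v z => search d0 d1 fuel (put3 t a y c) dv2 ub S2 (max n c) v z
          (.cons a y c l)) 11 (a + 1)) with ⟨z, e5, hz1, hz2⟩ | ⟨m, e5, hm, hm'⟩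
  · rw [e5]
    exact ih _ _ _ _ _ _ _ _ (hinv ub2 hub2) (by omega) hz1 hz2 hdone (by omega)
  · rw [e5]
    obtain ⟨ub3, e6, hub3⟩ := closed_ubd hC (dv := dv2) (v := a) (by omega) ⟨O, hO, hTO'⟩ hm hub2
      hdv fun ub => nextv (put3 t a y c) d0 d1 (max n c) (.cons a y c l)
        (fun v z => search d0 d1 fuel (put3 t a y c) dv2 ub S2 (max n c) v z
          (.cons a y c l)) 11 (a + 1)
    rw [e6]
    refine nextv_mem (hinv ub3 hub3) hC _ (fun v z hv hv' h1 h2 h3 =>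
      ih _ _ _ _ _ _ _ _ (hinv ub3 hub3) ⟨hv, hv'⟩ h1 h2 h3 (by omega)) _ _ (by omega) (by omega)
      (by omega) fun w hw hw' => ?_
    rcases Nat.lt_succ_iff_lt_or_eq.1 hw' with hw' | rfl
    · exact hdone w hw hw'
    · exact hm'

theorem search_mem {C : (ℕ → ℕ → ℕ) → Prop} {d0 d1 : ℕ} (hC : Cls C d0 d1) (fuel : ℕ) :
    ∀ t dv ub S n a y l, Inv C d0 d1 t dv ub S n l → 1 ≤ a ∧ a ≤ n → tab t a y = 0 →
      tab t y a ≠ 0 → (∀ w, 1 ≤ w → w < a → Done (tab t) w) → zeros (tab t) < fuel →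
      ∃ x ∈ search d0 d1 fuel t dv ub S n a y l, C (tab x) := by
  induction fuel with
  | zero => intro _ _ _ _ _ _ _ _ _ _ _ _ _ h; omega
  | succ fuel ih =>
    intro t dv ub S n a y l h ha hay hya hd hf
    obtain ⟨c, h1, h2, h3, x, hx, hCx⟩ := h.child_mem hC ha hay hya hd hf ih
    refine ⟨x, ?_, hCx⟩
    rw [search_succ]
    refine mem_children h1 ?_ hx
    rw [ble_eq, Bool.cond_decide]
    split_ifs <;> omega

theorem tab_zero (a b : ℕ) : tab 0 a b = 0 := by
  unfold tab
  split_ifs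
  · rw [look_def, Nat.zero_shiftRight]
  · rfl

theorem tab_triangle (i j : ℕ) : tab (put3 0 1 2 3) i j =
    if i = 1 ∧ j = 2 then 3 else if i = 2 ∧ j = 3 then 1 else if i = 3 ∧ j = 1 then 2 else 0 := by
  have := (fill_tab (t := 0) (a := 1) (y := 2) (c := 3) (by omega) (by omega) (by omega) (by omega)
    (by omega) (by omega) (tab_zero _ _) (tab_zero _ _) (tab_zero _ _)).new i j
  rwa [tab_zero] at this

theorem Cls.exists_three {C : (ℕ → ℕ → ℕ) → Prop} {d0 d1 : ℕ} (hC : Cls C d0 d1)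
    {O : ℕ → ℕ → ℕ} (hO : C O) : ∃ O, C O ∧ O 1 2 = 3 := by
  have hgood := hC.good hO
  have h0 := hC.o12 hO
  have h1 := (hgood.rng h0).2.2.1
  have h2 := hgood.next_ne h0
  have h3 : O 1 2 ≠ 1 := fun e => by
    have := hgood.next h0
    rw [e] at this
    exact (hgood.rng this).2.2.2 rfl
  have hfx : Fx (Equiv.swap (O 1 2) 3) := Fx.swap (by omega) (by omega)
  have e1 : Equiv.swap (O 1 2) 3 1 = 1 := Equiv.swap_apply_of_ne_of_ne (by omega) (by omega)
  have e2 : Equiv.swap (O 1 2) 3 2 = 2 := Equiv.swap_apply_of_ne_of_ne (by omega) (by omega)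
  have e3 := relabel_apply (Equiv.swap (O 1 2) 3) O 1 2
  have d1 := deg_relabel hfx O 1
  have d2 := deg_relabel hfx O 2
  rw [e1, e2, Equiv.swap_apply_left] at e3
  rw [e1] at d1
  rw [e2] at d2
  exact ⟨_, hC.eqv hO ((Eqv.refl O).relabel hfx) (by rw [d1, hC.deg1 hO]) (by rw [d2, hC.deg2 hO])
    (by omega), e3⟩

theorem inv_start {C : (ℕ → ℕ → ℕ) → Prop} {d0 d1 : ℕ} (hC : Cls C d0 d1)
    {O : ℕ → ℕ → ℕ} (hO : C O) : Inv C d0 d1 (put3 0 1 2 3)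
      (setn (setn (setn 0 1 2) 2 2) 3 2) (setn (setn 0xfffffffffff 1 d0) 2 d1)
      (Nat.add (Nat.mul 9 d0) d1) 3 (Path.cons 1 2 3 Path.nil) := by
  obtain ⟨O3, hO3, h123⟩ := hC.exists_three hO
  have h0 : 3 ≤ d0 := by
    rw [← hC.deg1 hO]; exact (hC.good hO).deg_ge (by omega) (by omega)
  have h1 : 3 ≤ d1 := by
    rw [← hC.deg2 hO]; exact (hC.good hO).deg_ge (by omega) (by omega)
  have h9 := hC.le_nine hO
  have hext : ∀ O, C O → O 1 2 = 3 → Ext (tab (put3 0 1 2 3)) O := by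
    intro O hO h i j hij
    have hne := hC.o12 hO
    rw [tab_triangle] at hij ⊢
    split_ifs at hij ⊢ with e1 e2 e3
    · rw [e1.1, e1.2, h]
    · rw [e2.1, e2.2, ← h]; exact (hC.good hO).rot hne
    · rw [e3.1, e3.2, ← h]; exact (hC.good hO).rot2 hne
    · exact absurd rfl hij
  have hdeg : ∀ v, 1 ≤ v → v ≤ 10 → nib (setn (setn (setn 0 1 2) 2 2) 3 2) v =
      rdeg (fun v w => tab (put3 0 1 2 3) v w ≠ 0 ∨ tab (put3 0 1 2 3) w v ≠ 0) v ∧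
      nib (setn (setn (setn 0 1 2) 2 2) 3 2) v ≤ 2 := by
    intro v hv hv'
    have : rdeg (fun v w => tab (put3 0 1 2 3) v w ≠ 0 ∨ tab (put3 0 1 2 3) w v ≠ 0) v =
        ((Finset.Icc 1 10).filter fun w => (v = 1 ∧ w = 2 ∨ v = 2 ∧ w = 3 ∨ v = 3 ∧ w = 1) ∨
          (w = 1 ∧ v = 2 ∨ w = 2 ∧ v = 3 ∨ w = 3 ∧ v = 1)).card := by
      have key : ∀ i j, tab (put3 0 1 2 3) i j ≠ 0 ↔
          i = 1 ∧ j = 2 ∨ i = 2 ∧ j = 3 ∨ i = 3 ∧ j = 1 := by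
        intro i j
        rw [tab_triangle]
        split_ifs <;> tauto
      simp only [rdeg, key]
    rw [this]
    interval_cases v <;> decide
  refine ⟨⟨fun {i j} hij => ?_, fun {i j} hij => ?_⟩, le_rfl, by omega,
    ⟨O3, hO3, hext O3 hO3 h123⟩, ?_, ?_, ?_, ?_, ?_, ?_, ⟨fun v hv hv' => (hdeg v hv hv').1, ?_⟩, ?_⟩
  · rw [tab_triangle] at hij ⊢
    split_ifs at hij ⊢ <;> omega
  · rw [tab_triangle i j] at hij ⊢
    split_ifs at hij ⊢ with e1 e2 e3
    · rw [tab_triangle]; simp [e1]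
    · rw [tab_triangle]; simp [e2]
    · rw [tab_triangle]; simp [e3]
    · exact absurd rfl hij
  · intro O hO
    change 3 < O 1 2 ∨ (O 1 2 = 3 ∧ True)
    have h4 := hC.o12 hO
    have h5 := (hC.good hO).next_ne h4
    have h6 := ((hC.good hO).rng ((hC.good hO).next h4)).2.2.2
    rcases Nat.lt_or_ge 3 (O 1 2) with h | h
    · exact Or.inl h
    · exact Or.inr ⟨by omega, trivial⟩
  · intro O hO h
    exact hext O hO (h (1, 2, 3) (by simp [Path.toList]))
  · intro e he
    simp only [Path.toList, List.reverse_cons, List.reverse_nil, List.nil_append,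
      List.mem_singleton] at he
    subst he
    rw [tab_triangle]; simp
  · simp [Path.toList, Wf]
  · rw [tab_triangle]; simp
  · intro v hv hv'
    interval_cases v
    · exact ⟨2, by rw [tab_triangle]; simp⟩
    · exact ⟨3, by rw [tab_triangle]; simp⟩
    · exact ⟨1, by rw [tab_triangle]; simp⟩
  · have : ∀ v ∈ Finset.Icc 1 10, max (rdeg (fun v w => tab (put3 0 1 2 3) v w ≠ 0 ∨
        tab (put3 0 1 2 3) w v ≠ 0) v) (lb d0 d1 v) = if v = 2 then d1 else d0 := by
      intro v hv
      rw [Finset.mem_Icc] at hv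
      have := hdeg v hv.1 hv.2
      rw [lb_eq]
      split_ifs <;> omega
    rw [Finset.sum_congr rfl this]
    simp [Finset.sum_Icc_succ_top]
    omega
  · intro O hO _ v hv hv'
    rw [nib_setn _ _ _ _ (by omega)]
    split_ifs with e2
    · rw [e2, hC.deg2 hO]
    rw [nib_setn _ _ _ _ (by omega)]
    split_ifs with e1
    · rw [e1, hC.deg1 hO]
    have h15 : nib 0xfffffffffff v = 15 := by
      interval_cases v <;> rfl
    rw [h15]
    have := (hC.good hO).deg_le_nine v
    omega

theorem start_mem {C : (ℕ → ℕ → ℕ) → Prop} {d0 d1 : ℕ} (hC : Cls C d0 d1)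
    {O : ℕ → ℕ → ℕ} (hO : C O) : ∃ x ∈ start d0 d1, C (tab x) := by
  refine search_mem hC 101 _ _ _ _ _ _ _ _ (inv_start hC hO) (by omega) ?_ ?_ ?_ ?_
  · rw [tab_triangle]; simp
  · rw [tab_triangle]; simp
  · intro w h1 h2; omega
  · refine lt_of_le_of_lt (Finset.card_filter_le _ _) ?_
    simp

/-- Every torus is equivalent to one found by the search. -/
theorem exists_start {O : ℕ → ℕ → ℕ} (hO : Good O) : ∃ d0 d1, 3 ≤ d0 ∧ d0 ≤ 6 ∧ d0 ≤ d1 ∧ d1 ≤ 9 ∧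
    ∃ x ∈ start d0 d1, Eqv O (tab x) := by
  obtain ⟨u, hu, hmin⟩ := Finset.exists_min_image (Finset.Icc 1 10) (deg O) ⟨1, by simp⟩
  have hP : ∃ p : ℕ × ℕ, p ∈ ((Finset.Icc 1 10 ×ˢ Finset.Icc 1 10).filter fun p : ℕ × ℕ =>
      deg O p.1 = deg O u ∧ O p.1 p.2 ≠ 0) := by
    have hu' := Finset.mem_Icc.1 hu
    obtain ⟨v, hv⟩ := hO.nz hu'.1 hu'.2
    exact ⟨(u, v), by simpa [hv] using ⟨hu', (hO.rng hv).2.1⟩⟩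
  obtain ⟨⟨x, y⟩, hxy, hmax⟩ := Finset.exists_max_image _ (fun p : ℕ × ℕ => deg O p.2) hP
  simp only [Finset.mem_filter, Finset.mem_product, Finset.mem_Icc, Prod.forall] at hxy hmax
  obtain ⟨⟨hx, hy⟩, hxu, hxy⟩ := hxy
  have hmin' : ∀ w, 1 ≤ w → w ≤ 10 → deg O u ≤ deg O w := fun w h1 h2 =>
    hmin w (Finset.mem_Icc.2 ⟨h1, h2⟩)
  have hu' := Finset.mem_Icc.1 hu
  refine ⟨deg O u, deg O y, hO.deg_ge hu'.1 hu'.2, ?_, hmin' y hy.1 hy.2, hO.deg_le_nine y, ?_⟩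
  · by_contra hlt
    have := Finset.card_nsmul_le_sum (Finset.Icc 1 10) (deg O) 7 fun v hv => by
      have := hmin v hv
      omega
    rw [hO.tot] at this
    simp at this
  · obtain ⟨σ, hσ, h1, h2⟩ := exists_fx hx hy (hO.rng hxy).2.2.2
    have hC : Cls (fun O' => Eqv O O' ∧ deg O' 1 = deg O u ∧ deg O' 2 = deg O y ∧ O' 1 2 ≠ 0)
        (deg O u) (deg O y) := by
      refine ⟨fun h => h.1.good hO, fun h => h.2.1, fun h => h.2.2.1, fun h => h.2.2.2, ?_, ?_,
        fun h h' h1 h2 h3 => ⟨h.1.trans h', h1, h2, h3⟩⟩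
      · intro O' h v hv hv'
        obtain ⟨w, hw⟩ := (h.1.good hO).nz hv hv'
        obtain ⟨i, j, hij, hi, _⟩ := h.1.exists_dart hO hw
        rw [← hi]
        exact hmin' i (hO.rng hij).1.1 (hO.rng hij).1.2
      · intro O' h v w hv hw
        obtain ⟨i, j, hij, hi, hj⟩ := h.1.exists_dart hO hw
        rw [← hj]
        exact hmax i j ⟨⟨(hO.rng hij).1, (hO.rng hij).2.1⟩, hi.trans hv, hij⟩
    have hd1 : deg (relabel σ O) 1 = deg O u := by rw [← h1, deg_relabel hσ, hxu]
    have hd2 : deg (relabel σ O) 2 = deg O y := by rw [← h2, deg_relabel hσ]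
    have h12 : relabel σ O 1 2 ≠ 0 := by
      rw [← h1, ← h2, relabel_apply]
      exact fun e => hxy (hσ.eq_zero.1 e)
    obtain ⟨z, hz, hz'⟩ := start_mem hC (O := relabel σ O) ⟨(Eqv.refl O).relabel hσ, hd1, hd2, h12⟩
    exact ⟨z, hz, hz'.1⟩

/-! ### Orientations of triangulated surfaces -/

/-- A set of oriented triangles in which every dart lies in at most one triangle and every edge
carries two different triangles. -/
structure Ori (T : Fin 10 → Fin 10 → Fin 10 → Prop) : Prop where
  ne : ∀ {a b c}, T a b c → a ≠ b ∧ a ≠ c ∧ b ≠ c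
  rot : ∀ {a b c}, T a b c → T b c a
  uniq : ∀ {a b c c'}, T a b c → T a b c' → c = c'
  opp : ∀ {a b c}, T a b c → ∃ d, d ≠ c ∧ T b a d

/-- The faces of the surface are the given triangles. -/
def Rep (S : TriSurface 10) (T : Fin 10 → Fin 10 → Fin 10 → Prop) : Prop :=
  ∀ f, f ∈ S.faces ↔ ∃ a b c, T a b c ∧ f = {a, b, c}

/-- The darts of an oriented triangle. -/
noncomputable def darts (T : Fin 10 → Fin 10 → Fin 10 → Prop) (f : Finset (Fin 10)) :
    Finset (Fin 10 × Fin 10) :=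
  Finset.univ.filter fun p => ∃ c, T p.1 p.2 c ∧ f = {p.1, p.2, c}

theorem triple_eq {a b c x y z : Fin 10} (h : ({a, b, c} : Finset (Fin 10)) = {x, y, z})
    (hab : a ≠ b) (hac : a ≠ c) (hbc : b ≠ c) :
    (a = x ∧ b = y ∧ c = z) ∨ (a = y ∧ b = z ∧ c = x) ∨ (a = z ∧ b = x ∧ c = y) ∨
    (a = x ∧ b = z ∧ c = y) ∨ (a = y ∧ b = x ∧ c = z) ∨ (a = z ∧ b = y ∧ c = x) := by
  have ha : a ∈ ({x, y, z} : Finset (Fin 10)) := h ▸ (by simp)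
  have hb : b ∈ ({x, y, z} : Finset (Fin 10)) := h ▸ (by simp)
  have hc : c ∈ ({x, y, z} : Finset (Fin 10)) := h ▸ (by simp)
  simp only [Finset.mem_insert, Finset.mem_singleton] at ha hb hc
  rcases ha with rfl | rfl | rfl <;> rcases hb with rfl | rfl | rfl <;>
    rcases hc with rfl | rfl | rfl <;> simp_all

namespace Ori

variable {T : Fin 10 → Fin 10 → Fin 10 → Prop}

theorem anti (h : Ori T) {a b c : Fin 10} (h1 : T a b c) : ¬T b a c := fun h2 => by
  obtain ⟨d, hd, h3⟩ := h.opp h1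
  exact hd (h.uniq h3 h2)

/-- A triangle of the complex is oriented in one of two ways. -/
theorem triple (h : Ori T) {a b c x y z : Fin 10} (h1 : T x y z)
    (e : ({a, b, c} : Finset (Fin 10)) = {x, y, z}) (hab : a ≠ b) (hac : a ≠ c) (hbc : b ≠ c) :
    T a b c ∨ T b a c := by
  have h2 := h.rot h1
  have h3 := h.rot h2
  rcases triple_eq e hab hac hbc with ⟨rfl, rfl, rfl⟩ | ⟨rfl, rfl, rfl⟩ | ⟨rfl, rfl, rfl⟩ |
    ⟨rfl, rfl, rfl⟩ | ⟨rfl, rfl, rfl⟩ | ⟨rfl, rfl, rfl⟩ <;> tauto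

theorem of_mem (h : Ori T) {a b x y z : Fin 10} (h1 : T x y z)
    (ha : a ∈ ({x, y, z} : Finset (Fin 10))) (hb : b ∈ ({x, y, z} : Finset (Fin 10)))
    (hab : a ≠ b) : ∃ c, ({x, y, z} : Finset (Fin 10)) = {a, b, c} ∧ (T a b c ∨ T b a c) := by
  have h2 := h.rot h1
  have h3 := h.rot h2
  simp only [Finset.mem_insert, Finset.mem_singleton] at ha hb
  rcases ha with rfl | rfl | rfl <;> rcases hb with rfl | rfl | rfl
  · exact absurd rfl hab
  · exact ⟨z, rfl, Or.inl h1⟩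
  · exact ⟨y, by rw [Finset.pair_comm], Or.inr h3⟩
  · exact ⟨z, by rw [Finset.insert_comm], Or.inr h1⟩
  · exact absurd rfl hab
  · exact ⟨x, by ext; simp; tauto, Or.inl h2⟩
  · exact ⟨y, by ext; simp; tauto, Or.inl h3⟩
  · exact ⟨x, by ext; simp; tauto, Or.inr h2⟩
  · exact absurd rfl hab

theorem dart (h : Ori T) {S : TriSurface 10} (hS : Rep S T) {a b : Fin 10} (hab : a ≠ b) :
    (∃ f ∈ S.faces, a ∈ f ∧ b ∈ f) ↔ ∃ c, T a b c := by
  constructor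
  · rintro ⟨f, hf, ha, hb⟩
    obtain ⟨x, y, z, h1, rfl⟩ := (hS f).1 hf
    obtain ⟨c, -, hc | hc⟩ := h.of_mem h1 ha hb hab
    · exact ⟨c, hc⟩
    · obtain ⟨d, -, hd⟩ := h.opp hc
      exact ⟨d, hd⟩
  · rintro ⟨c, hc⟩
    exact ⟨_, (hS _).2 ⟨a, b, c, hc, rfl⟩, by simp, by simp⟩

theorem darts_eq (h : Ori T) {a b c : Fin 10} (h1 : T a b c) :
    darts T {a, b, c} = {(a, b), (b, c), (c, a)} := by
  have h2 := h.rot h1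
  have h3 := h.rot h2
  have n1 := h.ne h1
  ext ⟨x, y⟩
  simp only [darts, Finset.mem_filter, Finset.mem_univ, true_and, Finset.mem_insert,
    Finset.mem_singleton, Prod.mk.injEq]
  constructor
  · rintro ⟨z, hz, e⟩
    have n2 := h.ne hz
    have h1' := h.anti h1
    have h2' := h.anti h2
    have h3' := h.anti h3
    rcases triple_eq e.symm n2.1 n2.2.1 n2.2.2 with ⟨rfl, rfl, rfl⟩ | ⟨rfl, rfl, rfl⟩ |
      ⟨rfl, rfl, rfl⟩ | ⟨rfl, rfl, rfl⟩ | ⟨rfl, rfl, rfl⟩ | ⟨rfl, rfl, rfl⟩ <;> tauto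
  · rintro (⟨rfl, rfl⟩ | ⟨rfl, rfl⟩ | ⟨rfl, rfl⟩)
    · exact ⟨c, h1, rfl⟩
    · exact ⟨a, h2, by ext; simp; tauto⟩
    · exact ⟨b, h3, by ext; simp; tauto⟩

theorem orientable (h : Ori T) {S : TriSurface 10} (hS : Rep S T) : S.Orientable := by
  refine ⟨darts T, fun f hf => ?_, fun f _ g _ hfg p hp hp' => hfg ?_⟩
  · obtain ⟨a, b, c, h1, rfl⟩ := (hS f).1 hf
    have := h.ne h1
    exact ⟨a, b, c, this.1, this.2.1, this.2.2, rfl, h.darts_eq h1⟩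
  · obtain ⟨c, hc, rfl⟩ := (Finset.mem_filter.1 hp).2
    obtain ⟨d, hd, rfl⟩ := (Finset.mem_filter.1 hp').2
    rw [h.uniq hc hd]

theorem exists_of_orientable {S : TriSurface 10} (hS : S.Orientable) :
    ∃ T, Ori T ∧ Rep S T := by
  obtain ⟨ω, h1, h2⟩ := hS
  refine ⟨fun a b c => ({a, b, c} : Finset (Fin 10)) ∈ S.faces ∧
    ω {a, b, c} = {(a, b), (b, c), (c, a)}, ?_, ?_⟩
  · have ne : ∀ {a b c : Fin 10}, ({a, b, c} : Finset (Fin 10)) ∈ S.faces →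
        a ≠ b ∧ a ≠ c ∧ b ≠ c := fun {a b c} h => by
      have := S.card_eq _ h
      refine ⟨?_, ?_, ?_⟩ <;> rintro rfl
      · have := Finset.card_le_two (a := a) (b := c)
        simp_all
      · have := Finset.card_le_two (a := a) (b := b)
        rw [Finset.pair_comm b a, Finset.insert_idem] at *
        omega
      · have := Finset.card_le_two (a := a) (b := b)
        rw [Finset.pair_eq_singleton] at *
        omega
    have uniq : ∀ {f g}, f ∈ S.faces → g ∈ S.faces → ∀ p, p ∈ ω f → p ∈ ω g → f = g :=
      fun hf hg p hp hp' => by_contra fun e => h2 _ hf _ hg e p hp hp'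
    have rot : ∀ {a b c : Fin 10}, ({a, b, c} : Finset (Fin 10)) ∈ S.faces →
        ω {a, b, c} = {(a, b), (b, c), (c, a)} → ({b, c, a} : Finset (Fin 10)) ∈ S.faces ∧
        ω {b, c, a} = {(b, c), (c, a), (a, b)} := fun {a b c} h h' => by
      have e : ({b, c, a} : Finset (Fin 10)) = {a, b, c} := by ext; simp; tauto
      rw [e, h']
      exact ⟨h, by ext; simp; tauto⟩
    refine ⟨fun h => ne h.1, fun {a b c} h => rot h.1 h.2, fun {a b c c'} h h' => ?_,
      fun {a b c} h => ?_⟩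
    · have e := uniq h.1 h'.1 (a, b) (by rw [h.2]; simp) (by rw [h'.2]; simp)
      have n1 := ne h.1
      have : c ∈ ({a, b, c'} : Finset (Fin 10)) := e ▸ (by simp)
      simp only [Finset.mem_insert, Finset.mem_singleton] at this
      tauto
    · have n1 := ne h.1
      have h3 := S.edge_two a b n1.1 ⟨_, h.1, by simp, by simp⟩
      obtain ⟨g, hg, hne⟩ := Finset.exists_mem_ne (h3 ▸ one_lt_two) ({a, b, c} : Finset (Fin 10))
      rw [Finset.mem_filter] at hg
      obtain ⟨hg, ha, hb⟩ := hg
      have hab : (a, b) ∉ ω g := fun h' =>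
        hne (uniq hg h.1 (a, b) h' (by rw [h.2]; simp))
      obtain ⟨x, y, z, -, -, -, rfl, e⟩ := h1 g hg
      have r1 := rot hg e
      have r2 := rot r1.1 r1.2
      have key : ∀ d, ({b, a, d} : Finset (Fin 10)) = {x, y, z} → d ≠ c := by
        rintro d hd rfl
        rw [Finset.insert_comm] at hd
        exact hne hd.symm
      rw [e] at hab
      simp only [Finset.mem_insert, Finset.mem_singleton, Prod.mk.injEq] at ha hb hab
      have h3 : (b = x ∧ a = y) ∨ (b = y ∧ a = z) ∨ (b = z ∧ a = x) := by
        have n := n1.1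
        clear * - ha hb hab n
        rcases ha with rfl | rfl | rfl <;> rcases hb with rfl | rfl | rfl <;> simp_all
      rcases h3 with ⟨rfl, rfl⟩ | ⟨rfl, rfl⟩ | ⟨rfl, rfl⟩
      · exact ⟨z, key z rfl, hg, e⟩
      · exact ⟨x, key x (by ext; simp; tauto), r1⟩
      · exact ⟨y, key y (by ext; simp; tauto), r2⟩
  · intro f
    constructor
    · intro hf
      obtain ⟨a, b, c, -, -, -, rfl, e⟩ := h1 f hf
      exact ⟨a, b, c, ⟨hf, e⟩, rfl⟩
    · rintro ⟨a, b, c, h, rfl⟩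
      exact h.1

end Ori

namespace Ori

variable {T : Fin 10 → Fin 10 → Fin 10 → Prop}

/-- Every triangle has three darts. -/
theorem card_dart_faces (h : Ori T) {S : TriSurface 10} (hS : Rep S T) :
    (Finset.univ.filter fun p : Fin 10 × Fin 10 => ∃ c, T p.1 p.2 c).card = 3 * S.faces.card := by
  have e : (Finset.univ.filter fun p : Fin 10 × Fin 10 => ∃ c, T p.1 p.2 c) =
      S.faces.biUnion (darts T) := by
    ext p
    simp only [darts, Finset.mem_filter, Finset.mem_univ, true_and, Finset.mem_biUnion]
    constructor
    · rintro ⟨c, hc⟩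
      exact ⟨_, (hS _).2 ⟨_, _, _, hc, rfl⟩, c, hc, rfl⟩
    · rintro ⟨_, _, c, hc, _⟩
      exact ⟨c, hc⟩
  rw [e, Finset.card_biUnion]
  · rw [Finset.sum_congr rfl (g := fun _ => 3), Finset.sum_const, smul_eq_mul, mul_comm]
    intro f hf
    obtain ⟨a, b, c, hT, rfl⟩ := (hS f).1 hf
    have n := h.ne hT
    rw [h.darts_eq hT, Finset.card_eq_three]
    exact ⟨_, _, _, by simp [n.1], by simp [n.2.1], by simp [n.2.2], rfl⟩
  · intro f _ g _ hfg
    refine Finset.disjoint_left.2 ?_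
    intro p hp hp'
    obtain ⟨c, hc, e⟩ := (Finset.mem_filter.1 hp).2
    obtain ⟨d, hd, e'⟩ := (Finset.mem_filter.1 hp').2
    rw [h.uniq hd hc, ← e] at e'
    exact hfg e'.symm

/-- Every edge has two darts. -/
theorem card_dart_edges (h : Ori T) {S : TriSurface 10} (hS : Rep S T) :
    (Finset.univ.filter fun p : Fin 10 × Fin 10 => ∃ c, T p.1 p.2 c).card = 2 * S.edges.card := by
  have hsymm : ∀ {a b}, (∃ c, T a b c) → ∃ c, T b a c := fun ⟨c, hc⟩ => by
    obtain ⟨d, -, hd⟩ := h.opp hc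
    exact ⟨d, hd⟩
  rw [Finset.card_eq_sum_card_fiberwise (f := fun p => ({p.1, p.2} : Finset (Fin 10)))
    (t := S.edges)]
  · rw [Finset.sum_congr rfl (g := fun _ => 2), Finset.sum_const, smul_eq_mul, mul_comm]
    intro e he
    obtain ⟨he2, f, hf, hef⟩ := (Finset.mem_filter.1 he).2
    obtain ⟨a, b, hab, rfl⟩ := Finset.card_eq_two.1 he2
    have hc := (h.dart hS hab).1 ⟨f, hf, hef (by simp), hef (by simp)⟩
    rw [Finset.card_eq_two]
    refine ⟨(a, b), (b, a), by simp [hab], ?_⟩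
    ext ⟨x, y⟩
    simp only [Finset.mem_filter, Finset.mem_univ, true_and, Finset.mem_insert,
      Finset.mem_singleton, Prod.mk.injEq]
    constructor
    · rintro ⟨⟨c, hc⟩, e⟩
      have n := (h.ne hc).1
      have hx : x ∈ ({a, b} : Finset (Fin 10)) := e ▸ (by simp)
      have hy : y ∈ ({a, b} : Finset (Fin 10)) := e ▸ (by simp)
      simp only [Finset.mem_insert, Finset.mem_singleton] at hx hy
      clear * - hx hy n
      rcases hx with rfl | rfl <;> rcases hy with rfl | rfl <;> simp_all
    · rintro (⟨rfl, rfl⟩ | ⟨rfl, rfl⟩)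
      · exact ⟨hc, rfl⟩
      · exact ⟨hsymm hc, Finset.pair_comm _ _⟩
  · rintro ⟨a, b⟩ hp
    obtain ⟨c, hc⟩ := (Finset.mem_filter.1 hp).2
    refine Finset.mem_filter.2 ⟨Finset.mem_univ _, Finset.card_pair (h.ne hc).1,
      _, (hS _).2 ⟨_, _, _, hc, rfl⟩, ?_⟩
    intro z
    simp
    tauto

theorem eulerChar_eq_zero (h : Ori T) {S : TriSurface 10} (hS : Rep S T) : S.eulerChar = 0 ↔
    (Finset.univ.filter fun p : Fin 10 × Fin 10 => ∃ c, T p.1 p.2 c).card = 60 := by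
  have h1 := h.card_dart_faces hS
  have h2 := h.card_dart_edges hS
  unfold TriSurface.eulerChar
  omega

end Ori

/-! ### From rotation systems to surfaces -/

/-- The label of a vertex. -/
def lab (a : Fin 10) : ℕ := a.val + 1

/-- The oriented triangles of a rotation system. -/
def trip (O : ℕ → ℕ → ℕ) (a b c : Fin 10) : Prop := O (lab a) (lab b) = lab c

theorem lab_inj {a b : Fin 10} : lab a = lab b ↔ a = b := by
  simp [lab, Fin.ext_iff]

theorem lab_mem (a : Fin 10) : 1 ≤ lab a ∧ lab a ≤ 10 := by
  unfold lab; omega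

theorem exists_lab {x : ℕ} (h1 : 1 ≤ x) (h2 : x ≤ 10) : ∃ a, lab a = x :=
  ⟨⟨x - 1, by omega⟩, by simp only [lab]; omega⟩

theorem Pre.exists_trip {O : ℕ → ℕ → ℕ} (h : Pre O) {x y : ℕ} (hxy : O x y ≠ 0) :
    ∃ a b c, lab a = x ∧ lab b = y ∧ lab c = O x y ∧ trip O a b c := by
  have := h.rng hxy
  obtain ⟨a, ha⟩ := exists_lab this.1.1 this.1.2
  obtain ⟨b, hb⟩ := exists_lab this.2.1.1 this.2.1.2
  obtain ⟨c, hc⟩ := exists_lab (x := O x y) (by omega) this.2.2.1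
  exact ⟨a, b, c, ha, hb, hc, by rw [trip, ha, hb, hc]⟩

theorem Pre.ne_zero_iff {O : ℕ → ℕ → ℕ} (h : Pre O) {a b : Fin 10} :
    O (lab a) (lab b) ≠ 0 ↔ ∃ c, trip O a b c := by
  constructor
  · intro hab
    obtain ⟨a', b', c, ha, hb, -, hc⟩ := h.exists_trip hab
    rw [lab_inj] at ha hb
    subst ha hb
    exact ⟨c, hc⟩
  · rintro ⟨c, hc⟩
    rw [trip] at hc
    have := lab_mem c
    omega

theorem Pre.ori {O : ℕ → ℕ → ℕ} (h : Pre O) : Ori (trip O) := by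
  have nz : ∀ {a b c}, trip O a b c → O (lab a) (lab b) ≠ 0 := fun {a b c} hc =>
    h.ne_zero_iff.2 ⟨c, hc⟩
  have rot : ∀ {a b c}, trip O a b c → trip O b c a := fun {a b c} hc => by
    have := h.rot (nz hc)
    rw [trip] at hc ⊢
    rwa [hc] at this
  have ne : ∀ {a b c}, trip O a b c → a ≠ b := fun {a b c} hc e =>
    (h.rng (nz hc)).2.2.2 (by rw [e])
  refine ⟨fun hc => ⟨ne hc, (ne (rot (rot hc))).symm, ne (rot hc)⟩, rot,
    fun hc hc' => lab_inj.1 (hc.symm.trans hc'), fun {a b c} hc => ?_⟩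
  obtain ⟨h1, h2⟩ := h.opp (nz hc)
  obtain ⟨d, hd⟩ := h.ne_zero_iff.1 h1
  refine ⟨d, fun e => h2 ?_, hd⟩
  rw [trip] at hc hd
  rw [hc, hd, e]

theorem sum_deg {O : ℕ → ℕ → ℕ} (h : Pre O) : ∑ v ∈ Finset.Icc 1 10, deg O v =
    (Finset.univ.filter fun p : Fin 10 × Fin 10 => ∃ c, trip O p.1 p.2 c).card := by
  unfold deg
  rw [← Finset.card_sigma]
  symm
  refine Finset.card_bij (fun p _ => ⟨lab p.1, lab p.2⟩) ?_ ?_ ?_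
  · rintro ⟨a, b⟩ hp
    simp only [Finset.mem_filter, Finset.mem_univ, true_and] at hp
    rw [Finset.mem_sigma, Finset.mem_filter, Finset.mem_Icc, Finset.mem_Icc]
    exact ⟨lab_mem a, lab_mem b, h.ne_zero_iff.2 hp⟩
  · rintro ⟨a, b⟩ _ ⟨c, d⟩ _ e
    rw [Sigma.mk.injEq, heq_eq_eq, lab_inj, lab_inj] at e
    exact Prod.ext e.1 e.2
  · rintro ⟨x, y⟩ hp
    rw [Finset.mem_sigma, Finset.mem_filter] at hp
    obtain ⟨a, b, c, rfl, rfl, -, hc⟩ := h.exists_trip hp.2.2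
    exact ⟨(a, b), by simpa using ⟨c, hc⟩, rfl⟩

theorem exists_good_of_ori {S : TriSurface 10} {T : Fin 10 → Fin 10 → Fin 10 → Prop}
    (h : Ori T) (hS : Rep S T) (h0 : S.eulerChar = 0) : ∃ O, Good O ∧ trip O = T := by
  let O : ℕ → ℕ → ℕ := fun x y =>
    if e : ∃ c : Fin 10, ∃ a b, lab a = x ∧ lab b = y ∧ T a b c then lab e.choose else 0
  have hO : trip O = T := by
    ext a b c
    simp only [trip, O]
    constructor
    · intro e
      split_ifs at e with h1
      · obtain ⟨a', b', ha, hb, hT⟩ := h1.choose_spec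
        rw [lab_inj] at ha hb e
        rwa [ha, hb, e] at hT
      · have := lab_mem c
        omega
    · intro hT
      have h1 : ∃ c : Fin 10, ∃ a' b', lab a' = lab a ∧ lab b' = lab b ∧ T a' b' c :=
        ⟨c, a, b, rfl, rfl, hT⟩
      rw [dif_pos h1]
      obtain ⟨a', b', ha, hb, hT'⟩ := h1.choose_spec
      rw [lab_inj] at ha hb ⊢
      rw [ha, hb] at hT'
      exact h.uniq hT' hT
  have ex : ∀ {x y}, O x y ≠ 0 → ∃ a b c, lab a = x ∧ lab b = y ∧ T a b c ∧ O x y = lab c := by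
    intro x y hxy
    simp only [O] at hxy ⊢
    split_ifs at hxy ⊢ with h1
    · obtain ⟨a, b, ha, hb, hT⟩ := h1.choose_spec
      exact ⟨a, b, _, ha, hb, hT, rfl⟩
    · exact absurd rfl hxy
  have of : ∀ {a b c}, T a b c → O (lab a) (lab b) = lab c := fun {a b c} hT => by
    rw [← hO] at hT; exact hT
  have pre : Pre O := by
    refine ⟨fun {x y} hxy => ?_, fun {x y} hxy => ?_, fun {x y} hxy => ?_⟩ <;>
      obtain ⟨a, b, c, rfl, rfl, hT, e⟩ := ex hxy <;> rw [e]
    · exact ⟨lab_mem a, lab_mem b, (lab_mem c).2, fun e' => (h.ne hT).1 (lab_inj.1 e')⟩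
    · exact of (h.rot hT)
    · obtain ⟨d, hd, hT'⟩ := h.opp hT
      rw [of hT', Ne, Ne, lab_inj]
      exact ⟨by have := lab_mem d; omega, hd⟩
  have nz : ∀ {a b c}, T a b c → O (lab a) (lab b) ≠ 0 := fun {a b c} hT => by
    rw [of hT]; have := lab_mem c; omega
  refine ⟨O, ⟨pre, fun {v} h1 h2 => ?_, fun {v w w'} h1 h2 => ?_, ?_, fun {x y} h1 h2 h3 h4 => ?_⟩, hO⟩
  · obtain ⟨a, rfl⟩ := exists_lab h1 h2
    obtain ⟨f, hf, ha⟩ := S.vertex_mem a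
    obtain ⟨x, y, z, hT, rfl⟩ := (hS f).1 hf
    simp only [Finset.mem_insert, Finset.mem_singleton] at ha
    rcases ha with rfl | rfl | rfl
    · exact ⟨_, nz hT⟩
    · exact ⟨_, nz (h.rot hT)⟩
    · exact ⟨_, nz (h.rot (h.rot hT))⟩
  · obtain ⟨a, b, c, rfl, rfl, hb, -⟩ := ex h1
    obtain ⟨a', b', c', ha, rfl, hb', -⟩ := ex h2
    rw [lab_inj] at ha
    subst ha
    have := S.link_cycle a' b b' ⟨_, (hS _).2 ⟨_, _, _, hb, rfl⟩, by simp, by simp, (h.ne hb).1.symm⟩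
      ⟨_, (hS _).2 ⟨_, _, _, hb', rfl⟩, by simp, by simp, (h.ne hb').1.symm⟩
    clear hb' h2
    induction this with
    | refl => exact ⟨0, rfl⟩
    | @tail x y _ hxy ih =>
      obtain ⟨k, hk⟩ := ih
      obtain ⟨p, q, r, hp, e⟩ := (hS _).1 hxy.2.2.2
      rcases h.triple hp e hxy.2.1.symm hxy.2.2.1.symm hxy.1 with h3 | h3
      · exact ⟨k + 1, by rw [Function.iterate_succ_apply', hk, of h3]⟩
      · have h4 := h.rot (h.rot (h.rot h3))
        have h5 := of (h.rot h3)
        obtain ⟨m, hm, -, em⟩ := pre.exists_period (nz (h.rot h3))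
        refine ⟨(m - 1) + k, ?_⟩
        rw [Function.iterate_add_apply, hk, ← h5, ← Function.iterate_succ_apply,
          Nat.succ_eq_add_one, Nat.sub_add_cancel hm, em]
  · rw [sum_deg pre, hO]
    exact (h.eulerChar_eq_zero hS).1 h0
  · obtain ⟨a, rfl⟩ := exists_lab h1 h2
    obtain ⟨b, rfl⟩ := exists_lab h3 h4
    refine (S.conn a b).lift' lab fun p q hpq => ?_
    by_cases e : p = q
    · rw [e]
    · obtain ⟨c, hc⟩ := (h.dart hS e).1 hpq
      exact .single (nz hc)

theorem Good.exists_surface {O : ℕ → ℕ → ℕ} (h : Good O) :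
    ∃ S : TriSurface 10, (S.Orientable ∧ S.eulerChar = 0) ∧ Rep S (trip O) := by
  have ho := h.ori
  have nz : ∀ {a b c}, trip O a b c → O (lab a) (lab b) ≠ 0 := fun {a b c} hc =>
    h.ne_zero_iff.2 ⟨c, hc⟩
  have card3 : ∀ {a b c}, trip O a b c → ({a, b, c} : Finset (Fin 10)).card = 3 :=
    fun {a b c} hc => Finset.card_eq_three.2 ⟨a, b, c, (ho.ne hc).1, (ho.ne hc).2.1,
      (ho.ne hc).2.2, rfl⟩
  let F : Finset (Finset (Fin 10)) := Finset.univ.filter fun f => ∃ a b c, trip O a b c ∧ f = {a, b, c}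
  have hF : ∀ f, f ∈ F ↔ ∃ a b c, trip O a b c ∧ f = {a, b, c} := fun f => by simp [F]
  have conn : ∀ {x y}, Relation.ReflTransGen (fun x y => O x y ≠ 0) x y → ∀ a, lab a = x →
      ∃ b, lab b = y ∧
        Relation.ReflTransGen (fun a b : Fin 10 => ∃ f ∈ F, a ∈ f ∧ b ∈ f) a b := by
    intro x y hxy a ha
    induction hxy with
    | refl => exact ⟨a, ha, .refl⟩
    | tail _ hd ih =>
      obtain ⟨b, hb, hab⟩ := ih
      obtain ⟨b', c, d, hb', hc, -, hT⟩ := h.exists_trip hd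
      rw [← hb, lab_inj] at hb'
      subst hb'
      exact ⟨c, hc, hab.tail ⟨_, (hF _).2 ⟨_, _, _, hT, rfl⟩, by simp, by simp⟩⟩
  let S : TriSurface 10 := {
    faces := F
    card_eq := fun f hf => by
      obtain ⟨a, b, c, hT, rfl⟩ := (hF f).1 hf
      exact card3 hT
    vertex_mem := fun v => by
      obtain ⟨w, hw⟩ := h.nz (lab_mem v).1 (lab_mem v).2
      obtain ⟨a, b, c, ha, -, -, hT⟩ := h.exists_trip hw
      rw [lab_inj] at ha
      exact ⟨_, (hF _).2 ⟨_, _, _, hT, rfl⟩, by simp [ha]⟩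
    edge_two := fun u v huv he => by
      obtain ⟨f, hf, hu, hv⟩ := he
      obtain ⟨x, y, z, hT, rfl⟩ := (hF f).1 hf
      have h2 : ∃ c d, c ≠ d ∧ trip O u v c ∧ trip O v u d := by
        obtain ⟨c, -, hc | hc⟩ := ho.of_mem hT hu hv huv
        · obtain ⟨d, hd, hd'⟩ := ho.opp hc
          exact ⟨c, d, hd.symm, hc, hd'⟩
        · obtain ⟨d, hd, hd'⟩ := ho.opp hc
          exact ⟨d, c, hd, hd', hc⟩
      obtain ⟨c, d, hcd, hc, hd⟩ := h2
      rw [Finset.card_eq_two]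
      refine ⟨{u, v, c}, {v, u, d}, fun e => ?_, ?_⟩
      · have : c ∈ ({v, u, d} : Finset (Fin 10)) := e ▸ (by simp)
        have n := ho.ne hc
        simp only [Finset.mem_insert, Finset.mem_singleton] at this
        rcases this with e | e | e
        · exact n.2.2 e.symm
        · exact n.2.1 e.symm
        · exact hcd e
      · ext g
        rw [Finset.mem_filter, Finset.mem_insert, Finset.mem_singleton]
        constructor
        · rintro ⟨hg, hu, hv⟩
          obtain ⟨x, y, z, hT, rfl⟩ := (hF g).1 hg
          obtain ⟨w, e, hw | hw⟩ := ho.of_mem hT hu hv huv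
          · rw [e, ho.uniq hw hc]; exact Or.inl rfl
          · rw [e, ho.uniq hw hd]; exact Or.inr (Finset.insert_comm _ _ _)
        · rintro (rfl | rfl)
          · exact ⟨(hF _).2 ⟨_, _, _, hc, rfl⟩, by simp, by simp⟩
          · exact ⟨(hF _).2 ⟨_, _, _, hd, rfl⟩, by simp, by simp⟩
    conn := fun u v => by
      obtain ⟨b, hb, hub⟩ := conn (h.conn (lab_mem u).1 (lab_mem u).2 (lab_mem v).1 (lab_mem v).2)
        u rfl
      rw [lab_inj] at hb
      rwa [← hb]
    link_cycle := fun v a b ha hb => by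
      have key : ∀ a, (∃ f ∈ F, v ∈ f ∧ a ∈ f ∧ a ≠ v) → O (lab v) (lab a) ≠ 0 := by
        rintro a ⟨f, hf, hv, ha, hav⟩
        obtain ⟨x, y, z, hT, rfl⟩ := (hF f).1 hf
        obtain ⟨c, -, hc | hc⟩ := ho.of_mem hT hv ha hav.symm
        · exact nz hc
        · obtain ⟨d, -, hd⟩ := ho.opp hc
          exact nz hd
      have ha := key a ha
      obtain ⟨k, hk⟩ := h.link ha (key b hb)
      clear hb key
      induction k generalizing b with
      | zero => rw [← lab_inj.1 hk]
      | succ k ih =>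
        have hn := h.iter ha k
        obtain ⟨v', x, y, hv, hx, hy, hT⟩ := h.exists_trip hn
        rw [lab_inj] at hv
        subst hv
        rw [Function.iterate_succ_apply', hk, lab_inj] at *
        subst hy
        have n := ho.ne hT
        exact (ih x hx.symm).tail ⟨n.2.2, n.1.symm, n.2.1.symm, (hF _).2 ⟨_, _, _, hT, rfl⟩⟩ }
  refine ⟨S, ⟨ho.orientable hF, (ho.eulerChar_eq_zero (S := S) hF).2 ?_⟩, hF⟩
  rw [← sum_deg h.toPre, h.tot]

/-- Two rotation systems of a surface that agree at a dart agree at its first vertex. -/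
theorem Good.eq_of_dart {O O' : ℕ → ℕ → ℕ} (h : Good O) (h' : Good O') {S : TriSurface 10}
    (hS : Rep S (trip O)) (hS' : Rep S (trip O')) {a b : ℕ} (hab : O a b ≠ 0)
    (e : O' a b = O a b) (c : ℕ) : O' a c = O a c := by
  have key : ∀ {O O'}, Good O → Good O' → Rep S (trip O) → Rep S (trip O') → ∀ {x y}, O x y ≠ 0 →
      O' x y = O x y ∨ O' y x = O x y := by
    intro O O' h h' hS hS' x y hxy
    obtain ⟨a, b, c, rfl, rfl, hc, hT⟩ := h.exists_trip hxy
    obtain ⟨x, y, z, hT', e⟩ := (hS' _).1 ((hS _).2 ⟨_, _, _, hT, rfl⟩)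
    have n := h.ori.ne hT
    rw [← hc]
    exact h'.ori.triple hT' e n.1 n.2.1 n.2.2
  by_cases hc : O a c = 0
  · rw [hc]
    by_contra hc'
    rcases key h' h hS' hS hc' with e | e
    · exact hc' (e.symm.trans hc)
    · exact h.ne_iff.1 (fun e' => hc' (e.symm.trans e')) hc
  · obtain ⟨k, rfl⟩ := h.link hab hc
    clear hc
    induction k with
    | zero => exact e
    | succ k ih =>
      rw [Function.iterate_succ_apply']
      have h1 := h.iter hab k
      have h2 := h.next h1
      rcases key h h' hS hS' h2 with e1 | e1
      · exact e1
      · have h3 := h'.rot2 (ih ▸ h1)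
        rw [ih, e1] at h3
        exact absurd ((h.rot2 h1).trans h3.symm) (h.opp h2).2

theorem Good.eq_of_eq {O O' : ℕ → ℕ → ℕ} (h : Good O) (h' : Good O') {S : TriSurface 10}
    (hS : Rep S (trip O)) (hS' : Rep S (trip O')) {a b : ℕ} (hab : O a b ≠ 0)
    (e : O' a b = O a b) : O' = O := by
  have hr := h.rng hab
  have key : ∀ {y}, Relation.ReflTransGen (fun x y => O x y ≠ 0) a y → ∀ c, O' y c = O y c := by
    intro y hy
    induction hy with
    | refl => exact h.eq_of_dart h' hS hS' hab e
    | @tail x y _ hxy ih =>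
      have h1 := h.rot hxy
      have h2 := h'.rot ((ih y).symm ▸ hxy)
      rw [ih] at h2
      exact h.eq_of_dart h' hS hS' (b := O x y) (by have := h.rng hxy; omega) (by rw [h1, h2])
  ext x c
  by_cases hx : 1 ≤ x ∧ x ≤ 10
  · exact key (h.conn hr.1.1 hr.1.2 hx.1 hx.2) c
  · rw [not_not.1 fun e => hx (h.rng e).1, not_not.1 fun e => hx (h'.rng e).1]

theorem rep_flip {O : ℕ → ℕ → ℕ} {S : TriSurface 10} (hS : Rep S (trip O)) :
    Rep S (trip fun a b => O b a) := fun f => (hS f).trans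
  ⟨fun ⟨a, b, c, h, e⟩ => ⟨b, a, c, h, e.trans (Finset.insert_comm _ _ _)⟩,
    fun ⟨a, b, c, h, e⟩ => ⟨b, a, c, h, e.trans (Finset.insert_comm _ _ _)⟩⟩

/-- A surface has only two orientations. -/
theorem Good.eq_or_flip {O O' : ℕ → ℕ → ℕ} (h : Good O) (h' : Good O') {S : TriSurface 10}
    (hS : Rep S (trip O)) (hS' : Rep S (trip O')) : O' = O ∨ O' = fun a b => O b a := by
  obtain ⟨w, hw⟩ := h.nz (v := 1) (by omega) (by omega)
  obtain ⟨a, b, c, ha, hb, hc, hT⟩ := h.exists_trip hw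
  obtain ⟨x, y, z, hT', e⟩ := (hS' _).1 ((hS _).2 ⟨_, _, _, hT, rfl⟩)
  have n := h.ori.ne hT
  have hT2 := hT
  rw [trip, ha, hb] at hT2
  rcases h'.ori.triple hT' e n.1 n.2.1 n.2.2 with h1 | h1 <;> rw [trip, ha, hb] at h1
  · exact Or.inl (h.eq_of_eq h' hS hS' hw (h1.trans hT2.symm))
  · refine Or.inr (h.flip.eq_of_eq h' (rep_flip hS) hS' (a := w) (b := 1) hw (h1.trans hT2.symm))

/-- Permutations of the vertices and of the labels. -/
theorem exists_label_perm (τ : Equiv.Perm (Fin 10)) : ∃ σ, Fx σ ∧ ∀ a, σ (lab a) = lab (τ a) := by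
  let f : Fin 10 ≃ {x : ℕ // 1 ≤ x ∧ x ≤ 10} := Equiv.ofBijective (fun a => ⟨lab a, lab_mem a⟩)
    ⟨fun a b e => lab_inj.1 (Subtype.ext_iff.1 e), fun x => by
      obtain ⟨a, ha⟩ := exists_lab x.2.1 x.2.2
      exact ⟨a, Subtype.ext ha⟩⟩
  exact ⟨τ.extendDomain f, fun x hx => Equiv.Perm.extendDomain_apply_not_subtype _ _ hx,
    fun a => Equiv.Perm.extendDomain_apply_image τ f a⟩

theorem exists_vertex_perm {σ : Equiv.Perm ℕ} (h : Fx σ) :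
    ∃ τ : Equiv.Perm (Fin 10), ∀ a, σ (lab a) = lab (τ a) := by
  have key : ∀ a, ∃ b, lab b = σ (lab a) := fun a =>
    exists_lab (h.rng (lab_mem a)).1 (h.rng (lab_mem a)).2
  choose τ hτ using key
  have hi : Function.Injective τ := fun a b e =>
    lab_inj.1 (σ.injective (by rw [← hτ, ← hτ, e]))
  exact ⟨Equiv.ofBijective τ (Finite.injective_iff_bijective.1 hi), fun a => (hτ a).symm⟩

theorem rep_relabel {O : ℕ → ℕ → ℕ} {S S' : TriSurface 10} (hS : Rep S (trip O))
    {σ : Equiv.Perm ℕ} {τ : Equiv.Perm (Fin 10)} (h : ∀ a, σ (lab a) = lab (τ a)) :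
    Rep S' (trip (relabel σ O)) ↔ ∀ f, f ∈ S.faces ↔ f.image τ ∈ S'.faces := by
  have key : ∀ f : Finset (Fin 10), (∃ a b c, trip (relabel σ O) a b c ∧ f = {a, b, c}) ↔
      f.image τ.symm ∈ S.faces := by
    intro f
    rw [hS]
    have ht : ∀ a b c, trip (relabel σ O) (τ a) (τ b) (τ c) ↔ trip O a b c := fun a b c => by
      rw [trip, ← h, ← h, ← h, relabel_apply, σ.injective.eq_iff, trip]
    constructor
    · rintro ⟨a, b, c, hT, rfl⟩
      refine ⟨τ.symm a, τ.symm b, τ.symm c, ?_, by simp⟩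
      rw [← ht]
      simpa using hT
    · rintro ⟨a, b, c, hT, e⟩
      refine ⟨τ a, τ b, τ c, (ht _ _ _).2 hT, ?_⟩
      have := congrArg (Finset.image τ) e
      rw [Finset.image_image] at this
      simpa using this
  have im : ∀ f : Finset (Fin 10), (f.image τ).image τ.symm = f := fun f => by rw [Finset.image_image]; simp
  have im' : ∀ f : Finset (Fin 10), (f.image τ.symm).image τ = f := fun f => by rw [Finset.image_image]; simp
  constructor
  · intro h' f
    rw [h' (f.image τ), key, im]
  · intro h' f
    rw [key, h' (f.image τ.symm), im']

theorem iso_iff_eqv {O O' : ℕ → ℕ → ℕ} {S S' : TriSurface 10} (h : Good O) (h' : Good O')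
    (hS : Rep S (trip O)) (hS' : Rep S' (trip O')) : S.Iso S' ↔ Eqv O O' := by
  constructor
  · rintro ⟨τ, hτ⟩
    obtain ⟨σ, hσ, e⟩ := exists_label_perm τ
    rcases (h.relabel hσ).eq_or_flip h' ((rep_relabel hS e).2 hτ) hS' with rfl | rfl
    · exact ⟨σ, hσ, Or.inl rfl⟩
    · exact ⟨σ, hσ, Or.inr rfl⟩
  · rintro ⟨σ, hσ, rfl | rfl⟩ <;> obtain ⟨τ, e⟩ := exists_vertex_perm hσ
    · exact ⟨τ, (rep_relabel hS e).1 hS'⟩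
    · exact ⟨τ, (rep_relabel (rep_flip hS) e).1 hS'⟩

set_option maxRecDepth 100000 in
theorem len_start_3_3 : Nat.beq (len (start 3 3) 0) 0 = true := by decide +kernel

set_option maxRecDepth 100000 in
theorem len_start_3_4 : Nat.beq (len (start 3 4) 0) 0 = true := by decide +kernel

set_option maxRecDepth 100000 in
theorem len_start_3_5 : Nat.beq (len (start 3 5) 0) 0 = true := by decide +kernel

set_option maxRecDepth 100000 in
theorem len_start_3_6 : Nat.beq (len (start 3 6) 0) 1 = true := by decide +kernel

set_option maxRecDepth 100000 in
theorem len_start_3_7 : Nat.beq (len (start 3 7) 0) 107 = true := by decide +kernel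

set_option maxRecDepth 100000 in
theorem len_start_3_8 : Nat.beq (len (start 3 8) 0) 661 = true := by decide +kernel

set_option maxRecDepth 100000 in
theorem len_start_3_9 : Nat.beq (len (start 3 9) 0) 453 = true := by decide +kernel

set_option maxRecDepth 100000 in
theorem len_start_4_4 : Nat.beq (len (start 4 4) 0) 0 = true := by decide +kernel

set_option maxRecDepth 100000 in
theorem len_start_4_5 : Nat.beq (len (start 4 5) 0) 0 = true := by decide +kernel

set_option maxRecDepth 100000 in
theorem len_start_4_6 : Nat.beq (len (start 4 6) 0) 2 = true := by decide +kernel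

set_option maxRecDepth 100000 in
theorem len_start_4_7 : Nat.beq (len (start 4 7) 0) 125 = true := by decide +kernel

set_option maxRecDepth 100000 in
theorem len_start_4_8 : Nat.beq (len (start 4 8) 0) 446 = true := by decide +kernel

set_option maxRecDepth 100000 in
theorem len_start_4_9 : Nat.beq (len (start 4 9) 0) 202 = true := by decide +kernel

set_option maxRecDepth 100000 in
theorem len_start_5_5 : Nat.beq (len (start 5 5) 0) 0 = true := by decide +kernel

set_option maxRecDepth 100000 in
theorem len_start_5_6 : Nat.beq (len (start 5 6) 0) 1 = true := by decide +kernel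

set_option maxRecDepth 100000 in
theorem len_start_5_7 : Nat.beq (len (start 5 7) 0) 41 = true := by decide +kernel

set_option maxRecDepth 100000 in
theorem len_start_5_8 : Nat.beq (len (start 5 8) 0) 54 = true := by decide +kernel

set_option maxRecDepth 100000 in
theorem len_start_5_9 : Nat.beq (len (start 5 9) 0) 15 = true := by decide +kernel

set_option maxRecDepth 100000 in
theorem len_start_6_6 : Nat.beq (len (start 6 6) 0) 1 = true := by decide +kernel

set_option maxRecDepth 100000 in
theorem len_start_6_7 : Nat.beq (len (start 6 7) 0) 0 = true := by decide +kernel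

set_option maxRecDepth 100000 in
theorem len_start_6_8 : Nat.beq (len (start 6 8) 0) 0 = true := by decide +kernel

set_option maxRecDepth 100000 in
theorem len_start_6_9 : Nat.beq (len (start 6 9) 0) 0 = true := by decide +kernel

/-! ### Counting -/

theorem len_eq (l : List ℕ) (n : ℕ) : len l n = l.length + n := by
  induction l generalizing n with
  | nil => exact (Nat.zero_add n).symm
  | cons a l ih =>
    have : len (a :: l) n = len l (n + 1) :=
      force_eq (Nat.succ n) (len l)
    rw [this, ih, List.length_cons]
    omega

/-- The possible degrees of the first two labels. -/
def degrees : List (ℕ × ℕ) :=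
  (List.range' 3 4).flatMap fun d0 => (List.range' d0 (10 - d0)).map fun d1 => (d0, d1)

/-- A list of the tori. -/
noncomputable def tori : List ℕ := degrees.flatMap fun d => start d.1 d.2

theorem exists_degrees {x : ℕ} (h : x ∈ tori) : ∃ d0 d1, x ∈ start d0 d1 := by
  obtain ⟨d, -, hd⟩ := List.mem_flatMap.1 h
  exact ⟨_, _, hd⟩

theorem good_of_mem {x : ℕ} (h : x ∈ tori) : Good (tab x) := by
  obtain ⟨d0, d1, h⟩ := exists_degrees h
  obtain ⟨p, hp, -⟩ := (search_sep 101 _ _ _ _ _ _ _ _).1 x h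
  exact (accept_sound hp).good

theorem pairwise_tori : tori.Pairwise fun x x' => ¬Eqv (tab x) (tab x') := by
  refine List.pairwise_flatMap.2 ⟨fun d _ => (search_sep 101 _ _ _ _ _ _ _ _).2, ?_⟩
  have : degrees.Pairwise (· ≠ ·) := by decide
  refine this.imp fun {d d'} hd x hx x' hx' e => hd ?_
  obtain ⟨p, hp, -⟩ := (search_sep 101 _ _ _ _ _ _ _ _).1 x hx
  obtain ⟨p', hp', -⟩ := (search_sep 101 _ _ _ _ _ _ _ _).1 x' hx'
  have := (accept_sound hp).degrees_eq (accept_sound hp') e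
  exact Prod.ext this.1 this.2

theorem exists_tori {O : ℕ → ℕ → ℕ} (hO : Good O) : ∃ x ∈ tori, Eqv O (tab x) := by
  obtain ⟨d0, d1, h1, h2, h3, h4, x, hx, e⟩ := exists_start hO
  refine ⟨x, List.mem_flatMap.2 ⟨(d0, d1), List.mem_flatMap.2 ⟨d0, ?_, ?_⟩, hx⟩, e⟩
  · simp [List.mem_range']; exact ⟨d0 - 3, by omega⟩
  · refine List.mem_map.2 ⟨d1, ?_, rfl⟩
    simp [List.mem_range']; exact ⟨d1 - d0, by omega⟩

theorem length_start {d0 d1 n : ℕ} (h : Nat.beq (len (start d0 d1) 0) n = true) :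
    (start d0 d1).length = n := by
  rw [← Nat.eq_of_beq_eq_true h, len_eq, Nat.add_zero]

theorem length_tori : tori.length = 2109 := by
  have h : degrees = [(3, 3), (3, 4), (3, 5), (3, 6), (3, 7), (3, 8), (3, 9), (4, 4), (4, 5),
    (4, 6), (4, 7), (4, 8), (4, 9), (5, 5), (5, 6), (5, 7), (5, 8), (5, 9), (6, 6), (6, 7),
    (6, 8), (6, 9)] := by decide
  rw [tori, h]
  simp only [List.flatMap_cons, List.flatMap_nil, List.length_append, List.length_nil,
    length_start len_start_3_3, length_start len_start_3_4, length_start len_start_3_5,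
    length_start len_start_3_6, length_start len_start_3_7, length_start len_start_3_8,
    length_start len_start_3_9, length_start len_start_4_4, length_start len_start_4_5,
    length_start len_start_4_6, length_start len_start_4_7, length_start len_start_4_8,
    length_start len_start_4_9, length_start len_start_5_5, length_start len_start_5_6,
    length_start len_start_5_7, length_start len_start_5_8, length_start len_start_5_9,
    length_start len_start_6_6, length_start len_start_6_7, length_start len_start_6_8,
    length_start len_start_6_9]

theorem iso_equivalence (n : ℕ) : Equivalence (TriSurface.Iso (n := n)) where
  refl S := ⟨1, fun f => by simp⟩
  symm := fun ⟨σ, h⟩ => ⟨σ.symm, fun f => by rw [h (f.image σ.symm), Finset.image_image]; simp⟩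
  trans := fun ⟨σ, h⟩ ⟨τ, h'⟩ => ⟨τ * σ, fun f => by
    rw [h, h', Finset.image_image, Equiv.Perm.coe_mul]⟩

end Tor

/-- There are exactly 2109 combinatorial isomorphism classes of orientable triangulated
surfaces with 10 vertices and Euler characteristic 0 (triangulations of the torus). -/
theorem num_tori_10_vertices :
    Nat.card (Quot (fun S T : {S : TriSurface 10 // S.Orientable ∧ S.eulerChar = 0} =>
      S.1.Iso T.1)) = 2109 := by
  have ex : ∀ i : Fin Tor.tori.length, ∃ S : {S : TriSurface 10 // S.Orientable ∧ S.eulerChar = 0},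
      Tor.Rep S.1 (Tor.trip (Tor.tab Tor.tori[i])) := fun i => by
    obtain ⟨S, h, hS⟩ := (Tor.good_of_mem (List.getElem_mem i.2)).exists_surface
    exact ⟨⟨S, h⟩, hS⟩
  choose S hS using ex
  have good : ∀ i : Fin Tor.tori.length, Tor.Good (Tor.tab Tor.tori[i]) := fun i =>
    Tor.good_of_mem (List.getElem_mem i.2)
  have bij : Function.Bijective fun i => Quot.mk (fun S T : {S : TriSurface 10 //
      S.Orientable ∧ S.eulerChar = 0} => S.1.Iso T.1) (S i) := by
    constructor
    · intro i j e
      have e := (((Tor.iso_equivalence 10).comap Subtype.val).eqvGen_iff).1 (Quot.eqvGen_exact e)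
      have e := (Tor.iso_iff_eqv (good i) (good j) (hS i) (hS j)).1 e
      have key := List.pairwise_iff_getElem.1 Tor.pairwise_tori
      rcases lt_trichotomy i j with h | h | h
      · exact absurd e (key i j i.2 j.2 h)
      · exact h
      · exact absurd e.symm (key j i j.2 i.2 h)
    · rintro ⟨T⟩
      obtain ⟨T', ho, hT'⟩ := Tor.Ori.exists_of_orientable T.2.1
      obtain ⟨O, hO, rfl⟩ := Tor.exists_good_of_ori ho hT' T.2.2
      obtain ⟨x, hx, e⟩ := Tor.exists_tori hO
      obtain ⟨i, hi, rfl⟩ := List.getElem_of_mem hx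
      exact ⟨⟨i, hi⟩, Quot.sound ((Tor.iso_iff_eqv (good ⟨i, hi⟩) hO (hS ⟨i, hi⟩) hT').2 e.symm)⟩
  rw [← Nat.card_congr (Equiv.ofBijective _ bij), Nat.card_fin, Tor.length_tori]
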